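/- Let E ⊂ ℝ² be a compact set. If the Hausdorff dimension of E is greater than 8/5, then the 3-dimensional Lebesgue measure of T_2(E) is positive. -/

import Mathlib

open MeasureTheory Metric Set Topology
open scoped ENNReal

noncomputable section

/-- `ℝ^d` as Euclidean space. -/
abbrev Pt (d : ℕ) := EuclideanSpace ℝ (Fin d)

/-- The index set of pairs `i < j` in `{1, …, k+1}`; it has `k(k+1)/2` elements. -/
abbrev PairIdx (k : ℕ) : Type := {p : Fin (k+1) × Fin (k+1) // p.1 < p.2}

/-- The map sending a `(k+1)`-tuple of points to its vector of pairwise distances. -/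
def simplexMap (d k : ℕ) (x : Fin (k+1) → Pt d) : PairIdx k → ℝ :=
  fun p => dist (x p.1.1) (x p.1.2)

/-- A `(k+1)`-tuple is nondegenerate if `x^2 - x^1, …, x^{k+1} - x^1` are linearly
independent. -/
def Nondeg (d k : ℕ) (x : Fin (k+1) → Pt d) : Prop :=
  LinearIndependent ℝ (fun i : Fin k => x i.succ - x 0)

/-- `T_k(E)`: the set of congruence classes of nondegenerate `k`-simplices with vertices in `E`,
realized as a subset of `ℝ^{k(k+1)/2}` via the pairwise-distance map. -/
def Tconf (d k : ℕ) (E : Set (Pt d)) : Set (PairIdx k → ℝ) :=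
  simplexMap d k '' {x | (∀ i, x i ∈ E) ∧ Nondeg d k x}

section
/-- the additive character `exp(2πix)` -/
def ee (x : ℝ) : ℂ := Complex.exp (2 * Real.pi * x * Complex.I)

lemma ee_add (x y : ℝ) : ee (x + y) = ee x * ee y := by
  unfold ee; rw [← Complex.exp_add]; push_cast; ring_nf

lemma ee_zero : ee 0 = 1 := by simp [ee]

lemma norm_ee (x : ℝ) : ‖ee x‖ = 1 := by
  unfold ee
  rw [show (2 * Real.pi * x * Complex.I : ℂ) = ((2 * Real.pi * x : ℝ) : ℂ) * Complex.I by push_cast; ring]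
  exact Complex.norm_exp_ofReal_mul_I _

lemma enorm_ee (x : ℝ) : ‖ee x‖ₑ = 1 := by
  rw [← ofReal_norm, norm_ee]; simp

lemma conj_ee (x : ℝ) : (starRingEnd ℂ) (ee x) = ee (-x) := by
  unfold ee; rw [← Complex.exp_conj]; simp [Complex.conj_ofNat]

@[fun_prop] lemma continuous_ee : Continuous ee := by unfold ee; fun_prop
@[fun_prop] lemma measurable_ee : Measurable ee := continuous_ee.measurable

lemma hasDerivAt_ee (x : ℝ) : HasDerivAt ee (2 * Real.pi * Complex.I * ee x) x := by
  unfold ee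
  have h : HasDerivAt (fun x : ℝ => (2 * Real.pi * x * Complex.I : ℂ)) (2 * Real.pi * Complex.I) x := by
    have := ((Complex.ofRealCLM.hasDerivAt (x := x)).const_mul (2 * Real.pi : ℂ)).mul_const Complex.I
    simpa using this
  simpa [mul_comm] using h.cexp

lemma enorm_sq_eq (z : ℂ) : ‖z‖ₑ ^ 2 = ENNReal.ofReal (‖z‖ ^ 2) := by
  rw [← ofReal_norm, ENNReal.ofReal_pow (norm_nonneg _)]

section PL
variable {V : Type*} [NormedAddCommGroup V] [InnerProductSpace ℝ V] [FiniteDimensional ℝ V]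
  [MeasurableSpace V] [BorelSpace V]

/-- Fourier transform of the Gaussian `exp(-b‖v‖²)` -/
def gK (V : Type*) [NormedAddCommGroup V] [InnerProductSpace ℝ V] (b : ℝ) (w : V) : ℝ :=
  (Real.pi / b) ^ (Module.finrank ℝ V / 2 : ℝ) * Real.exp (-Real.pi ^ 2 * ‖w‖ ^ 2 / b)

lemma gK_nonneg {b : ℝ} (hb : 0 < b) (w : V) : 0 ≤ gK V b w := by
  unfold gK; positivity

lemma continuous_gK (b : ℝ) : Continuous (gK V b) := by
  unfold gK; fun_prop

lemma gauss_FT {b : ℝ} (hb : 0 < b) (w : V) :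
    ∫ v : V, (Real.exp (-b * ‖v‖ ^ 2) : ℂ) * ee (inner ℝ v w) = (gK V b w : ℂ) := by
  have := GaussianFourier.integral_cexp_neg_mul_sq_norm_add (V := V) (b := (b:ℂ)) (by simpa using hb)
    (2 * Real.pi * Complex.I) w
  rw [show (fun v : V => (Real.exp (-b * ‖v‖ ^ 2) : ℂ) * ee (inner ℝ v w)) =
    fun v : V => Complex.exp (-b * ‖v‖ ^ 2 + 2 * Real.pi * Complex.I * (inner ℝ w v)) from ?_, this]
  · unfold gK
    push_cast
    rw [Complex.ofReal_cpow (by positivity)]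
    push_cast
    congr 2
    rw [mul_pow, mul_pow, Complex.I_sq]; field_simp; ring
  · ext v
    unfold ee
    rw [real_inner_comm, Complex.exp_add]; push_cast; ring_nf

lemma integrable_gauss {b : ℝ} (hb : 0 < b) :
    Integrable (fun v : V => Real.exp (-b * ‖v‖ ^ 2)) := by
  have := GaussianFourier.integrable_cexp_neg_mul_sq_norm_add (V := V) (b := (b:ℂ)) (by simpa using hb) 0 0
  have h2 := this.norm
  refine h2.congr (Filter.Eventually.of_forall fun v => ?_)
  simp only [zero_mul, add_zero]
  rw [Complex.norm_exp]
  congr 1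
  rw [show -(b:ℂ) * (‖v‖:ℂ) ^ 2 = ((-b * ‖v‖ ^ 2 : ℝ) : ℂ) by push_cast; ring, Complex.ofReal_re]

lemma lintegral_gK {b : ℝ} (hb : 0 < b) : ∫⁻ w : V, ENNReal.ofReal (gK V b w) = 1 := by
  have hc : 0 < Real.pi ^ 2 / b := by positivity
  have e : gK V b = fun w => (Real.pi / b) ^ (Module.finrank ℝ V / 2 : ℝ) *
      Real.exp (-(Real.pi ^ 2 / b) * ‖w‖ ^ 2) := by
    ext w; unfold gK; congr 2; ring
  rw [← ofReal_integral_eq_lintegral_ofReal]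
  · rw [e, integral_const_mul, GaussianFourier.integral_rexp_neg_mul_sq_norm hc,
      ← Real.mul_rpow (by positivity) (by positivity)]
    rw [show Real.pi / b * (Real.pi / (Real.pi ^ 2 / b)) = 1 by field_simp]
    simp
  · rw [e]; exact (integrable_gauss hc).const_mul _
  · exact Filter.Eventually.of_forall fun w => gK_nonneg hb w

variable {X : Type*} [MeasurableSpace X] {m : Measure X} [SFinite m]

lemma PL_gauss {q : X → V} (hq : Measurable q) {c : ℝ≥0∞} (hm : m.map q ≤ c • volume)
    {h : X → ℂ} (hh : Integrable h m) {b : ℝ} (hb : 0 < b) :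
    ∫⁻ ξ : V, ENNReal.ofReal (Real.exp (-b * ‖ξ‖ ^ 2)) * ‖∫ t, h t * ee (inner ℝ ξ (q t)) ∂m‖ₑ ^ 2
      ≤ c * ∫⁻ t, ‖h t‖ₑ ^ 2 ∂m := by
  set F : V → ℂ := fun ξ => ∫ t, h t * ee (inner ℝ ξ (q t)) ∂m with hF
  have hsq : ∀ ξ, (F ξ) * (starRingEnd ℂ) (F ξ) =
      ∫ p : X × X, (h p.1 * (starRingEnd ℂ) (h p.2)) * ee (inner ℝ ξ (q p.1 - q p.2)) ∂(m.prod m) := by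
    intro ξ
    rw [hF]
    simp only
    rw [← integral_conj, ← integral_prod_mul]
    congr 1; ext p
    simp only [map_mul, conj_ee]
    rw [inner_sub_right, sub_eq_add_neg, ee_add]; ring
  have hhp : Integrable (fun p : X × X => h p.1 * (starRingEnd ℂ) (h p.2)) (m.prod m) := by
    exact Integrable.mul_prod (g := fun x => (starRingEnd ℂ) (h x)) hh
      (Complex.conjCLE.toContinuousLinearMap.integrable_comp hh)
  have hint : Integrable (fun z : V × (X × X) => (Real.exp (-b * ‖z.1‖ ^ 2) : ℂ) *
      ((h z.2.1 * (starRingEnd ℂ) (h z.2.2)) * ee (inner ℝ z.1 (q z.2.1 - q z.2.2))))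
      ((volume : Measure V).prod (m.prod m)) := by
    have h1 := ((integrable_gauss (V := V) hb).ofReal (𝕜 := ℂ)).mul_prod hhp
    refine h1.mono ?_ ?_
    · have h2 := h1.aestronglyMeasurable
      have h3 : AEStronglyMeasurable (fun z : V × (X × X) => ee (inner ℝ z.1 (q z.2.1 - q z.2.2)))
        ((volume : Measure V).prod (m.prod m)) := by
        apply Measurable.aestronglyMeasurable
        fun_prop
      have := h2.mul h3
      refine this.congr (Filter.Eventually.of_forall fun z => ?_)
      simp [mul_assoc]
    · refine Filter.Eventually.of_forall fun z => ?_
      simp only [norm_mul, norm_ee, mul_one]; simp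
  have hFsq : ∀ ξ, ((‖F ξ‖ ^ 2 : ℝ) : ℂ) = (F ξ) * (starRingEnd ℂ) (F ξ) := by
    intro ξ; rw [Complex.mul_conj, Complex.normSq_eq_norm_sq]
  have key : ∫ ξ : V, ((Real.exp (-b * ‖ξ‖ ^ 2) * ‖F ξ‖ ^ 2 : ℝ) : ℂ) =
      ∫ p : X × X, (h p.1 * (starRingEnd ℂ) (h p.2)) * (gK V b (q p.1 - q p.2) : ℂ) ∂(m.prod m) := by
    calc _ = ∫ ξ : V, ∫ p : X × X, (Real.exp (-b * ‖ξ‖ ^ 2) : ℂ) *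
      ((h p.1 * (starRingEnd ℂ) (h p.2)) * ee (inner ℝ ξ (q p.1 - q p.2))) ∂(m.prod m) := by
          congr 1; ext ξ
          rw [integral_const_mul, ← hsq, ← hFsq]; push_cast; ring
      _ = _ := by
          rw [integral_integral_swap hint]
          congr 1; ext p
          rw [← gauss_FT hb, ← integral_const_mul]
          congr 1; ext ξ; ring
  have hint1 : Integrable (fun ξ : V => Real.exp (-b * ‖ξ‖ ^ 2) * ‖F ξ‖ ^ 2) := by
    have := hint.integral_prod_left
    have h3 : Integrable (fun ξ : V => ((Real.exp (-b * ‖ξ‖ ^ 2) * ‖F ξ‖ ^ 2 : ℝ) : ℂ)) := by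
      refine this.congr (Filter.Eventually.of_forall fun ξ => ?_)
      simp only
      rw [integral_const_mul, ← hsq, ← hFsq]; push_cast; ring
    exact h3.re
  have e1 : ∫⁻ ξ : V, ENNReal.ofReal (Real.exp (-b * ‖ξ‖ ^ 2)) * ‖F ξ‖ₑ ^ 2 =
      ‖∫ p : X × X, (h p.1 * (starRingEnd ℂ) (h p.2)) * (gK V b (q p.1 - q p.2) : ℂ) ∂(m.prod m)‖ₑ := by
    rw [← key, integral_complex_ofReal, ← ofReal_norm, Complex.norm_real, Real.norm_of_nonneg,
      ofReal_integral_eq_lintegral_ofReal hint1]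
    · congr 1; ext ξ; rw [enorm_sq_eq, ENNReal.ofReal_mul (Real.exp_nonneg _)]
    · exact Filter.Eventually.of_forall fun ξ => by positivity
    · exact integral_nonneg fun ξ => by positivity
  rw [e1]
  have hg : ∀ x : V, ∫⁻ u, ENNReal.ofReal (gK V b (x - q u)) ∂m ≤ c := by
    intro x
    have hmg : Measurable (fun y : V => ENNReal.ofReal (gK V b (x - y))) := by
      have := (continuous_gK (V := V) b).measurable
      fun_prop
    calc _ = ∫⁻ y, ENNReal.ofReal (gK V b (x - y)) ∂(m.map q) := by rw [lintegral_map hmg hq]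
      _ ≤ ∫⁻ y, ENNReal.ofReal (gK V b (x - y)) ∂(c • volume) := lintegral_mono' hm le_rfl
      _ = c * ∫⁻ y, ENNReal.ofReal (gK V b (x - y)) := by rw [lintegral_smul_measure]; rfl
      _ = c := by
        rw [lintegral_sub_left_eq_self (fun y => ENNReal.ofReal (gK V b y)) x, lintegral_gK hb, mul_one]
  have hsym : ∀ x : V, gK V b (-x) = gK V b x := by intro x; unfold gK; simp
  have hKm : Measurable (fun p : X × X => ENNReal.ofReal (gK V b (q p.1 - q p.2))) := by
    have := (continuous_gK (V := V) b).measurable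
    fun_prop
  have hhm : AEMeasurable (fun t => ‖h t‖ₑ ^ 2) m := hh.aestronglyMeasurable.enorm.pow_const 2
  have b1 : ∫⁻ p : X × X, ‖h p.1‖ₑ ^ 2 * ENNReal.ofReal (gK V b (q p.1 - q p.2)) ∂(m.prod m)
      ≤ c * ∫⁻ t, ‖h t‖ₑ ^ 2 ∂m := by
    have hx : AEMeasurable (fun p : X × X => ‖h p.1‖ₑ ^ 2 * ENNReal.ofReal (gK V b (q p.1 - q p.2)))
        (m.prod m) := by
      refine AEMeasurable.mul ?_ hKm.aemeasurable
      exact hhm.comp_fst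
    rw [lintegral_prod _ hx]
    calc _ ≤ ∫⁻ t, ‖h t‖ₑ ^ 2 * c ∂m := by
          refine lintegral_mono fun t => ?_
          simp only
          rw [lintegral_const_mul' _ _ (by simp)]
          gcongr; exact hg _
      _ = _ := by rw [lintegral_mul_const'' _ hhm, mul_comm]
  have b2 : ∫⁻ p : X × X, ‖h p.2‖ₑ ^ 2 * ENNReal.ofReal (gK V b (q p.1 - q p.2)) ∂(m.prod m)
      ≤ c * ∫⁻ t, ‖h t‖ₑ ^ 2 ∂m := by
    refine le_trans (le_of_eq ?_) b1
    rw [← lintegral_prod_swap]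
    congr 1; ext p
    simp only [Prod.fst_swap, Prod.snd_swap]
    rw [← hsym, neg_sub]
  calc _ ≤ ∫⁻ p : X × X, ‖h p.1‖ₑ * ‖h p.2‖ₑ * ENNReal.ofReal (gK V b (q p.1 - q p.2)) ∂(m.prod m) := by
        refine (enorm_integral_le_lintegral_enorm _).trans (le_of_eq ?_)
        congr 1; ext p
        rw [enorm_mul, enorm_mul]
        congr 1
        · congr 1; exact RCLike.enorm_conj _
        · rw [← ofReal_norm, Complex.norm_real, Real.norm_of_nonneg (gK_nonneg hb _)]
    _ ≤ ∫⁻ p : X × X, 2⁻¹ * (‖h p.1‖ₑ ^ 2 * ENNReal.ofReal (gK V b (q p.1 - q p.2)) +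
          ‖h p.2‖ₑ ^ 2 * ENNReal.ofReal (gK V b (q p.1 - q p.2))) ∂(m.prod m) := by
        refine lintegral_mono fun p => ?_
        simp only
        rw [← add_mul, ← mul_assoc]
        refine mul_le_mul_left ?_ _
        have h2 := two_mul_le_add_sq ‖h p.1‖ ‖h p.2‖
        rw [enorm_sq_eq, enorm_sq_eq, ← ofReal_norm, ← ofReal_norm,
          ← ENNReal.ofReal_mul (norm_nonneg _), ← ENNReal.ofReal_add (by positivity) (by positivity),
          show (2⁻¹ : ℝ≥0∞) = ENNReal.ofReal (2⁻¹) by rw [ENNReal.ofReal_inv_of_pos]; simp; norm_num,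
          ← ENNReal.ofReal_mul (by norm_num)]
        apply ENNReal.ofReal_le_ofReal
        linarith
    _ ≤ 2⁻¹ * (c * ∫⁻ t, ‖h t‖ₑ ^ 2 ∂m + c * ∫⁻ t, ‖h t‖ₑ ^ 2 ∂m) := by
        rw [lintegral_const_mul' _ _ (by simp), lintegral_add_left']
        · gcongr
        · exact AEMeasurable.mul hhm.comp_fst hKm.aemeasurable
    _ = _ := by
        rw [← two_mul, ← mul_assoc, ENNReal.inv_mul_cancel (by simp) (by simp), one_mul]

theorem PL {q : X → V} (hq : Measurable q) {c : ℝ≥0∞} (hm : m.map q ≤ c • volume)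
    {h : X → ℂ} (hh : Integrable h m) :
    ∫⁻ ξ : V, ‖∫ t, h t * ee (inner ℝ ξ (q t)) ∂m‖ₑ ^ 2 ≤ c * ∫⁻ t, ‖h t‖ₑ ^ 2 ∂m := by
  have hFm : Measurable (fun ξ : V => ∫ t, h t * ee (inner ℝ ξ (q t)) ∂m) := by
    apply Continuous.measurable
    apply continuous_of_dominated (bound := fun t => ‖h t‖)
    · intro ξ
      exact hh.aestronglyMeasurable.mul (by apply Measurable.aestronglyMeasurable; fun_prop)
    · intro ξ; exact Filter.Eventually.of_forall fun t => by simp [norm_ee]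
    · exact hh.norm
    · exact Filter.Eventually.of_forall fun t => by fun_prop
  have hlim := lintegral_tendsto_of_tendsto_of_monotone (μ := (volume : Measure V))
    (f := fun (n : ℕ) (ξ : V) => ENNReal.ofReal (Real.exp (-(1 / ((n:ℝ) + 1)) * ‖ξ‖ ^ 2)) *
      ‖∫ t, h t * ee (inner ℝ ξ (q t)) ∂m‖ₑ ^ 2)
    (F := fun ξ => ‖∫ t, h t * ee (inner ℝ ξ (q t)) ∂m‖ₑ ^ 2)
    (fun n => by
      have := hFm.enorm.pow_const 2
      apply AEMeasurable.mul _ this.aemeasurable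
      apply Measurable.aemeasurable
      fun_prop)
    (Filter.Eventually.of_forall fun ξ n k hnk => by
      simp only
      gcongr
      )
    (Filter.Eventually.of_forall fun ξ => by
      have : Filter.Tendsto (fun n : ℕ => ENNReal.ofReal (Real.exp (-(1 / ((n:ℝ) + 1)) * ‖ξ‖ ^ 2)))
          Filter.atTop (𝓝 1) := by
        rw [show (1:ℝ≥0∞) = ENNReal.ofReal (Real.exp (-0 * ‖ξ‖ ^ 2)) by simp]
        apply ENNReal.tendsto_ofReal
        apply (Real.continuous_exp.tendsto _).comp
        apply Filter.Tendsto.mul_const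
        apply Filter.Tendsto.neg
        exact tendsto_one_div_add_atTop_nhds_zero_nat
      have h2 := ENNReal.Tendsto.mul_const (b := ‖∫ t, h t * ee (inner ℝ ξ (q t)) ∂m‖ₑ ^ 2) this
        (Or.inl one_ne_zero)
      simpa using h2)
  refine le_of_tendsto hlim (Filter.Eventually.of_forall fun n => ?_)
  exact PL_gauss hq hm hh (by positivity)

end PL
end

section
/-- admissible phase functions -/
structure Ph (φ φ' : ℝ → ℝ) : Prop where
  h0 : φ 0 = 0
  h0' : φ' 0 = 0
  hd : ∀ t, HasDerivAt φ (φ' t) t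
  lo : ∀ u t, u ≤ t → t - u ≤ φ' t - φ' u
  hi : ∀ u t, u ≤ t → φ' t - φ' u ≤ 2 * (t - u)

namespace Ph
variable {φ φ' : ℝ → ℝ}
lemma cont (h : Ph φ φ') : Continuous φ :=
  continuous_iff_continuousAt.2 fun t => (h.hd t).continuousAt
lemma abs' (h : Ph φ φ') (t : ℝ) : |φ' t| ≤ 2 * |t| := by
  rcases le_total 0 t with ht | ht
  · have h1 := h.lo 0 t ht; have h2 := h.hi 0 t ht
    rw [h.h0'] at h1 h2
    rw [abs_of_nonneg ht, abs_of_nonneg (by linarith)]; linarith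
  · have h1 := h.lo t 0 ht; have h2 := h.hi t 0 ht
    rw [h.h0'] at h1 h2
    rw [abs_of_nonpos ht, abs_of_nonpos (by linarith)]; linarith
lemma lip (h : Ph φ φ') {M : ℝ} {u v : ℝ} (hu : |u| ≤ M) (hv : |v| ≤ M) :
    |φ v - φ u| ≤ 2 * M * |v - u| := by
  have := (convex_Icc (-M) M).norm_image_sub_le_of_norm_hasDerivWithin_le
    (f := φ) (f' := φ') (C := 2 * M) (x := u) (y := v)
    (fun x _ => (h.hd x).hasDerivWithinAt) (fun x hx => by
      have h1 := h.abs' x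
      have h2 : |x| ≤ M := abs_le.2 hx
      rw [Real.norm_eq_abs]; linarith) (abs_le.1 hu) (abs_le.1 hv)
  simpa [Real.norm_eq_abs] using this
lemma bd (h : Ph φ φ') {t : ℝ} (ht : t ∈ Icc (0:ℝ) 1) : |φ t| ≤ 2 := by
  have ht' : |t| ≤ 1 := by rw [abs_of_nonneg ht.1]; exact ht.2
  have := h.lip (M := 1) (u := 0) (v := t) (by simp) ht'
  rw [h.h0] at this
  simp only [sub_zero] at this
  linarith
end Ph

/-- extension operator -/
def Eop (φ : ℝ → ℝ) (f : ℝ → ℂ) (x : ℝ × ℝ) : ℂ := ∫ t, f t * ee (x.1 * t + x.2 * φ t)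

/-- squared `L²` norm -/
def Nf (f : ℝ → ℂ) : ℝ≥0∞ := ∫⁻ t, ‖f t‖ₑ ^ 2

/-- good functions: measurable, bounded, supported in `[0,1]` -/
structure Gd (f : ℝ → ℂ) : Prop where
  meas : Measurable f
  bdd : ∃ C, ∀ t, ‖f t‖ ≤ C
  supp : ∀ t, t ∉ Icc (0:ℝ) 1 → f t = 0

lemma integrable_of_bdd_supp {f : ℝ → ℂ} (hm : Measurable f) {C : ℝ} (hC : ∀ t, ‖f t‖ ≤ C)
    {a b : ℝ} (hs : ∀ t, t ∉ Icc a b → f t = 0) : Integrable f := by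
  have h : IntegrableOn f (Icc a b) :=
    Measure.integrableOn_of_bounded (M := C) (by simp) hm.aestronglyMeasurable
      (Filter.Eventually.of_forall hC)
  rw [← integrable_indicator_iff measurableSet_Icc] at h
  rwa [indicator_eq_self.2] at h
  intro t ht; by_contra h'; exact ht (hs t h')

lemma Gd.integrable {f : ℝ → ℂ} (h : Gd f) : Integrable f := by
  obtain ⟨C, hC⟩ := h.bdd
  exact integrable_of_bdd_supp h.meas hC h.supp

lemma continuous_Eop {φ : ℝ → ℝ} (hφ : Continuous φ) {f : ℝ → ℂ} (hf : Integrable f) :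
    Continuous (Eop φ f) := by
  unfold Eop
  apply continuous_of_dominated (bound := fun t => ‖f t‖)
  · intro x
    exact hf.aestronglyMeasurable.mul (by apply Continuous.aestronglyMeasurable; fun_prop)
  · intro ξ; exact Filter.Eventually.of_forall fun t => by simp [norm_ee]
  · exact hf.norm
  · exact Filter.Eventually.of_forall fun t => by fun_prop

lemma oneD {S : Set ℝ} (hS : MeasurableSet S) {q q' : ℝ → ℝ}
    (hd : ∀ t ∈ S, HasDerivWithinAt q (q' t) S t) (inj : InjOn q S) {κ : ℝ} (hκ : 0 < κ)
    (hq : ∀ t ∈ S, κ ≤ |q' t|) (g : ℝ → ℝ≥0∞) :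
    ∫⁻ t in S, g (q t) ≤ ENNReal.ofReal κ⁻¹ * ∫⁻ y, g y := by
  have h1 := lintegral_image_eq_lintegral_abs_deriv_mul hS hd inj g
  have h2 : ENNReal.ofReal κ * ∫⁻ t in S, g (q t) ≤ ∫⁻ y, g y := by
    calc _ = ∫⁻ t in S, ENNReal.ofReal κ * g (q t) := by rw [lintegral_const_mul' _ _ (by simp)]
      _ ≤ ∫⁻ t in S, ENNReal.ofReal |q' t| * g (q t) :=
          setLIntegral_mono' hS fun t ht => by gcongr; exact hq t ht
      _ = _ := h1.symm
      _ ≤ _ := setLIntegral_le_lintegral _ _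
  calc _ = ENNReal.ofReal κ⁻¹ * (ENNReal.ofReal κ * ∫⁻ t in S, g (q t)) := by
        rw [← mul_assoc, ← ENNReal.ofReal_mul (by positivity), inv_mul_cancel₀ hκ.ne']; simp
    _ ≤ _ := by gcongr

lemma bil_map {φ φ' : ℝ → ℝ} (h : Ph φ φ') {κ : ℝ} (hκ : 0 < κ) :
    ((volume : Measure (ℝ × ℝ)).restrict {p | p.1 + κ ≤ p.2}).map
      (fun p => (⟨p.1 + p.2, φ p.1 + φ p.2⟩ : ℂ)) ≤ ENNReal.ofReal κ⁻¹ • volume := by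
  have hc := h.cont
  set q : ℝ × ℝ → ℂ := fun p => (⟨p.1 + p.2, φ p.1 + φ p.2⟩ : ℂ) with hq
  have hqm : Measurable q := by
    have : q = fun p => Complex.equivRealProdCLM.symm (p.1 + p.2, φ p.1 + φ p.2) := by
      ext p; apply Complex.ext <;> simp [q]
    rw [this]
    have h3 := Complex.equivRealProdCLM.symm.continuous
    apply Continuous.measurable
    exact h3.comp (by fun_prop)
  have hSm : MeasurableSet {p : ℝ × ℝ | p.1 + κ ≤ p.2} :=
    measurableSet_le (by fun_prop) (by fun_prop)
  rw [Measure.le_iff]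
  intro B hB
  rw [Measure.map_apply hqm hB, Measure.restrict_apply (hqm hB)]
  set g : ℝ → ℝ → ℝ≥0∞ := fun a b => B.indicator 1 (⟨a, b⟩ : ℂ) with hg
  have hgm : Measurable (fun p : ℝ × ℝ => g p.1 p.2) := by
    have : (fun p : ℝ × ℝ => g p.1 p.2) = fun p => B.indicator 1 (Complex.measurableEquivRealProd.symm p) := by
      ext p; rfl
    rw [this]
    exact (measurable_one.indicator hB).comp (MeasurableEquiv.measurable _)
  have hB' : volume B = ∫⁻ a, ∫⁻ b, g a b := by
    rw [← lintegral_prod (fun p : ℝ × ℝ => g p.1 p.2) hgm.aemeasurable,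
      ← Measure.volume_eq_prod, ← lintegral_indicator_one hB]
    rw [← Complex.volume_preserving_equiv_real_prod.symm.lintegral_comp_emb
      (MeasurableEquiv.measurableEmbedding _)]
    rfl
  set G : ℝ → ℝ → ℝ≥0∞ := fun t u =>
    ({p : ℝ × ℝ | p.1 + κ ≤ p.2}.indicator (fun p => g (p.1 + p.2) (φ p.1 + φ p.2))) (t, u) with hG
  have hGm : Measurable (fun p : ℝ × ℝ => G p.1 p.2) := by
    apply Measurable.indicator _ hSm
    have : Measurable (fun p : ℝ × ℝ => (p.1 + p.2, φ p.1 + φ p.2)) := by fun_prop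
    exact hgm.comp this
  have e1 : volume (q ⁻¹' B ∩ {p | p.1 + κ ≤ p.2}) = ∫⁻ t, ∫⁻ u, G t u := by
    rw [← lintegral_prod (fun p : ℝ × ℝ => G p.1 p.2) hGm.aemeasurable,
      ← Measure.volume_eq_prod, ← lintegral_indicator_one ((hqm hB).inter hSm)]
    congr 1; ext p
    simp only [G, g, indicator, mem_inter_iff, mem_preimage, mem_setOf_eq, q, Prod.mk.eta]
    split_ifs <;> simp_all
  rw [e1]
  calc ∫⁻ t, ∫⁻ u, G t u = ∫⁻ t, ∫⁻ p, G t (p - t) := by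
        congr 1; ext t
        exact (lintegral_sub_right_eq_self (fun u => G t u) t).symm
    _ = ∫⁻ p, ∫⁻ t, G t (p - t) := by
        apply lintegral_lintegral_swap
        apply Measurable.aemeasurable
        have : Measurable (fun p : ℝ × ℝ => (p.1, p.2 - p.1)) := by fun_prop
        exact hGm.comp this
    _ ≤ ∫⁻ p, ENNReal.ofReal κ⁻¹ * ∫⁻ b, g p b := by
        refine lintegral_mono fun p => ?_
        simp only
        have e2 : (fun t => G t (p - t)) = (Iic ((p - κ) / 2)).indicator
            (fun t => g p (φ t + φ (p - t))) := by
          ext t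
          simp only [G, indicator, mem_setOf_eq, mem_Iic]
          have : t + κ ≤ p - t ↔ t ≤ (p - κ) / 2 := by constructor <;> intro h <;> linarith
          simp only [this, add_sub_cancel]
        rw [e2, lintegral_indicator measurableSet_Iic]
        have hder : ∀ t, HasDerivAt (fun t => φ t + φ (p - t)) (φ' t - φ' (p - t)) t := by
          intro t
          have h1 := (h.hd (p - t)).comp t ((hasDerivAt_id t).const_sub p)
          have h2 := (h.hd t).add h1
          exact h2.congr_deriv (by ring)
        have hlt : ∀ t ∈ Iic ((p - κ) / 2), φ' t - φ' (p - t) ≤ -κ := by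
          intro t ht
          have ht' : t ≤ (p - κ) / 2 := ht
          have := h.lo t (p - t) (by linarith)
          linarith
        refine oneD (q := fun t => φ t + φ (p - t)) (q' := fun t => φ' t - φ' (p - t))
          measurableSet_Iic (fun t _ => (hder t).hasDerivWithinAt) ?_ hκ ?_ (g p)
        · apply StrictAntiOn.injOn
          apply strictAntiOn_of_deriv_neg (convex_Iic _)
          · exact fun t _ => (hder t).continuousAt.continuousWithinAt
          · intro t ht
            rw [(hder t).deriv]
            have := hlt t (interior_subset ht)
            linarith
        · intro t ht
          have := hlt t ht
          rw [abs_of_neg (by linarith)]; linarith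
    _ = _ := by
        rw [lintegral_const_mul' _ _ (by simp), ← hB']; rfl

theorem bil {φ φ' : ℝ → ℝ} (h : Ph φ φ') {κ : ℝ} (hκ : 0 < κ) {f g : ℝ → ℂ}
    (hf : Integrable f) (hg : Integrable g) (hsep : ∀ t u, f t ≠ 0 → g u ≠ 0 → t + κ ≤ u) :
    ∫⁻ x : ℝ × ℝ, ‖Eop φ f x‖ₑ ^ 2 * ‖Eop φ g x‖ₑ ^ 2 ≤ ENNReal.ofReal κ⁻¹ * (Nf f * Nf g) := by
  have hc := h.cont
  set S : Set (ℝ × ℝ) := {p | p.1 + κ ≤ p.2} with hS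
  have hSm : MeasurableSet S := measurableSet_le (by fun_prop) (by fun_prop)
  have hqm : Measurable (fun p : ℝ × ℝ => (⟨p.1 + p.2, φ p.1 + φ p.2⟩ : ℂ)) := by
    have : (fun p : ℝ × ℝ => (⟨p.1 + p.2, φ p.1 + φ p.2⟩ : ℂ)) =
        fun p => Complex.equivRealProdCLM.symm (p.1 + p.2, φ p.1 + φ p.2) := by
      ext p; apply Complex.ext <;> simp
    rw [this]
    have h3 := Complex.equivRealProdCLM.symm.continuous
    apply Continuous.measurable
    exact h3.comp (by fun_prop)
  have hint : Integrable (fun p : ℝ × ℝ => f p.1 * g p.2) := hf.mul_prod hg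
  have := PL hqm (bil_map h hκ) (h := fun p : ℝ × ℝ => f p.1 * g p.2) hint.restrict
  rw [← Complex.volume_preserving_equiv_real_prod.symm.lintegral_comp_emb
      (MeasurableEquiv.measurableEmbedding _)] at this
  refine le_trans (le_of_eq ?_) (this.trans ?_)
  · congr 1; ext x
    rw [← mul_pow, ← enorm_mul]
    congr 2
    rw [setIntegral_eq_integral_of_forall_compl_eq_zero]
    · unfold Eop
      rw [← integral_prod_mul]
      rw [← Measure.volume_eq_prod]
      congr 1; ext p
      rw [show f p.1 * ee (x.1 * p.1 + x.2 * φ p.1) * (g p.2 * ee (x.1 * p.2 + x.2 * φ p.2)) =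
        f p.1 * g p.2 * (ee (x.1 * p.1 + x.2 * φ p.1) * ee (x.1 * p.2 + x.2 * φ p.2)) by ring,
        ← ee_add]
      congr 2
      rw [Complex.inner]
      simp [Complex.measurableEquivRealProd]
      ring
    · intro p hp
      by_cases h1 : f p.1 = 0
      · simp [h1]
      · by_cases h2 : g p.2 = 0
        · simp [h2]
        · exact absurd (hsep _ _ h1 h2) hp
  · gcongr
    refine (setLIntegral_le_lintegral _ _).trans (le_of_eq ?_)
    unfold Nf
    rw [← lintegral_prod_mul (hf.aestronglyMeasurable.enorm.pow_const 2)
      (hg.aestronglyMeasurable.enorm.pow_const 2), ← Measure.volume_eq_prod]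
    congr 1; ext p; rw [enorm_mul, mul_pow]
end

section
lemma cs_sq {X : Type*} [MeasurableSpace X] {m : Measure X} {f g : X → ℝ≥0∞}
    (hf : AEMeasurable f m) (hg : AEMeasurable g m) :
    (∫⁻ x, f x * g x ∂m) ^ 2 ≤ (∫⁻ x, f x ^ 2 ∂m) * ∫⁻ x, g x ^ 2 ∂m := by
  have h := ENNReal.lintegral_mul_le_Lp_mul_Lq m Real.HolderConjugate.two_two hf hg
  have h2 := pow_le_pow_left₀ (zero_le) h 2
  refine h2.trans (le_of_eq ?_)
  rw [mul_pow]
  have e : ∀ a : ℝ≥0∞, (a ^ (1 / 2 : ℝ)) ^ 2 = a := by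
    intro a; rw [← ENNReal.rpow_natCast, ← ENNReal.rpow_mul]; norm_num
  rw [e, e]; simp

lemma cs_sqrt {X : Type*} [MeasurableSpace X] {m : Measure X} {f g : X → ℝ≥0∞}
    (hf : AEMeasurable f m) (hg : AEMeasurable g m) :
    (∫⁻ x, f x * g x ∂m) ≤ (∫⁻ x, f x ^ 2 ∂m) ^ (1 / 2 : ℝ) * (∫⁻ x, g x ^ 2 ∂m) ^ (1 / 2 : ℝ) := by
  have h := ENNReal.lintegral_mul_le_Lp_mul_Lq m Real.HolderConjugate.two_two hf hg
  simpa using h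

lemma sob0 {p p' : ℝ → ℂ} (hd : ∀ x, HasDerivAt p (p' x) x) (hc : Continuous p') (x : ℝ) :
    ‖p x‖ₑ ^ 2 ≤ ∫⁻ w in Icc (0:ℝ) 1, (‖p (x + w)‖ₑ + ‖p' (x + w)‖ₑ) ^ 2 := by
  have hcp : Continuous p := continuous_iff_continuousAt.2 fun t => (hd t).continuousAt
  have hI : ∫⁻ w in Icc (0:ℝ) 1, (1:ℝ≥0∞) = 1 := by simp
  have h1 : ∀ w ∈ Icc (0:ℝ) 1, ‖p x‖ₑ ≤ ‖p (x + w)‖ₑ + ∫⁻ v in Icc (0:ℝ) 1, ‖p' (x + v)‖ₑ := by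
    intro w hw
    have hft := intervalIntegral.integral_eq_sub_of_hasDerivAt (a := x) (b := x + w)
      (fun y _ => hd y) (hc.intervalIntegrable _ _)
    have e : p x = p (x + w) - ∫ y in x..(x + w), p' y := by rw [hft]; ring
    calc ‖p x‖ₑ ≤ ‖p (x + w)‖ₑ + ‖∫ y in x..(x + w), p' y‖ₑ := by
          nth_rewrite 1 [e]; exact enorm_sub_le
      _ ≤ _ := by
          gcongr
          rw [intervalIntegral.integral_of_le (by linarith [hw.1])]
          refine (enorm_integral_le_lintegral_enorm _).trans ?_
          have e3 : ∫⁻ v in Icc (0:ℝ) 1, ‖p' (x + v)‖ₑ = ∫⁻ y in Icc x (x + 1), ‖p' y‖ₑ := by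
            rw [← lintegral_indicator measurableSet_Icc, ← lintegral_indicator measurableSet_Icc]
            refine Eq.trans ?_ (lintegral_add_left_eq_self _ x)
            congr 1; ext v
            simp [indicator]
          rw [e3]
          apply lintegral_mono_set
          intro y hy
          exact ⟨hy.1.le, hy.2.trans (by linarith [hw.2])⟩
  have hmp := hcp.measurable
  have hmp' := hc.measurable
  have h2 : ‖p x‖ₑ ≤ ∫⁻ w in Icc (0:ℝ) 1, (‖p (x + w)‖ₑ + ‖p' (x + w)‖ₑ) := by
    calc ‖p x‖ₑ = ∫⁻ w in Icc (0:ℝ) 1, ‖p x‖ₑ := by simp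
      _ ≤ ∫⁻ w in Icc (0:ℝ) 1, (‖p (x + w)‖ₑ + ∫⁻ v in Icc (0:ℝ) 1, ‖p' (x + v)‖ₑ) :=
          setLIntegral_mono' measurableSet_Icc h1
      _ = _ := by
          rw [lintegral_add_left (by fun_prop), lintegral_add_left (by fun_prop)]; simp
  calc ‖p x‖ₑ ^ 2 ≤ (∫⁻ w in Icc (0:ℝ) 1, 1 * (‖p (x + w)‖ₑ + ‖p' (x + w)‖ₑ)) ^ 2 := by
        simp only [one_mul]; gcongr
    _ ≤ _ := by
        refine (cs_sq (by fun_prop) (by fun_prop)).trans ?_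
        simp

lemma sum3_sq (a b c : ℝ≥0∞) : (a + b + c) ^ 2 ≤ 3 * (a ^ 2 + b ^ 2 + c ^ 2) := by
  by_cases ha : a = ∞
  · simp [ha]
  by_cases hb : b = ∞
  · simp [hb]
  by_cases hc : c = ∞
  · simp [hc]
  lift a to NNReal using ha
  lift b to NNReal using hb
  lift c to NNReal using hc
  norm_cast
  rw [← NNReal.coe_le_coe]
  push_cast
  nlinarith [sq_nonneg ((a:ℝ) - b), sq_nonneg ((b:ℝ) - c), sq_nonneg ((a:ℝ) - c)]

lemma sob1 {p p' q q' : ℝ → ℂ} (hd : ∀ x, HasDerivAt p (p' x) x) (hc : Continuous p')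
    (hd2 : ∀ x, HasDerivAt q (q' x) x) (hc2 : Continuous q') (x : ℝ) :
    ‖p x‖ₑ ^ 2 * ‖q x‖ₑ ^ 2 ≤ 3 * ∫⁻ w in Icc (0:ℝ) 1, (‖p (x + w)‖ₑ ^ 2 + ‖p' (x + w)‖ₑ ^ 2) *
      (‖q (x + w)‖ₑ ^ 2 + ‖q' (x + w)‖ₑ ^ 2) := by
  have hcp : Continuous p := continuous_iff_continuousAt.2 fun t => (hd t).continuousAt
  have hcq : Continuous q := continuous_iff_continuousAt.2 fun t => (hd2 t).continuousAt
  have := sob0 (p := fun x => p x * q x) (p' := fun x => p' x * q x + p x * q' x)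
    (fun x => (hd x).mul (hd2 x)) (by fun_prop) x
  rw [enorm_mul, mul_pow] at this
  refine this.trans ?_
  rw [← lintegral_const_mul' _ _ (by simp)]
  refine lintegral_mono fun w => ?_
  simp only
  calc _ ≤ (‖p (x + w)‖ₑ * ‖q (x + w)‖ₑ + ‖p' (x + w)‖ₑ * ‖q (x + w)‖ₑ +
        ‖p (x + w)‖ₑ * ‖q' (x + w)‖ₑ) ^ 2 := by
        refine pow_le_pow_left₀ zero_le ?_ 2
        rw [add_assoc]
        refine add_le_add ?_ ?_
        · rw [enorm_mul]
        · exact (enorm_add_le _ _).trans (by rw [enorm_mul, enorm_mul])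
    _ ≤ _ := by
        refine (sum3_sq _ _ _).trans ?_
        gcongr
        rw [mul_pow, mul_pow, mul_pow, add_mul, mul_add, mul_add]
        rw [show ∀ a b c d : ℝ≥0∞, a + b + (c + d) = a + c + b + d by intros; ring]
        exact le_self_add

/-- multiplier for `∂₁` -/
def m1 (f : ℝ → ℂ) : ℝ → ℂ := fun t => f t * (2 * Real.pi * Complex.I * t)
/-- multiplier for `∂₂` -/
def m2 (φ : ℝ → ℝ) (f : ℝ → ℂ) : ℝ → ℂ := fun t => f t * (2 * Real.pi * Complex.I * φ t)

lemma norm_2pi : ‖(2 * Real.pi * Complex.I : ℂ)‖ = 2 * Real.pi := by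
  simp [abs_of_pos Real.pi_pos]

lemma norm_m1_le {f : ℝ → ℂ} (h : Gd f) (t : ℝ) : ‖m1 f t‖ ≤ 7 * ‖f t‖ := by
  by_cases ht : t ∈ Icc (0:ℝ) 1
  · unfold m1
    rw [norm_mul, norm_mul, norm_2pi, Complex.norm_real, Real.norm_of_nonneg ht.1, mul_comm]
    gcongr
    nlinarith [Real.pi_lt_d2, ht.2, ht.1, Real.pi_pos]
  · simp [m1, h.supp t ht]

lemma norm_m2_le {φ φ' : ℝ → ℝ} (hφ : Ph φ φ') {f : ℝ → ℂ} (h : Gd f) (t : ℝ) :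
    ‖m2 φ f t‖ ≤ 14 * ‖f t‖ := by
  by_cases ht : t ∈ Icc (0:ℝ) 1
  · unfold m2
    rw [norm_mul, norm_mul, norm_2pi, Complex.norm_real, Real.norm_eq_abs, mul_comm]
    gcongr
    nlinarith [Real.pi_lt_d2, hφ.bd ht, abs_nonneg (φ t), Real.pi_pos]
  · simp [m2, h.supp t ht]

lemma Gd.m1 {f : ℝ → ℂ} (h : Gd f) : Gd (m1 f) where
  meas := by have := h.meas; unfold _root_.m1; fun_prop
  bdd := by
    obtain ⟨C, hC⟩ := h.bdd
    exact ⟨7 * C, fun t => (norm_m1_le h t).trans (by gcongr; exact hC t)⟩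
  supp := fun t ht => by simp [_root_.m1, h.supp t ht]

lemma Gd.m2 {φ φ' : ℝ → ℝ} (hφ : Ph φ φ') {f : ℝ → ℂ} (h : Gd f) : Gd (m2 φ f) where
  meas := by have := h.meas; have := hφ.cont.measurable; unfold _root_.m2; fun_prop
  bdd := by
    obtain ⟨C, hC⟩ := h.bdd
    exact ⟨14 * C, fun t => (norm_m2_le hφ h t).trans (by gcongr; exact hC t)⟩
  supp := fun t ht => by simp [_root_.m2, h.supp t ht]

lemma Nf_le_of {f g : ℝ → ℂ} {c : ℝ} (hc : 0 ≤ c) (h : ∀ t, ‖f t‖ ≤ c * ‖g t‖) :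
    Nf f ≤ ENNReal.ofReal (c ^ 2) * Nf g := by
  unfold Nf
  rw [← lintegral_const_mul' _ _ (by simp)]
  refine lintegral_mono fun t => ?_
  simp only
  rw [enorm_sq_eq, enorm_sq_eq, ← ENNReal.ofReal_mul (by positivity), ← mul_pow]
  apply ENNReal.ofReal_le_ofReal
  gcongr; exact h t

lemma Eop_deriv1 {φ φ' : ℝ → ℝ} (hφ : Ph φ φ') {f : ℝ → ℂ} (h : Gd f) (x1 x2 : ℝ) :
    HasDerivAt (fun x1 => Eop φ f (x1, x2)) (Eop φ (m1 f) (x1, x2)) x1 := by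
  have hm := h.meas
  have hφm := hφ.cont.measurable
  unfold Eop
  refine (hasDerivAt_integral_of_dominated_loc_of_deriv_le (bound := fun t => ‖m1 f t‖)
    (F := fun x t => f t * ee (x * t + x2 * φ t))
    (F' := fun x t => m1 f t * ee (x * t + x2 * φ t)) Filter.univ_mem ?_ ?_ ?_ ?_ ?_ ?_).2
  · refine Filter.Eventually.of_forall fun x => ?_
    apply Measurable.aestronglyMeasurable; fun_prop
  · refine h.integrable.mono (by apply Measurable.aestronglyMeasurable; fun_prop) ?_
    exact Filter.Eventually.of_forall fun t => by simp [norm_ee]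
  · have := h.m1.meas
    apply Measurable.aestronglyMeasurable; fun_prop
  · exact Filter.Eventually.of_forall fun t x _ => by simp [norm_ee]
  · exact h.m1.integrable.norm
  · refine Filter.Eventually.of_forall fun t x _ => ?_
    have h1 : HasDerivAt (fun x : ℝ => x * t + x2 * φ t) t x := by
      simpa using ((hasDerivAt_id x).mul_const t).add_const (x2 * φ t)
    have h2 := ((hasDerivAt_ee (x * t + x2 * φ t)).scomp x h1).const_mul (f t)
    refine h2.congr_deriv ?_
    simp only [m1, Complex.real_smul]; ring

lemma Eop_deriv2 {φ φ' : ℝ → ℝ} (hφ : Ph φ φ') {f : ℝ → ℂ} (h : Gd f) (x1 x2 : ℝ) :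
    HasDerivAt (fun x2 => Eop φ f (x1, x2)) (Eop φ (m2 φ f) (x1, x2)) x2 := by
  have hm := h.meas
  have hφm := hφ.cont.measurable
  unfold Eop
  refine (hasDerivAt_integral_of_dominated_loc_of_deriv_le (bound := fun t => ‖m2 φ f t‖)
    (F := fun x t => f t * ee (x1 * t + x * φ t))
    (F' := fun x t => m2 φ f t * ee (x1 * t + x * φ t)) Filter.univ_mem ?_ ?_ ?_ ?_ ?_ ?_).2
  · refine Filter.Eventually.of_forall fun x => ?_
    apply Measurable.aestronglyMeasurable; fun_prop
  · refine h.integrable.mono (by apply Measurable.aestronglyMeasurable; fun_prop) ?_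
    exact Filter.Eventually.of_forall fun t => by simp [norm_ee]
  · have := (h.m2 hφ).meas
    apply Measurable.aestronglyMeasurable; fun_prop
  · exact Filter.Eventually.of_forall fun t x _ => by simp [norm_ee]
  · exact (h.m2 hφ).integrable.norm
  · refine Filter.Eventually.of_forall fun t x _ => ?_
    have h1 : HasDerivAt (fun x : ℝ => x1 * t + x * φ t) (φ t) x := by
      simpa using ((hasDerivAt_id x).mul_const (φ t)).const_add (x1 * t)
    have h2 := ((hasDerivAt_ee (x1 * t + x * φ t)).scomp x h1).const_mul (f t)
    refine h2.congr_deriv ?_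
    simp only [m2, Complex.real_smul]; ring

/-- sum of squares of the derivatives of `E f` -/
def SA (φ : ℝ → ℝ) (f : ℝ → ℂ) (x : ℝ × ℝ) : ℝ≥0∞ :=
  (‖Eop φ f x‖ₑ ^ 2 + ‖Eop φ (m2 φ f) x‖ₑ ^ 2) +
  (‖Eop φ (m1 f) x‖ₑ ^ 2 + ‖Eop φ (m2 φ (m1 f)) x‖ₑ ^ 2)

lemma measurable_SA {φ φ' : ℝ → ℝ} (hφ : Ph φ φ') {f : ℝ → ℂ} (h : Gd f) : Measurable (SA φ f) := by
  unfold SA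
  have a1 := (continuous_Eop hφ.cont h.integrable).measurable
  have a2 := (continuous_Eop hφ.cont h.m1.integrable).measurable
  have a3 := (continuous_Eop hφ.cont (h.m2 hφ).integrable).measurable
  have a4 := (continuous_Eop hφ.cont (h.m1.m2 hφ).integrable).measurable
  fun_prop

lemma box_int (G : ℝ × ℝ → ℝ≥0∞) (hG : Measurable G) (x : ℝ × ℝ) :
    ∫⁻ w in Icc (0:ℝ) 1, ∫⁻ v in Icc (0:ℝ) 1, G (x.1 + w, x.2 + v) =
      ∫⁻ w in Icc (0:ℝ) 1 ×ˢ Icc (0:ℝ) 1, G (x + w) := by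
  rw [Measure.volume_eq_prod, ← Measure.prod_restrict, lintegral_prod]
  · rfl
  · apply Measurable.aemeasurable; fun_prop

lemma sob2 {φ φ' : ℝ → ℝ} (hφ : Ph φ φ') {f g : ℝ → ℂ} (hf : Gd f) (hg : Gd g) (x : ℝ × ℝ) :
    ‖Eop φ f x‖ₑ ^ 2 * ‖Eop φ g x‖ₑ ^ 2 ≤
      9 * ∫⁻ w in Icc (0:ℝ) 1 ×ˢ Icc (0:ℝ) 1, SA φ f (x + w) * SA φ g (x + w) := by
  have hcE : ∀ {f : ℝ → ℂ}, Gd f → ∀ y, Continuous fun x => Eop φ f (x, y) := fun h y =>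
    (continuous_Eop hφ.cont h.integrable).comp (by fun_prop)
  have hcE' : ∀ {f : ℝ → ℂ}, Gd f → ∀ y, Continuous fun x => Eop φ f (y, x) := fun h y =>
    (continuous_Eop hφ.cont h.integrable).comp (by fun_prop)
  have s1 := sob1 (fun y => Eop_deriv1 hφ hf y x.2) (hcE hf.m1 x.2)
    (fun y => Eop_deriv1 hφ hg y x.2) (hcE hg.m1 x.2) x.1
  have s2 : ∀ {f g : ℝ → ℂ}, Gd f → Gd g → ∀ y : ℝ, _ := fun {f g} hf hg y =>
    sob1 (fun z => Eop_deriv2 hφ hf y z) (hcE' (hf.m2 hφ) y)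
    (fun z => Eop_deriv2 hφ hg y z) (hcE' (hg.m2 hφ) y) x.2
  refine s1.trans ?_
  rw [← box_int (fun z => SA φ f z * SA φ g z) ((measurable_SA hφ hf).mul (measurable_SA hφ hg)),
    show (9:ℝ≥0∞) = 3 * 3 by norm_num, mul_assoc]
  gcongr
  rw [← lintegral_const_mul' _ _ (by simp)]
  refine lintegral_mono fun w => ?_
  simp only
  have a : ∀ {f : ℝ → ℂ}, Gd f → ∀ y, Measurable fun v => ‖Eop φ f (y, x.2 + v)‖ₑ ^ 2 := fun h y => by
    have := (hcE' h y).measurable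
    exact (this.comp (measurable_const_add x.2)).enorm.pow_const 2
  have a0 := a hf (x.1 + w)
  have a1 := a hf.m1 (x.1 + w)
  have a2 := a (hf.m2 hφ) (x.1 + w)
  have a3 := a (hf.m1.m2 hφ) (x.1 + w)
  have b0 := a hg (x.1 + w)
  have b1 := a hg.m1 (x.1 + w)
  have b2 := a (hg.m2 hφ) (x.1 + w)
  have b3 := a (hg.m1.m2 hφ) (x.1 + w)
  unfold SA
  rw [add_mul, mul_add, mul_add]
  refine (add_le_add (add_le_add (s2 hf hg (x.1 + w)) (s2 hf hg.m1 (x.1 + w)))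
    (add_le_add (s2 hf.m1 hg (x.1 + w)) (s2 hf.m1 hg.m1 (x.1 + w)))).trans (le_of_eq ?_)
  rw [← mul_add, ← mul_add, ← mul_add, ← lintegral_add_left (by fun_prop),
    ← lintegral_add_left (by fun_prop), ← lintegral_add_left (by fun_prop)]
  congr 2; ext v
  ring

lemma sob2' {φ φ' : ℝ → ℝ} (hφ : Ph φ φ') {f : ℝ → ℂ} (hf : Gd f) (x : ℝ × ℝ) :
    ‖Eop φ f x‖ₑ ^ 2 ≤ 9 * ∫⁻ w in Icc (0:ℝ) 1 ×ˢ Icc (0:ℝ) 1, SA φ f (x + w) := by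
  have hcE : ∀ {f : ℝ → ℂ}, Gd f → ∀ y, Continuous fun x => Eop φ f (x, y) := fun h y =>
    (continuous_Eop hφ.cont h.integrable).comp (by fun_prop)
  have hcE' : ∀ {f : ℝ → ℂ}, Gd f → ∀ y, Continuous fun x => Eop φ f (y, x) := fun h y =>
    (continuous_Eop hφ.cont h.integrable).comp (by fun_prop)
  have s1 := sob1 (fun y => Eop_deriv1 hφ hf y x.2) (hcE hf.m1 x.2)
    (q := fun _ => 1) (q' := fun _ => 0) (fun y => hasDerivAt_const _ _) continuous_const x.1
  have s2 : ∀ {f : ℝ → ℂ}, Gd f → ∀ y : ℝ, _ := fun {f} hf y =>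
    sob1 (fun z => Eop_deriv2 hφ hf y z) (hcE' (hf.m2 hφ) y)
    (q := fun _ => 1) (q' := fun _ => 0) (fun y => hasDerivAt_const _ _) continuous_const x.2
  simp only [enorm_one, one_pow, mul_one, enorm_zero, ne_eq, OfNat.ofNat_ne_zero, not_false_eq_true,
    zero_pow, add_zero] at s1 s2
  refine s1.trans ?_
  rw [← box_int (fun z => SA φ f z) (measurable_SA hφ hf),
    show (9:ℝ≥0∞) = 3 * 3 by norm_num, mul_assoc]
  gcongr
  rw [← lintegral_const_mul' _ _ (by simp)]
  refine lintegral_mono fun w => ?_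
  simp only
  have a : ∀ {f : ℝ → ℂ}, Gd f → ∀ y, Measurable fun v => ‖Eop φ f (y, x.2 + v)‖ₑ ^ 2 := fun h y => by
    have := (hcE' h y).measurable
    exact (this.comp (measurable_const_add x.2)).enorm.pow_const 2
  have a0 := a hf (x.1 + w)
  have a1 := a hf.m1 (x.1 + w)
  have a2 := a (hf.m2 hφ) (x.1 + w)
  have a3 := a (hf.m1.m2 hφ) (x.1 + w)
  unfold SA
  refine (add_le_add (s2 hf (x.1 + w)) (s2 hf.m1 (x.1 + w))).trans (le_of_eq ?_)
  rw [← mul_add, ← lintegral_add_left (by fun_prop)]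

lemma box_H {H : Measure (ℝ × ℝ)} [SFinite H] {D : ℝ≥0∞} (hD : ∀ y, H (closedBall y 1) ≤ D)
    {G : ℝ × ℝ → ℝ≥0∞} (hG : Measurable G) {Q Q' : Set (ℝ × ℝ)} (hQ : MeasurableSet Q)
    (hQ' : MeasurableSet Q') (hQQ : ∀ x ∈ Q, ∀ w ∈ Icc (0:ℝ) 1 ×ˢ Icc (0:ℝ) 1, x + w ∈ Q') :
    ∫⁻ x in Q, (∫⁻ w in Icc (0:ℝ) 1 ×ˢ Icc (0:ℝ) 1, G (x + w)) ∂H ≤ D * ∫⁻ y in Q', G y := by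
  set B : Set (ℝ × ℝ) := Icc (0:ℝ) 1 ×ˢ Icc (0:ℝ) 1 with hB
  have hBm : MeasurableSet B := measurableSet_Icc.prod measurableSet_Icc
  have e1 : ∀ x, ∫⁻ w in B, G (x + w) = ∫⁻ y, B.indicator 1 (y - x) * G y := by
    intro x
    rw [← lintegral_indicator hBm]
    refine Eq.trans ?_ (lintegral_add_left_eq_self _ x)
    congr 1; ext w
    simp [indicator]
  calc _ = ∫⁻ x in Q, ∫⁻ y, B.indicator 1 (y - x) * G y ∂volume ∂H := lintegral_congr fun x => e1 x
    _ = ∫⁻ y, ∫⁻ x in Q, B.indicator 1 (y - x) * G y ∂H := by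
        apply lintegral_lintegral_swap
        apply Measurable.aemeasurable
        have h1 : Measurable (B.indicator (1 : ℝ × ℝ → ℝ≥0∞)) := measurable_one.indicator hBm
        have h2 : Measurable (fun p : (ℝ × ℝ) × (ℝ × ℝ) => p.2 - p.1) := by fun_prop
        exact (h1.comp h2).mul (hG.comp measurable_snd)
    _ ≤ ∫⁻ y, Q'.indicator (fun y => D * G y) y := by
        refine lintegral_mono fun y => ?_
        by_cases hy : y ∈ Q'
        · rw [indicator_of_mem hy]
          have h1 : Measurable (fun x => B.indicator (1 : ℝ × ℝ → ℝ≥0∞) (y - x)) :=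
            (measurable_one.indicator hBm).comp (by fun_prop)
          simp only
          rw [lintegral_mul_const _ h1]
          gcongr
          refine (setLIntegral_le_lintegral _ _).trans (le_trans ?_ (hD y))
          rw [← lintegral_indicator_one measurableSet_closedBall]
          refine lintegral_mono fun x => ?_
          simp only [indicator]
          split_ifs with h3 h4
          · exact le_rfl
          · exfalso; apply h4
            rw [hB] at h3
            obtain ⟨⟨h5, h6⟩, h7, h8⟩ := h3
            simp only [Prod.fst_sub, Prod.snd_sub] at h5 h6 h7 h8
            rw [mem_closedBall, Prod.dist_eq, max_le_iff, Real.dist_eq, Real.dist_eq, abs_le, abs_le]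
            refine ⟨⟨?_, ?_⟩, ?_, ?_⟩ <;> linarith
          · exact zero_le
          · exact le_rfl
        · rw [indicator_of_notMem hy]
          rw [nonpos_iff_eq_zero]
          rw [setLIntegral_eq_zero_iff hQ]
          · refine Filter.Eventually.of_forall fun x hx => ?_
            have : y - x ∉ B := fun h => hy (by have := hQQ x hx _ h; simpa using this)
            simp [this]
          · exact ((measurable_one.indicator hBm).comp (by fun_prop)).mul_const _
    _ = _ := by
        rw [lintegral_indicator hQ', lintegral_const_mul _ hG]
end

section
lemma slab1 {φ φ' : ℝ → ℝ} (hφ : Ph φ φ') {f : ℝ → ℂ} (hf : Gd f) (M : ℝ) :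
    ∫⁻ x in {x : ℝ × ℝ | |x.2| ≤ M}, ‖Eop φ f x‖ₑ ^ 2 ≤ ENNReal.ofReal (2 * M) * Nf f := by
  have hc := hφ.cont
  have hm := hf.meas
  have hs : {x : ℝ × ℝ | |x.2| ≤ M} = univ ×ˢ Icc (-M) M := by
    ext x; simp [abs_le]
  rw [hs, Measure.volume_eq_prod, ← Measure.prod_restrict, lintegral_prod_symm _ (by
    have := (continuous_Eop hφ.cont hf.integrable).measurable
    apply Measurable.aemeasurable; fun_prop)]
  have h1 : ∀ y : ℝ, ∫⁻ x : ℝ, ‖Eop φ f (x, y)‖ₑ ^ 2 ≤ Nf f := by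
    intro y
    have hi : Integrable (fun t => f t * ee (y * φ t)) := by
      refine hf.integrable.mono (by apply Measurable.aestronglyMeasurable; fun_prop) ?_
      exact Filter.Eventually.of_forall fun t => by simp [norm_ee]
    have := PL (V := ℝ) (m := volume) (q := fun t : ℝ => t) measurable_id (c := 1)
      (by simp) hi
    simp only [one_mul, enorm_mul, enorm_ee, mul_one] at this
    refine le_trans (le_of_eq ?_) this
    congr 1; ext x
    unfold Eop
    congr 3; ext t
    rw [mul_assoc, ← ee_add]
    congr 2
    simp [add_comm, mul_comm]
  calc _ ≤ ∫⁻ y in Icc (-M) M, Nf f := by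
        rw [Measure.restrict_univ]
        exact lintegral_mono fun y => h1 y
    _ = _ := by
        rw [setLIntegral_const, Real.volume_Icc, mul_comm]; congr 2; ring

lemma Nf_m1 {f : ℝ → ℂ} (hf : Gd f) : Nf (m1 f) ≤ 49 * Nf f := by
  have := Nf_le_of (by norm_num) (norm_m1_le hf)
  norm_num at this; exact this
lemma Nf_m2 {φ φ' : ℝ → ℝ} (hφ : Ph φ φ') {f : ℝ → ℂ} (hf : Gd f) : Nf (m2 φ f) ≤ 196 * Nf f := by
  have := Nf_le_of (by norm_num) (norm_m2_le hφ hf)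
  norm_num at this; exact this

lemma slabSA {φ φ' : ℝ → ℝ} (hφ : Ph φ φ') {f : ℝ → ℂ} (hf : Gd f) (M : ℝ) :
    ∫⁻ x in {x : ℝ × ℝ | |x.2| ≤ M}, SA φ f x ≤ 10000 * (ENNReal.ofReal (2 * M) * Nf f) := by
  have a1 := (continuous_Eop hφ.cont hf.integrable).measurable
  have a2 := (continuous_Eop hφ.cont hf.m1.integrable).measurable
  have a3 := (continuous_Eop hφ.cont (hf.m2 hφ).integrable).measurable
  have a4 := (continuous_Eop hφ.cont (hf.m1.m2 hφ).integrable).measurable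
  unfold SA
  rw [lintegral_add_left (by fun_prop), lintegral_add_left (by fun_prop),
    lintegral_add_left (by fun_prop)]
  have b1 := slab1 hφ hf M
  have b2 := (slab1 hφ hf.m1 M).trans (mul_le_mul_right (Nf_m1 hf) _)
  have b3 := (slab1 hφ (hf.m2 hφ) M).trans (mul_le_mul_right (Nf_m2 hφ hf) _)
  have b4 := (slab1 hφ (hf.m1.m2 hφ) M).trans (mul_le_mul_right ((Nf_m2 hφ hf.m1).trans
    (mul_le_mul_right (Nf_m1 hf) _)) _)
  refine (add_le_add (add_le_add b1 b3) (add_le_add b2 b4)).trans ?_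
  set X := ENNReal.ofReal (2 * M) * Nf f
  calc _ = (1 + 196 + 49 + 196 * 49) * (ENNReal.ofReal (2 * M) * Nf f) := by ring
    _ ≤ _ := by gcongr; norm_num

/-- `s`-dimensional measure in a slab -/
structure HB (s R : ℝ) (D : ℝ≥0∞) (H : Measure (ℝ × ℝ)) : Prop where
  slab : H {x | R < |x.2|} = 0
  ball : ∀ y r, 1 ≤ r → H (closedBall y r) ≤ D * ENNReal.ofReal (r ^ s)

lemma HB.ball1 {s R : ℝ} {D : ℝ≥0∞} {H : Measure (ℝ × ℝ)} (h : HB s R D H) (y : ℝ × ℝ) :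
    H (closedBall y 1) ≤ D := by simpa using h.ball y 1 le_rfl

lemma HB.restr {s R : ℝ} {D : ℝ≥0∞} {H : Measure (ℝ × ℝ)} (h : HB s R D H) :
    H.restrict {x | |x.2| ≤ R} = H := by
  apply Measure.restrict_eq_self_of_ae_mem
  rw [ae_iff]
  simpa using h.slab

/-- Weighted estimate. -/
def WW (s R : ℝ) (A : ℝ≥0∞) : Prop := ∀ φ φ' : ℝ → ℝ, Ph φ φ' → ∀ f : ℝ → ℂ, Gd f →
  ∀ (D : ℝ≥0∞) (H : Measure (ℝ × ℝ)), IsFiniteMeasure H → HB s R D H →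
    ∫⁻ x, ‖Eop φ f x‖ₑ ^ 2 ∂H ≤ A * (D * Nf f)

lemma WW_triv (s : ℝ) {R : ℝ} (hR : 1 ≤ R) : WW s R (ENNReal.ofReal (1000000 * R)) := by
  intro φ φ' hφ f hf D H _ hH
  have hms : ∀ R : ℝ, MeasurableSet {x : ℝ × ℝ | |x.2| ≤ R} := fun R =>
    measurableSet_le (by fun_prop) (by fun_prop)
  calc ∫⁻ x, ‖Eop φ f x‖ₑ ^ 2 ∂H
      ≤ ∫⁻ x, 9 * (∫⁻ w in Icc (0:ℝ) 1 ×ˢ Icc (0:ℝ) 1, SA φ f (x + w)) ∂H :=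
        lintegral_mono fun x => sob2' hφ hf x
    _ = 9 * ∫⁻ x in {x : ℝ × ℝ | |x.2| ≤ R}, (∫⁻ w in Icc (0:ℝ) 1 ×ˢ Icc (0:ℝ) 1, SA φ f (x + w)) ∂H := by
        rw [lintegral_const_mul' _ _ (by simp), hH.restr]
    _ ≤ 9 * (D * ∫⁻ y in {x : ℝ × ℝ | |x.2| ≤ R + 1}, SA φ f y) := by
        gcongr
        refine box_H hH.ball1 (measurable_SA hφ hf) (hms R) (hms _) ?_
        intro x hx w hw
        simp only [mem_setOf_eq, Prod.snd_add] at hx ⊢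
        have := hw.2
        rw [abs_le] at hx ⊢
        constructor <;> linarith [this.1, this.2]
    _ ≤ 9 * (D * (10000 * (ENNReal.ofReal (2 * (R + 1)) * Nf f))) := by
        gcongr; exact slabSA hφ hf _
    _ = (90000 * ENNReal.ofReal (2 * (R + 1))) * (D * Nf f) := by ring
    _ ≤ _ := by
        gcongr
        rw [show (90000:ℝ≥0∞) = ENNReal.ofReal 90000 by norm_num, ← ENNReal.ofReal_mul (by norm_num)]
        apply ENNReal.ofReal_le_ofReal; linarith

/-- Bessel inequality -/
lemma bessel {k : ℝ → ℂ} (hm : Measurable k) {C : ℝ} (hC : ∀ t, ‖k t‖ ≤ C)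
    (hs : ∀ t, t ∉ Icc (-(1/8):ℝ) (1/8) → k t = 0) :
    ∑' a : ℤ, ‖∫ w, k w * ee (-(a * w))‖ₑ ^ 2 ≤ ∫⁻ w, ‖k w‖ₑ ^ 2 := by
  have hab : (-(1/2):ℝ) < 1/2 := by norm_num
  have hL : MemLp k 2 (volume.restrict (Ioc (-(1/2):ℝ) (1/2))) :=
    MemLp.of_bound hm.aestronglyMeasurable C (Filter.Eventually.of_forall hC)
  have hS := hasSum_sq_fourierCoeffOn hab hL
  have hsub : ∀ h : ℝ → ℂ, (∀ t, t ∉ Icc (-(1/8):ℝ) (1/8) → h t = 0) →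
      ∫ w in (-(1/2):ℝ)..(1/2), h w = ∫ w, h w := by
    intro h hh
    rw [intervalIntegral.integral_of_le hab.le]
    apply setIntegral_eq_integral_of_forall_compl_eq_zero
    intro x hx
    apply hh
    intro h2; apply hx
    exact ⟨by linarith [h2.1], by linarith [h2.2]⟩
  have e1 : ∀ a : ℤ, ∫ w, k w * ee (-(a * w)) = fourierCoeffOn hab k a := by
    intro a
    rw [fourierCoeffOn_eq_integral, ← hsub]
    · norm_num
      apply intervalIntegral.integral_congr
      intro x _
      simp only
      rw [mul_comm]; congr 1
      rw [← Complex.exp_conj]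
      unfold ee
      congr 1
      simp only [map_mul, Complex.conj_I, Complex.conj_ofReal, map_ofNat, map_intCast]; push_cast; ring
    · intro t ht; simp [hs t ht]
  have e2 : ∀ a : ℤ, ‖∫ w, k w * ee (-(a * w))‖ₑ ^ 2 = ENNReal.ofReal (‖fourierCoeffOn hab k a‖ ^ 2) := by
    intro a; rw [e1, enorm_sq_eq]
  simp_rw [e2]
  rw [← ENNReal.ofReal_tsum_of_nonneg (fun _ => by positivity) hS.summable, hS.tsum_eq,
    intervalIntegral.integral_of_le hab.le]
  norm_num
  rw [ofReal_integral_eq_lintegral_ofReal]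
  · simp_rw [← enorm_sq_eq]
    exact setLIntegral_le_lintegral _ _
  · exact hL.integrable_norm_pow (by norm_num)
  · exact Filter.Eventually.of_forall fun _ => by positivity
end

section
lemma integrable_bdd_set {X : Type*} [MeasurableSpace X] {m : Measure X} {f : X → ℂ}
    (hm : Measurable f) {C : ℝ} (hC : ∀ t, ‖f t‖ ≤ C) {S : Set X} (hS : MeasurableSet S)
    (hSf : m S ≠ ∞) (hs : ∀ t, t ∉ S → f t = 0) : Integrable f m := by
  have h : IntegrableOn f S m :=
    Measure.integrableOn_of_bounded (M := C) hSf hm.aestronglyMeasurable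
      (Filter.Eventually.of_forall hC)
  rw [← integrable_indicator_iff hS] at h
  rwa [indicator_eq_self.2] at h
  intro t ht; by_contra h'; exact ht (hs t h')

/-- cutoff -/
def chi (δ y : ℝ) : ℂ := ∫ w, (if |w| ≤ δ then ee (y * w) else 0)

lemma chi_lb {δ y : ℝ} (hδ : 0 ≤ δ) (h : |y| * δ ≤ 1 / 8) : δ ≤ ‖chi δ y‖ := by
  have e : chi δ y = ∫ w in (-δ)..δ, ee (y * w) := by
    unfold chi
    rw [intervalIntegral.integral_of_le (by linarith), ← integral_Icc_eq_integral_Ioc,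
      ← integral_indicator measurableSet_Icc]
    congr 1; ext w
    simp [indicator, abs_le]
  have hre : (chi δ y).re = ∫ w in (-δ)..δ, Real.cos (2 * Real.pi * (y * w)) := by
    rw [e]
    have hint : IntervalIntegrable (fun w => ee (y * w)) volume (-δ) δ := by
      apply Continuous.intervalIntegrable
      exact continuous_ee.comp (by fun_prop)
    have := Complex.reCLM.intervalIntegral_comp_comm hint
    rw [← Complex.reCLM_apply, ← this]
    apply intervalIntegral.integral_congr
    intro w _
    simp only [Complex.reCLM_apply, ee]
    rw [Complex.exp_re]; simp
  have hlb : ∫ w in (-δ)..δ, (1/2:ℝ) ≤ ∫ w in (-δ)..δ, Real.cos (2 * Real.pi * (y * w)) := by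
    apply intervalIntegral.integral_mono_on (by linarith)
    · exact continuous_const.intervalIntegrable _ _
    · apply Continuous.intervalIntegrable; fun_prop
    · intro w hw
      rw [← Real.cos_pi_div_three, ← Real.cos_abs (2 * Real.pi * (y * w))]
      have hw' : |w| ≤ δ := abs_le.2 hw
      have h1 : |y * w| ≤ 1/8 := by
        rw [abs_mul]
        exact (mul_le_mul_of_nonneg_left hw' (abs_nonneg y)).trans h
      have h2 : |2 * Real.pi * (y * w)| ≤ Real.pi / 3 := by
        rw [abs_mul, abs_of_pos (by positivity)]
        nlinarith [Real.pi_pos]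
      exact Real.cos_le_cos_of_nonneg_of_le_pi (abs_nonneg _) (by linarith [Real.pi_pos]) h2
  calc δ = ∫ w in (-δ)..δ, (1/2:ℝ) := by
        rw [intervalIntegral.integral_const]; simp; ring
    _ ≤ (chi δ y).re := by rw [hre]; exact hlb
    _ ≤ _ := Complex.re_le_norm _

/-- localization kernel -/
def KK (φ : ℝ → ℝ) (g : ℝ → ℂ) (R ζ v w : ℝ) : ℂ :=
  if |w| ≤ 1/8 then (if |ζ - R * (φ (v - w / R) - φ v)| ≤ 1/16 then g (v - w / R) else 0) else 0

/-- localized function -/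
def GG (φ : ℝ → ℝ) (g : ℝ → ℂ) (R : ℝ) (a : ℤ) (ζ v : ℝ) : ℂ :=
  ∫ w, KK φ g R ζ v w * ee (-(a * w))

lemma KK_meas {φ φ' : ℝ → ℝ} (hφ : Ph φ φ') {g : ℝ → ℂ} (hg : Gd g) {R : ℝ} : Measurable (fun p : ℝ × (ℝ × ℝ) => KK φ g R p.1 p.2.1 p.2.2) := by
  have h1 := hφ.cont.measurable
  have h2 := hg.meas
  unfold KK
  refine Measurable.ite (measurableSet_le (by fun_prop) (by fun_prop)) ?_ measurable_const
  refine Measurable.ite (measurableSet_le (by fun_prop) (by fun_prop)) ?_ measurable_const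
  fun_prop

lemma KK_supp {φ φ' : ℝ → ℝ} (hφ : Ph φ φ') {g : ℝ → ℂ} (hg : Gd g) {R : ℝ} (hR : 1 ≤ R) 
    {ζ v w : ℝ} (h : KK φ g R ζ v w ≠ 0) :
    |w| ≤ 1/8 ∧ |ζ| ≤ 1 ∧ v ∈ Icc (-1:ℝ) 2 ∧ g (v - w / R) ≠ 0 ∧
      KK φ g R ζ v w = g (v - w / R) := by
  have hKK : KK φ g R ζ v w = _ := rfl
  unfold KK at h
  split_ifs at h with h1 h2
  · have h3 : v - w / R ∈ Icc (0:ℝ) 1 := by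
      by_contra h4; exact h (hg.supp _ h4)
    have h4 : |w / R| ≤ 1/8 := by
      rw [abs_div, abs_of_pos (show (0:ℝ) < R by linarith)]
      exact (div_le_self (abs_nonneg w) hR).trans h1
    have h5 := abs_le.1 h4
    have h6 := hφ.lip (M := 9/8) (u := v) (v := v - w / R)
      (abs_le.2 ⟨by linarith [h3.1, h3.2, h5.1, h5.2], by linarith [h3.1, h3.2, h5.1, h5.2]⟩)
      (abs_le.2 ⟨by linarith [h3.1, h3.2], by linarith [h3.1, h3.2]⟩)
    have h7 : |R * (φ (v - w / R) - φ v)| ≤ 9/32 := by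
      rw [abs_mul, abs_of_pos (show (0:ℝ) < R by linarith)]
      rw [show v - w / R - v = -(w / R) by ring, abs_neg, abs_div,
        abs_of_pos (show (0:ℝ) < R by linarith)] at h6
      have h8 : R * (2 * (9/8) * (|w| / R)) = 9/4 * |w| := by field_simp; ring
      nlinarith
    refine ⟨h1, ?_, ⟨by linarith [h3.1, h5.1], by linarith [h3.2, h5.2]⟩, h, ?_⟩
    · have := abs_le.1 h7; have := abs_le.1 h2
      rw [abs_le]; constructor <;> linarith
    · simp only [KK]; rw [if_pos h1, if_pos h2]
  · exact absurd rfl h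
  · exact absurd rfl h

lemma KK_le {φ φ' : ℝ → ℝ} (hφ : Ph φ φ') {g : ℝ → ℂ} (hg : Gd g) {R : ℝ} (hR : 1 ≤ R) 
    (ζ v w : ℝ) : ‖KK φ g R ζ v w‖ₑ ^ 2 ≤ (Icc (-1:ℝ) 1).indicator 1 ζ *
    ((Icc (-(1/8):ℝ) (1/8)).indicator 1 w * ‖g (v - w / R)‖ₑ ^ 2) := by
  by_cases h : KK φ g R ζ v w = 0
  · simp [h]
  · obtain ⟨h1, h2, h3, h4, h5⟩ := KK_supp hφ hg hR h
    rw [indicator_of_mem (show ζ ∈ Icc (-1:ℝ) 1 from abs_le.1 h2), indicator_of_mem (show w ∈ Icc (-(1/8):ℝ) (1/8) from abs_le.1 h1), h5]; simp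

lemma GG_meas {φ φ' : ℝ → ℝ} (hφ : Ph φ φ') {g : ℝ → ℂ} (hg : Gd g) {R : ℝ} (hR : 1 ≤ R) 
    (a : ℤ) : Measurable (fun p : ℝ × ℝ => GG φ g R a p.1 p.2) := by
  unfold GG
  apply StronglyMeasurable.measurable
  have : Measurable (fun q : (ℝ × ℝ) × ℝ => KK φ g R q.1.1 q.1.2 q.2 * ee (-(a * q.2))) := by
    have h1 : Measurable (fun q : (ℝ × ℝ) × ℝ => KK φ g R q.1.1 q.1.2 q.2) :=
      (KK_meas hφ hg).comp (g := fun p : ℝ × (ℝ × ℝ) => KK φ g R p.1 p.2.1 p.2.2)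
        (f := fun q : (ℝ × ℝ) × ℝ => (q.1.1, (q.1.2, q.2))) (by fun_prop)
    fun_prop
  exact this.stronglyMeasurable.integral_prod_right

lemma GG_supp {φ φ' : ℝ → ℝ} (hφ : Ph φ φ') {g : ℝ → ℂ} (hg : Gd g) {R : ℝ} (hR : 1 ≤ R) 
    (a : ℤ) {ζ v : ℝ} (h : GG φ g R a ζ v ≠ 0) :
    ∃ w, KK φ g R ζ v w ≠ 0 := by
  by_contra! h1
  apply h
  simp [GG, h1]

lemma KK_bdd {φ φ' : ℝ → ℝ} (hφ : Ph φ φ') {g : ℝ → ℂ} (hg : Gd g) {R : ℝ} (hR : 1 ≤ R) 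
    : ∃ C, 0 ≤ C ∧ ∀ ζ v w, ‖KK φ g R ζ v w‖ ≤ C := by
  obtain ⟨C, hC⟩ := hg.bdd
  refine ⟨C, (norm_nonneg _).trans (hC 0), fun ζ v w => ?_⟩
  by_cases h : KK φ g R ζ v w = 0
  · rw [h, norm_zero]; exact (norm_nonneg _).trans (hC 0)
  · rw [(KK_supp hφ hg hR h).2.2.2.2]; exact hC _

lemma GG_bdd {φ φ' : ℝ → ℝ} (hφ : Ph φ φ') {g : ℝ → ℂ} (hg : Gd g) {R : ℝ} (hR : 1 ≤ R) 
    : ∃ C, ∀ a ζ v, ‖GG φ g R a ζ v‖ ≤ C := by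
  obtain ⟨C, hC0, hC⟩ := KK_bdd hφ hg hR
  refine ⟨C * 2, fun a ζ v => ?_⟩
  unfold GG
  have : ∫ w, KK φ g R ζ v w * ee (-(a * w)) = ∫ w in Icc (-1:ℝ) 1, KK φ g R ζ v w * ee (-(a * w)) := by
    symm
    apply setIntegral_eq_integral_of_forall_compl_eq_zero
    intro w hw
    by_contra h
    have h1 := (KK_supp hφ hg hR (left_ne_zero_of_mul h)).1
    exact hw (abs_le.1 (h1.trans (by norm_num)))
  rw [this]
  refine (norm_setIntegral_le_of_norm_le_const (C := C) (by simp) (fun w _ => ?_)).trans ?_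
  · rw [norm_mul, norm_ee, mul_one]; exact hC _ _ _
  · norm_num [Measure.real]

lemma GG_int {φ φ' : ℝ → ℝ} (hφ : Ph φ φ') {g : ℝ → ℂ} (hg : Gd g) {R : ℝ} (hR : 1 ≤ R) 
    (a : ℤ) (ζ : ℝ) : Integrable (GG φ g R a ζ) := by
  obtain ⟨C, hC⟩ := GG_bdd hφ hg hR
  refine integrable_of_bdd_supp (C := C) (a := -1) (b := 2) ?_ (hC a ζ) ?_
  · exact (GG_meas hφ hg hR a).comp (measurable_prodMk_left)
  · intro t ht
    by_contra h
    obtain ⟨w, hw⟩ := GG_supp hφ hg hR a h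
    exact ht (KK_supp hφ hg hR hw).2.2.1

lemma EGG_meas {φ φ' : ℝ → ℝ} (hφ : Ph φ φ') {g : ℝ → ℂ} (hg : Gd g) {R : ℝ} (hR : 1 ≤ R) 
    (a : ℤ) : Measurable (fun p : ℝ × (ℝ × ℝ) => Eop φ (GG φ g R a p.1) p.2) := by
  unfold Eop
  apply StronglyMeasurable.measurable
  have hφm := hφ.cont.measurable
  have : Measurable (fun q : (ℝ × (ℝ × ℝ)) × ℝ => GG φ g R a q.1.1 q.2 *
      ee (q.1.2.1 * q.2 + q.1.2.2 * φ q.2)) := by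
    have h1 : Measurable (fun q : (ℝ × (ℝ × ℝ)) × ℝ => GG φ g R a q.1.1 q.2) :=
      (GG_meas hφ hg hR a).comp (g := fun p : ℝ × ℝ => GG φ g R a p.1 p.2)
        (f := fun q : (ℝ × (ℝ × ℝ)) × ℝ => (q.1.1, q.2)) (by fun_prop)
    fun_prop
  exact this.stronglyMeasurable.integral_prod_right

lemma loc_id {φ φ' : ℝ → ℝ} (hφ : Ph φ φ') {g : ℝ → ℂ} (hg : Gd g) {R : ℝ} (hR : 1 ≤ R) 
    (a : ℤ) (x : ℝ × ℝ) : chi (1/8) (x.1 / R - a) * chi (1/16) (x.2 / R) * Eop φ g x =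
    ∫ ζ, ee (x.2 / R * ζ) * Eop φ (GG φ g R a ζ) x := by
  have hR0 : R ≠ 0 := by linarith
  have hφm := hφ.cont.measurable
  set J : ℝ → ℝ × ℝ → ℂ := fun ζ p => ee (x.2 / R * ζ) * (KK φ g R ζ p.1 p.2 * ee (-(a * p.2)) *
    ee (x.1 * p.1 + x.2 * φ p.1)) with hJ
  obtain ⟨C, hC0, hC⟩ := KK_bdd hφ hg hR
  have hK := KK_meas hφ hg (R := R)
  have hJm : Measurable (fun q : ℝ × (ℝ × ℝ) => J q.1 q.2) := by
    simp only [hJ]; fun_prop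
  have hJb : ∀ ζ p, ‖J ζ p‖ ≤ C := fun ζ p => by
    simp only [hJ, norm_mul, norm_ee, one_mul, mul_one]; exact hC _ _ _
  have hJ0 : ∀ ζ p, J ζ p ≠ 0 → ζ ∈ Icc (-1:ℝ) 1 ∧ p ∈ Icc (-1:ℝ) 2 ×ˢ Icc (-1:ℝ) 1 := by
    intro ζ p h
    have h1 : KK φ g R ζ p.1 p.2 ≠ 0 := by
      intro h2; apply h; simp [hJ, h2]
    obtain ⟨h2, h3, h4, -⟩ := KK_supp hφ hg hR h1
    exact ⟨abs_le.1 h3, h4, abs_le.1 (h2.trans (by norm_num))⟩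
  have hJi : Integrable (fun q : ℝ × (ℝ × ℝ) => J q.1 q.2) (volume.prod volume) := by
    refine integrable_bdd_set hJm (fun q => hJb _ _)
      (S := Icc (-1:ℝ) 1 ×ˢ (Icc (-1:ℝ) 2 ×ˢ Icc (-1:ℝ) 1))
      (measurableSet_Icc.prod (measurableSet_Icc.prod measurableSet_Icc)) ?_ ?_
    · rw [Measure.prod_prod, Measure.volume_eq_prod, Measure.prod_prod]
      simp only [Real.volume_Icc]
      exact ENNReal.mul_ne_top (by simp) (ENNReal.mul_ne_top (by simp) (by simp))
    · intro t ht; by_contra h; exact ht (hJ0 _ _ h)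
  have hJi2 : ∀ ζ, Integrable (J ζ) (volume.prod volume) := by
    intro ζ
    have hJmζ : Measurable (J ζ) := hJm.comp (g := fun q : ℝ × (ℝ × ℝ) => J q.1 q.2)
      (f := fun p => (ζ, p)) (by fun_prop)
    refine integrable_bdd_set hJmζ (fun q => hJb _ _)
      (S := (Icc (-1:ℝ) 2 ×ˢ Icc (-1:ℝ) 1)) (measurableSet_Icc.prod measurableSet_Icc) ?_ ?_
    · rw [Measure.prod_prod]
      simp only [Real.volume_Icc]
      exact (ENNReal.mul_ne_top (by simp) (by simp))
    · intro t ht; by_contra h; exact ht (hJ0 _ _ h).2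
  have e1 : ∫ ζ, ee (x.2 / R * ζ) * Eop φ (GG φ g R a ζ) x = ∫ ζ, ∫ p, J ζ p := by
    congr 1; ext ζ
    rw [Measure.volume_eq_prod, integral_prod _ (hJi2 ζ)]
    simp only [hJ]
    unfold Eop GG
    rw [← integral_const_mul]
    congr 1; ext v
    rw [integral_const_mul, integral_mul_const]
  have e2 : ∀ p : ℝ × ℝ, ∫ ζ, J ζ p = (if |p.2| ≤ 1/8 then g (p.1 - p.2 / R) *
      ee (x.1 * p.1 + x.2 * φ (p.1 - p.2 / R)) * ee (-(a * p.2)) else 0) * chi (1/16) (x.2 / R) := by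
    intro p
    by_cases hp : |p.2| ≤ 1/8
    · rw [if_pos hp]
      simp only [hJ, KK, if_pos hp]
      set d := R * (φ (p.1 - p.2 / R) - φ p.1) with hd
      rw [← integral_add_right_eq_self _ d]
      unfold chi
      rw [← integral_const_mul]
      congr 1; ext ζ
      rw [add_sub_cancel_right]
      split_ifs
      · have h1 : ee (x.2 / R * (ζ + d)) = ee (x.2 / R * ζ) * ee (x.2 * (φ (p.1 - p.2 / R) - φ p.1)) := by
          rw [← ee_add]; congr 1; rw [hd]; field_simp
        have h2 : ee (x.1 * p.1 + x.2 * φ (p.1 - p.2 / R)) = ee (x.1 * p.1 + x.2 * φ p.1) *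
            ee (x.2 * (φ (p.1 - p.2 / R) - φ p.1)) := by
          rw [← ee_add]; congr 1; ring
        rw [h1, h2]; ring
      · simp
    · simp only [hJ, KK, if_neg hp]; simp
  rw [e1, integral_integral_swap hJi]
  simp_rw [e2]
  have hi3 : Integrable (fun p : ℝ × ℝ => ∫ ζ, J ζ p) (volume.prod volume) := hJi.integral_prod_right
  simp_rw [e2] at hi3
  rw [Measure.volume_eq_prod, integral_prod_symm _ hi3]
  have e3 : ∀ w : ℝ, ∫ v, (if |w| ≤ 1/8 then g (v - w / R) *
      ee (x.1 * v + x.2 * φ (v - w / R)) * ee (-(a * w)) else 0) * chi (1/16) (x.2 / R) =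
      (if |w| ≤ 1/8 then ee ((x.1 / R - a) * w) else 0) * (chi (1/16) (x.2 / R) * Eop φ g x) := by
    intro w
    split_ifs with hw
    · rw [← integral_add_right_eq_self _ (w / R)]
      unfold Eop
      rw [← mul_assoc, ← integral_const_mul]
      congr 1; ext v
      rw [add_sub_cancel_right]
      have h1 : ee (x.1 * (v + w / R) + x.2 * φ v) * ee (-(a * w)) =
        ee ((x.1 / R - a) * w) * ee (x.1 * v + x.2 * φ v) := by
        rw [← ee_add, ← ee_add]; congr 1; field_simp; ring
      rw [mul_assoc (g v), h1]; ring
    · simp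
  simp_rw [e3]
  rw [integral_mul_const]
  unfold chi
  ring
end

section
/-- square root -/
def sqh (x : ℝ≥0∞) : ℝ≥0∞ := x ^ (1/2 : ℝ)
lemma sqh_mul (x y : ℝ≥0∞) : sqh (x * y) = sqh x * sqh y :=
  ENNReal.mul_rpow_of_nonneg _ _ (by norm_num)
lemma sqh_sq (x : ℝ≥0∞) : sqh (x ^ 2) = x := by
  unfold sqh; rw [← ENNReal.rpow_natCast, ← ENNReal.rpow_mul]; norm_num
lemma sqh_self (x : ℝ≥0∞) : sqh x * sqh x = x := by
  rw [← sqh_mul, ← sq, sqh_sq]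
lemma sqh_mono {x y : ℝ≥0∞} (h : x ≤ y) : sqh x ≤ sqh y := ENNReal.rpow_le_rpow h (by norm_num)
lemma sqh_add (x y : ℝ≥0∞) : sqh (x + y) ≤ sqh x + sqh y :=
  ENNReal.rpow_add_le_add_rpow _ _ (by norm_num) (by norm_num)
lemma sqh_sum {ι : Type*} (S : Finset ι) (x : ι → ℝ≥0∞) : sqh (∑ i ∈ S, x i) ≤ ∑ i ∈ S, sqh (x i) := by
  classical
  induction S using Finset.induction_on with
  | empty => simp [sqh]
  | insert a S ha ih =>
    rw [Finset.sum_insert ha, Finset.sum_insert ha]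
    exact (sqh_add _ _).trans (by gcongr)
lemma cs_h {X : Type*} [MeasurableSpace X] {m : Measure X} {f g : X → ℝ≥0∞}
    (hf : AEMeasurable f m) (hg : AEMeasurable g m) :
    (∫⁻ x, f x * g x ∂m) ≤ sqh (∫⁻ x, f x ^ 2 ∂m) * sqh (∫⁻ x, g x ^ 2 ∂m) := cs_sqrt hf hg

lemma cell_pt {φ φ' : ℝ → ℝ} (hφ : Ph φ φ') {g : ℝ → ℂ} (hg : Gd g) {R : ℝ} (hR : 1 ≤ R) (a : ℤ)
    (x : ℝ × ℝ) (h1 : |x.1 / R - a| ≤ 1) (h2 : |x.2| ≤ 2 * R) :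
    ‖Eop φ g x‖ₑ ^ 2 ≤ 32768 * ∫⁻ ζ, ‖Eop φ (GG φ g R a ζ) x‖ₑ ^ 2 := by
  have hR0 : 0 < R := by linarith
  have hm : Measurable (fun ζ => ‖Eop φ (GG φ g R a ζ) x‖ₑ) :=
    ((EGG_meas hφ hg hR a).comp (g := fun p : ℝ × (ℝ × ℝ) => Eop φ (GG φ g R a p.1) p.2)
      (f := fun ζ => (ζ, x)) (by fun_prop)).enorm
  have c1 := chi_lb (δ := 1/8) (y := x.1 / R - a) (by norm_num) (by linarith)
  have c2 := chi_lb (δ := 1/16) (y := x.2 / R) (by norm_num) (by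
    rw [abs_div, abs_of_pos hR0]
    have : |x.2| / R ≤ 2 := by rw [div_le_iff₀ hR0]; exact h2
    linarith)
  have e := loc_id hφ hg hR a x
  have h3 : ‖Eop φ g x‖ₑ ≤ 128 * ‖chi (1/8) (x.1 / R - a) * chi (1/16) (x.2 / R) * Eop φ g x‖ₑ := by
    rw [← ofReal_norm, ← ofReal_norm, show (128:ℝ≥0∞) = ENNReal.ofReal 128 by norm_num,
      ← ENNReal.ofReal_mul (by norm_num)]
    apply ENNReal.ofReal_le_ofReal
    rw [norm_mul, norm_mul]
    have : (1/8:ℝ) * (1/16) ≤ ‖chi (1/8) (x.1 / R - a)‖ * ‖chi (1/16) (x.2 / R)‖ := by gcongr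
    nlinarith [norm_nonneg (Eop φ g x)]
  have h4 : ‖Eop φ g x‖ₑ ≤ 128 * ∫⁻ ζ, (Icc (-1:ℝ) 1).indicator 1 ζ * ‖Eop φ (GG φ g R a ζ) x‖ₑ := by
    refine h3.trans ?_
    gcongr
    rw [e]
    refine (enorm_integral_le_lintegral_enorm _).trans ?_
    refine lintegral_mono fun ζ => ?_
    simp only
    rw [enorm_mul, enorm_ee, one_mul]
    by_cases hζ : ζ ∈ Icc (-1:ℝ) 1
    · simp [indicator_of_mem hζ]
    · have : Eop φ (GG φ g R a ζ) x = 0 := by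
        have h0 : ∀ t, GG φ g R a ζ t = 0 := by
          intro t; by_contra h
          obtain ⟨w, hw⟩ := GG_supp hφ hg hR a h
          exact hζ (abs_le.1 (KK_supp hφ hg hR hw).2.1)
        simp [Eop, h0]
      simp [this]
  have hind : Measurable ((Icc (-1:ℝ) 1).indicator (1 : ℝ → ℝ≥0∞)) := measurable_one.indicator measurableSet_Icc
  have h5 := cs_sq (m := volume) hind.aemeasurable hm.aemeasurable
  have h6 : ∫⁻ ζ, ((Icc (-1:ℝ) 1).indicator (1 : ℝ → ℝ≥0∞) ζ) ^ 2 = 2 := by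
    have : ∀ ζ, ((Icc (-1:ℝ) 1).indicator (1 : ℝ → ℝ≥0∞) ζ) ^ 2 = (Icc (-1:ℝ) 1).indicator (1 : ℝ → ℝ≥0∞) ζ := by
      intro ζ; by_cases h : ζ ∈ Icc (-1:ℝ) 1 <;> simp [h]
    simp_rw [this]
    rw [lintegral_indicator_one measurableSet_Icc]; norm_num
  rw [h6] at h5
  calc _ ≤ (128 * ∫⁻ ζ, (Icc (-1:ℝ) 1).indicator 1 ζ * ‖Eop φ (GG φ g R a ζ) x‖ₑ) ^ 2 := by gcongr
    _ = 16384 * (∫⁻ ζ, (Icc (-1:ℝ) 1).indicator 1 ζ * ‖Eop φ (GG φ g R a ζ) x‖ₑ) ^ 2 := by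
        rw [mul_pow]; norm_num
    _ ≤ 16384 * (2 * ∫⁻ ζ, ‖Eop φ (GG φ g R a ζ) x‖ₑ ^ 2) := by gcongr
    _ = _ := by rw [← mul_assoc]; norm_num

/-- total mass -/
def SS (φ : ℝ → ℝ) (g : ℝ → ℂ) (R : ℝ) (a : ℤ) : ℝ≥0∞ := ∫⁻ ζ, Nf (GG φ g R a ζ)

lemma NfGG_meas {φ φ' : ℝ → ℝ} (hφ : Ph φ φ') {g : ℝ → ℂ} (hg : Gd g) {R : ℝ} (hR : 1 ≤ R) (a : ℤ) :
    Measurable (fun ζ => Nf (GG φ g R a ζ)) := by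
  unfold Nf
  have := GG_meas hφ hg hR a
  exact Measurable.lintegral_prod_right' (f := fun p : ℝ × ℝ => ‖GG φ g R a p.1 p.2‖ₑ ^ 2) (by fun_prop)

lemma sumSS {φ φ' : ℝ → ℝ} (hφ : Ph φ φ') {g : ℝ → ℂ} (hg : Gd g) {R : ℝ} (hR : 1 ≤ R) :
    ∑' a, SS φ g R a ≤ Nf g := by
  have hgm := hg.meas
  have hind : Measurable ((Icc (-1:ℝ) 1).indicator (1 : ℝ → ℝ≥0∞)) := measurable_one.indicator measurableSet_Icc
  have hind2 : Measurable ((Icc (-(1/8):ℝ) (1/8)).indicator (1 : ℝ → ℝ≥0∞)) :=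
    measurable_one.indicator measurableSet_Icc
  have hK := KK_meas hφ hg (R := R)
  obtain ⟨C, hC0, hC⟩ := KK_bdd hφ hg hR
  unfold SS
  rw [← lintegral_tsum (fun a => (NfGG_meas hφ hg hR a).aemeasurable)]
  have h1 : ∀ ζ, ∑' a, Nf (GG φ g R a ζ) ≤ (Icc (-1:ℝ) 1).indicator 1 ζ * (ENNReal.ofReal (1/4) * Nf g) := by
    intro ζ
    unfold Nf
    rw [← lintegral_tsum]
    · calc _ ≤ ∫⁻ v, ∫⁻ w, ‖KK φ g R ζ v w‖ₑ ^ 2 := by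
            refine lintegral_mono fun v => ?_
            refine bessel (k := KK φ g R ζ v) ?_ (hC ζ v) ?_
            · exact hK.comp (g := fun p : ℝ × (ℝ × ℝ) => KK φ g R p.1 p.2.1 p.2.2)
                (f := fun w => (ζ, (v, w))) (by fun_prop)
            · intro t ht; by_contra h
              exact ht (abs_le.1 (KK_supp hφ hg hR h).1)
        _ ≤ ∫⁻ v, ∫⁻ w, (Icc (-1:ℝ) 1).indicator 1 ζ *
              ((Icc (-(1/8):ℝ) (1/8)).indicator 1 w * ‖g (v - w / R)‖ₑ ^ 2) :=
            lintegral_mono fun v => lintegral_mono fun w => KK_le hφ hg hR ζ v w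
        _ = ∫⁻ w, ∫⁻ v, (Icc (-1:ℝ) 1).indicator 1 ζ *
              ((Icc (-(1/8):ℝ) (1/8)).indicator 1 w * ‖g (v - w / R)‖ₑ ^ 2) := by
            apply lintegral_lintegral_swap
            apply Measurable.aemeasurable
            have h1 : Measurable (fun p : ℝ × ℝ => (Icc (-(1/8):ℝ) (1/8)).indicator (1 : ℝ → ℝ≥0∞) p.2) :=
              hind2.comp measurable_snd
            simp only [Function.uncurry_def]
            fun_prop
        _ = ∫⁻ w, (Icc (-1:ℝ) 1).indicator 1 ζ *
              ((Icc (-(1/8):ℝ) (1/8)).indicator 1 w * ∫⁻ v, ‖g v‖ₑ ^ 2) := by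
            congr 1; ext w
            rw [lintegral_const_mul _ (by fun_prop), lintegral_const_mul _ (by fun_prop),
              lintegral_sub_right_eq_self (fun v => ‖g v‖ₑ ^ 2)]
        _ = _ := by
            rw [lintegral_const_mul _ (by fun_prop), lintegral_mul_const _ hind2,
              lintegral_indicator_one measurableSet_Icc]
            norm_num
    · intro a
      have := GG_meas hφ hg hR a
      exact ((this.comp (g := fun p : ℝ × ℝ => GG φ g R a p.1 p.2) (f := fun v => (ζ, v))
        (by fun_prop)).enorm.pow_const 2).aemeasurable
  calc _ ≤ ∫⁻ ζ, (Icc (-1:ℝ) 1).indicator 1 ζ * (ENNReal.ofReal (1/4) * Nf g) := lintegral_mono h1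
    _ = (2 * ENNReal.ofReal (1/4)) * Nf g := by
        rw [lintegral_mul_const _ hind, lintegral_indicator_one measurableSet_Icc, mul_assoc]
        norm_num
    _ ≤ 1 * Nf g := by
        gcongr
        rw [show (2:ℝ≥0∞) = ENNReal.ofReal 2 by norm_num, ← ENNReal.ofReal_mul (by norm_num)]
        rw [ENNReal.ofReal_le_one]; norm_num
    _ = _ := one_mul _

/-- enlarged cells -/
def QQ (R : ℝ) (a : ℤ) : Set (ℝ × ℝ) := {x | |x.1 / R - a| ≤ 1 ∧ |x.2| ≤ 2 * R}

lemma QQ_meas (R : ℝ) (a : ℤ) : MeasurableSet (QQ R a) := by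
  unfold QQ
  rw [setOf_and]
  exact (measurableSet_le (by fun_prop) (by fun_prop)).inter (measurableSet_le (by fun_prop) (by fun_prop))

lemma cell {φ φ' : ℝ → ℝ} (hφ : Ph φ φ') {f g : ℝ → ℂ} (hf : Gd f) (hg : Gd g) {R : ℝ} (hR : 1 ≤ R)
    (a : ℤ) {κ : ℝ} (hκ : 0 < κ) (hκR : 1 ≤ 2 * κ * R)
    (hsep : ∀ t u, f t ≠ 0 → g u ≠ 0 → t + κ ≤ u) :
    ∫⁻ x in QQ R a, ‖Eop φ f x‖ₑ ^ 2 * ‖Eop φ g x‖ₑ ^ 2 ≤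
      32768 ^ 2 * ENNReal.ofReal (κ / 2)⁻¹ * (SS φ f R a * SS φ g R a) := by
  have hR0 : 0 < R := by linarith
  have mE : ∀ {g : ℝ → ℂ}, Gd g → Measurable (fun p : ℝ × (ℝ × ℝ) => ‖Eop φ (GG φ g R a p.1) p.2‖ₑ ^ 2) :=
    fun hg => ((EGG_meas hφ hg hR a)).enorm.pow_const 2
  have mE' : ∀ {g : ℝ → ℂ}, Gd g → ∀ x, Measurable (fun ζ : ℝ => ‖Eop φ (GG φ g R a ζ) x‖ₑ ^ 2) :=
    fun {g} hg x => (mE hg).comp (g := fun p : ℝ × (ℝ × ℝ) => ‖Eop φ (GG φ g R a p.1) p.2‖ₑ ^ 2)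
      (f := fun ζ => (ζ, x)) (by fun_prop)
  calc _ ≤ ∫⁻ x in QQ R a, (32768 * ∫⁻ ζ, ‖Eop φ (GG φ f R a ζ) x‖ₑ ^ 2) *
        (32768 * ∫⁻ ζ, ‖Eop φ (GG φ g R a ζ) x‖ₑ ^ 2) := by
        refine setLIntegral_mono' (QQ_meas R a) fun x hx => ?_
        exact mul_le_mul' (cell_pt hφ hf hR a x hx.1 hx.2) (cell_pt hφ hg hR a x hx.1 hx.2)
    _ ≤ ∫⁻ x, (32768 * ∫⁻ ζ, ‖Eop φ (GG φ f R a ζ) x‖ₑ ^ 2) *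
        (32768 * ∫⁻ ζ, ‖Eop φ (GG φ g R a ζ) x‖ₑ ^ 2) := setLIntegral_le_lintegral _ _
    _ = ∫⁻ x, 32768 ^ 2 * ∫⁻ p : ℝ × ℝ, ‖Eop φ (GG φ f R a p.1) x‖ₑ ^ 2 * ‖Eop φ (GG φ g R a p.2) x‖ₑ ^ 2 := by
        congr 1; ext x
        rw [Measure.volume_eq_prod, lintegral_prod_mul (mE' hf x).aemeasurable (mE' hg x).aemeasurable]
        ring
    _ = 32768 ^ 2 * ∫⁻ p : ℝ × ℝ, ∫⁻ x, ‖Eop φ (GG φ f R a p.1) x‖ₑ ^ 2 * ‖Eop φ (GG φ g R a p.2) x‖ₑ ^ 2 := by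
        rw [lintegral_const_mul' _ _ (by simp), lintegral_lintegral_swap]
        apply Measurable.aemeasurable
        exact ((mE hf).comp (g := fun p : ℝ × (ℝ × ℝ) => ‖Eop φ (GG φ f R a p.1) p.2‖ₑ ^ 2)
          (f := fun q : (ℝ × ℝ) × (ℝ × ℝ) => (q.2.1, q.1)) (by fun_prop)).mul
          ((mE hg).comp (g := fun p : ℝ × (ℝ × ℝ) => ‖Eop φ (GG φ g R a p.1) p.2‖ₑ ^ 2)
          (f := fun q : (ℝ × ℝ) × (ℝ × ℝ) => (q.2.2, q.1)) (by fun_prop))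
    _ ≤ 32768 ^ 2 * ∫⁻ p : ℝ × ℝ, ENNReal.ofReal (κ / 2)⁻¹ * (Nf (GG φ f R a p.1) * Nf (GG φ g R a p.2)) := by
        gcongr with p
        refine bil hφ (by positivity) (GG_int hφ hf hR a _) (GG_int hφ hg hR a _) ?_
        intro t u ht hu
        obtain ⟨w, hw⟩ := GG_supp hφ hf hR a ht
        obtain ⟨w', hw'⟩ := GG_supp hφ hg hR a hu
        obtain ⟨h1, -, -, h2, -⟩ := KK_supp hφ hf hR hw
        obtain ⟨h1', -, -, h2', -⟩ := KK_supp hφ hg hR hw'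
        have h3 := hsep _ _ h2 h2'
        have h4 : ∀ w : ℝ, |w| ≤ 1/8 → |w / R| ≤ κ / 4 := by
          intro w hw
          rw [abs_div, abs_of_pos hR0, div_le_iff₀ hR0]; nlinarith
        have h5 := abs_le.1 (h4 w h1)
        have h6 := abs_le.1 (h4 w' h1')
        linarith [h5.1, h5.2, h6.1, h6.2]
    _ = _ := by
        rw [lintegral_const_mul' _ _ (by simp), Measure.volume_eq_prod,
          lintegral_prod_mul (NfGG_meas hφ hf hR a).aemeasurable (NfGG_meas hφ hg hR a).aemeasurable]
        unfold SS
        ring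

lemma loc {φ φ' : ℝ → ℝ} (hφ : Ph φ φ') {f g : ℝ → ℂ} (hf : Gd f) (hg : Gd g) {R : ℝ} (hR : 1 ≤ R)
    {κ : ℝ} (hκ : 0 < κ) (hκR : 1 ≤ 2 * κ * R)
    (hsep : ∀ t u, f t ≠ 0 → g u ≠ 0 → t + κ ≤ u) :
    ∑' a, sqh (∫⁻ x in QQ R a, ‖Eop φ f x‖ₑ ^ 2 * ‖Eop φ g x‖ₑ ^ 2) ≤
      sqh (32768 ^ 2 * ENNReal.ofReal (κ / 2)⁻¹) * sqh (Nf f * Nf g) := by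
  calc _ ≤ ∑' a, sqh (32768 ^ 2 * ENNReal.ofReal (κ / 2)⁻¹) * (sqh (SS φ f R a) * sqh (SS φ g R a)) := by
        refine ENNReal.tsum_le_tsum fun a => ?_
        rw [← sqh_mul, ← sqh_mul]
        exact sqh_mono (cell hφ hf hg hR a hκ hκR hsep)
    _ = sqh (32768 ^ 2 * ENNReal.ofReal (κ / 2)⁻¹) * ∑' a, (sqh (SS φ f R a) * sqh (SS φ g R a)) :=
        ENNReal.tsum_mul_left
    _ ≤ _ := by
        gcongr
        rw [← lintegral_count]
        refine (cs_h (Measurable.of_discrete).aemeasurable (Measurable.of_discrete).aemeasurable).trans ?_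
        rw [lintegral_count, lintegral_count]
        simp_rw [sq, sqh_self]
        rw [sqh_mul]
        exact mul_le_mul' (sqh_mono (sumSS hφ hf hR)) (sqh_mono (sumSS hφ hg hR))
end

section
/-- derivatives -/
def mm (φ : ℝ → ℝ) (f : ℝ → ℂ) : Fin 4 → ℝ → ℂ := ![f, m2 φ f, m1 f, m2 φ (m1 f)]

lemma SA_eq (φ : ℝ → ℝ) (f : ℝ → ℂ) (x : ℝ × ℝ) : SA φ f x = ∑ i, ‖Eop φ (mm φ f i) x‖ₑ ^ 2 := by
  rw [Fin.sum_univ_four, SA]; simp [mm, add_assoc]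

lemma mm_gd {φ φ' : ℝ → ℝ} (hφ : Ph φ φ') {f : ℝ → ℂ} (hf : Gd f) (i : Fin 4) : Gd (mm φ f i) := by
  fin_cases i
  · exact hf
  · exact hf.m2 hφ
  · exact hf.m1
  · exact hf.m1.m2 hφ

lemma mm_ne {φ : ℝ → ℝ} {f : ℝ → ℂ} (i : Fin 4) {t : ℝ} (h : mm φ f i t ≠ 0) : f t ≠ 0 := by
  intro h0; apply h
  fin_cases i <;> simp [mm, m1, m2, h0]

lemma mm_N {φ φ' : ℝ → ℝ} (hφ : Ph φ φ') {f : ℝ → ℂ} (hf : Gd f) (i : Fin 4) :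
    Nf (mm φ f i) ≤ 10000 * Nf f := by
  fin_cases i
  · calc Nf f = 1 * Nf f := (one_mul _).symm
      _ ≤ _ := by gcongr; norm_num
  · exact (Nf_m2 hφ hf).trans (by gcongr; norm_num)
  · exact (Nf_m1 hf).trans (by gcongr; norm_num)
  · refine ((Nf_m2 hφ hf.m1).trans (mul_le_mul_right (Nf_m1 hf) _)).trans ?_
    rw [← mul_assoc]; gcongr; norm_num

/-- broad constant -/
def CB (κ : ℝ) : ℝ≥0∞ := 480000 * sqh (32768 ^ 2 * ENNReal.ofReal (κ / 2)⁻¹)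

lemma CB_ne (κ : ℝ) : CB κ ≠ ∞ := by
  unfold CB sqh
  refine ENNReal.mul_ne_top (by simp) (ENNReal.rpow_ne_top_of_nonneg (by norm_num) ?_)
  exact ENNReal.mul_ne_top (by simp) (by simp)

lemma locSA {φ φ' : ℝ → ℝ} (hφ : Ph φ φ') {f g : ℝ → ℂ} (hf : Gd f) (hg : Gd g) {R : ℝ} (hR : 1 ≤ R)
    {κ : ℝ} (hκ : 0 < κ) (hκR : 1 ≤ 2 * κ * R)
    (hsep : ∀ t u, f t ≠ 0 → g u ≠ 0 → t + κ ≤ u) :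
    ∑' a, sqh (∫⁻ x in QQ R a, SA φ f x * SA φ g x) ≤
      160000 * (sqh (32768 ^ 2 * ENNReal.ofReal (κ / 2)⁻¹) * sqh (Nf f * Nf g)) := by
  have hm : ∀ {f : ℝ → ℂ}, Gd f → Measurable (fun x => ‖Eop φ f x‖ₑ ^ 2) := fun h =>
    (continuous_Eop hφ.cont h.integrable).measurable.enorm.pow_const 2
  set Z := sqh (32768 ^ 2 * ENNReal.ofReal (κ / 2)⁻¹)
  calc _ ≤ ∑' a, ∑ i, ∑ j, sqh (∫⁻ x in QQ R a, ‖Eop φ (mm φ f i) x‖ₑ ^ 2 * ‖Eop φ (mm φ g j) x‖ₑ ^ 2) := by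
        refine ENNReal.tsum_le_tsum fun a => ?_
        simp_rw [SA_eq, Finset.sum_mul_sum]
        have hmm : ∀ i j, Measurable (fun x => ‖Eop φ (mm φ f i) x‖ₑ ^ 2 * ‖Eop φ (mm φ g j) x‖ₑ ^ 2) :=
          fun i j => (hm (mm_gd hφ hf i)).mul (hm (mm_gd hφ hg j))
        rw [lintegral_finsetSum _ (fun i _ => Finset.measurable_sum _ fun j _ => hmm i j)]
        refine (sqh_sum _ _).trans (Finset.sum_le_sum fun i _ => ?_)
        rw [lintegral_finsetSum _ (fun j _ => hmm i j)]
        exact sqh_sum _ _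
    _ = ∑ i, ∑ j, ∑' a, sqh (∫⁻ x in QQ R a, ‖Eop φ (mm φ f i) x‖ₑ ^ 2 * ‖Eop φ (mm φ g j) x‖ₑ ^ 2) := by
        rw [Summable.tsum_finsetSum (fun _ _ => ENNReal.summable)]
        congr 1; ext i
        rw [Summable.tsum_finsetSum (fun _ _ => ENNReal.summable)]
    _ ≤ ∑ i : Fin 4, ∑ j : Fin 4, Z * (10000 * sqh (Nf f * Nf g)) := by
        refine Finset.sum_le_sum fun i _ => Finset.sum_le_sum fun j _ => ?_
        refine (loc hφ (mm_gd hφ hf i) (mm_gd hφ hg j) hR hκ hκR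
          (fun t u ht hu => hsep t u (mm_ne i ht) (mm_ne j hu))).trans ?_
        gcongr
        calc _ ≤ sqh (10000 ^ 2 * (Nf f * Nf g)) := by
              apply sqh_mono
              calc _ ≤ (10000 * Nf f) * (10000 * Nf g) := mul_le_mul' (mm_N hφ hf i) (mm_N hφ hg j)
                _ = _ := by ring
          _ = _ := by rw [sqh_mul, sqh_sq]
    _ = _ := by
        simp only [Finset.sum_const, Finset.card_univ, Fintype.card_fin, nsmul_eq_mul]
        push_cast; ring

lemma broad {φ φ' : ℝ → ℝ} (hφ : Ph φ φ') {f g : ℝ → ℂ} (hf : Gd f) (hg : Gd g) {R : ℝ} (hR : 1 ≤ R)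
    {κ : ℝ} (hκ : 0 < κ) (hκR : 1 ≤ 2 * κ * R)
    (hsep : ∀ t u, f t ≠ 0 → g u ≠ 0 → t + κ ≤ u) {s : ℝ} {D : ℝ≥0∞} {H : Measure (ℝ × ℝ)}
    [IsFiniteMeasure H] (hH : HB s R D H) :
    ∫⁻ x, ‖Eop φ f x‖ₑ * ‖Eop φ g x‖ₑ ∂H ≤ CB κ * ENNReal.ofReal (R ^ (s / 2)) * (D * sqh (Nf f * Nf g)) := by
  have hR0 : 0 < R := by linarith
  have hm : ∀ {f : ℝ → ℂ}, Gd f → Measurable (fun x => ‖Eop φ f x‖ₑ) := fun h =>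
    (continuous_Eop hφ.cont h.integrable).measurable.enorm
  have hmf := hm hf
  have hmg := hm hg
  set P : ℤ → Set (ℝ × ℝ) := fun a => {x | ⌊x.1 / R⌋ = a ∧ |x.2| ≤ R} with hP
  have hPm : ∀ a, MeasurableSet (P a) := by
    intro a
    simp only [hP, setOf_and]
    refine MeasurableSet.inter ?_ (measurableSet_le (by fun_prop) (by fun_prop))
    exact measurableSet_eq_fun (by fun_prop) (by fun_prop)
  have hU : {x : ℝ × ℝ | |x.2| ≤ R} ⊆ ⋃ a, P a := by
    intro x hx
    exact mem_iUnion.2 ⟨⌊x.1 / R⌋, rfl, hx⟩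
  have hPa : ∀ a, ∀ x ∈ P a, (a:ℝ) * R ≤ x.1 ∧ x.1 < (a + 1) * R ∧ |x.2| ≤ R := by
    rintro a x ⟨h1, h2⟩
    have := Int.floor_eq_iff.1 h1
    rw [le_div_iff₀ hR0, div_lt_iff₀ hR0] at this
    exact ⟨this.1, this.2, h2⟩
  have hHP : ∀ a, H (P a) ≤ D * ENNReal.ofReal (R ^ s) := by
    intro a
    refine (measure_mono ?_).trans (hH.ball ((a:ℝ) * R, 0) R hR)
    intro x hx
    obtain ⟨h1, h2, h3⟩ := hPa a x hx
    rw [mem_closedBall, Prod.dist_eq, max_le_iff, Real.dist_eq, Real.dist_eq]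
    refine ⟨?_, by simpa using h3⟩
    rw [abs_le]; constructor <;> nlinarith
  have hstep : ∀ a, ∫⁻ x in P a, ‖Eop φ f x‖ₑ * ‖Eop φ g x‖ₑ ∂H ≤
      3 * ENNReal.ofReal (R ^ (s / 2)) * D * sqh (∫⁻ x in QQ R (a + 1), SA φ f x * SA φ g x) := by
    intro a
    calc _ = ∫⁻ x in P a, 1 * (‖Eop φ f x‖ₑ * ‖Eop φ g x‖ₑ) ∂H := by simp
      _ ≤ _ := cs_h (by fun_prop) (by fun_prop)
      _ ≤ sqh (D * ENNReal.ofReal (R ^ s)) *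
          sqh (9 * (D * ∫⁻ x in QQ R (a + 1), SA φ f x * SA φ g x)) := by
          refine mul_le_mul' (sqh_mono ?_) (sqh_mono ?_)
          · simpa using hHP a
          · calc _ ≤ ∫⁻ x in P a, 9 * (∫⁻ w in Icc (0:ℝ) 1 ×ˢ Icc (0:ℝ) 1, SA φ f (x + w) * SA φ g (x + w)) ∂H := by
                  refine lintegral_mono fun x => ?_
                  simp only [mul_pow]
                  exact sob2 hφ hf hg x
              _ ≤ _ := by
                  rw [lintegral_const_mul' _ _ (by simp)]
                  gcongr
                  refine box_H (G := fun x => SA φ f x * SA φ g x) hH.ball1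
                    ((measurable_SA hφ hf).mul (measurable_SA hφ hg)) (hPm a) (QQ_meas R _) ?_
                  intro x hx w hw
                  obtain ⟨h1, h2, h3⟩ := hPa a x hx
                  obtain ⟨⟨h4, h5⟩, h6, h7⟩ := hw
                  constructor
                  · simp only [Prod.fst_add]
                    rw [abs_le, le_sub_iff_add_le, sub_le_iff_le_add, le_div_iff₀ hR0, div_le_iff₀ hR0]
                    push_cast
                    constructor <;> nlinarith
                  · simp only [Prod.snd_add]
                    rw [abs_le] at h3 ⊢
                    constructor <;> linarith [h3.1, h3.2]
      _ = _ := by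
          rw [sqh_mul, sqh_mul, sqh_mul, show (9:ℝ≥0∞) = 3 ^ 2 by norm_num, sqh_sq]
          have e : sqh (ENNReal.ofReal (R ^ s)) = ENNReal.ofReal (R ^ (s / 2)) := by
            unfold sqh
            rw [ENNReal.ofReal_rpow_of_pos (by positivity), ← Real.rpow_mul hR0.le]
            congr 2; ring
          rw [e]
          set X := sqh (∫⁻ x in QQ R (a + 1), SA φ f x * SA φ g x)
          calc _ = 3 * ENNReal.ofReal (R ^ (s / 2)) * (sqh D * sqh D) * X := by ring
            _ = _ := by rw [sqh_self]
  calc ∫⁻ x, ‖Eop φ f x‖ₑ * ‖Eop φ g x‖ₑ ∂H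
      = ∫⁻ x in {x : ℝ × ℝ | |x.2| ≤ R}, ‖Eop φ f x‖ₑ * ‖Eop φ g x‖ₑ ∂H := by rw [hH.restr]
    _ ≤ ∫⁻ x in ⋃ a, P a, ‖Eop φ f x‖ₑ * ‖Eop φ g x‖ₑ ∂H := lintegral_mono_set hU
    _ ≤ ∑' a, ∫⁻ x in P a, ‖Eop φ f x‖ₑ * ‖Eop φ g x‖ₑ ∂H := lintegral_iUnion_le _ _
    _ ≤ ∑' a, 3 * ENNReal.ofReal (R ^ (s / 2)) * D * sqh (∫⁻ x in QQ R (a + 1), SA φ f x * SA φ g x) :=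
        ENNReal.tsum_le_tsum hstep
    _ = 3 * ENNReal.ofReal (R ^ (s / 2)) * D * ∑' a, sqh (∫⁻ x in QQ R a, SA φ f x * SA φ g x) := by
        rw [ENNReal.tsum_mul_left]
        congr 1
        exact (Equiv.addRight (1:ℤ)).tsum_eq (fun a => sqh (∫⁻ x in QQ R a, SA φ f x * SA φ g x))
    _ ≤ 3 * ENNReal.ofReal (R ^ (s / 2)) * D *
        (160000 * (sqh (32768 ^ 2 * ENNReal.ofReal (κ / 2)⁻¹) * sqh (Nf f * Nf g))) := by
        gcongr
        exact locSA hφ hf hg hR hκ hκR hsep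
    _ = _ := by
        unfold CB
        rw [show (480000:ℝ≥0∞) = 3 * 160000 by norm_num]; ring
end

section
lemma Ph.resc {φ φ' : ℝ → ℝ} (hφ : Ph φ φ') (t0 : ℝ) {K : ℝ} (hK : 0 < K) :
    Ph (fun τ => K ^ 2 * (φ (t0 + τ / K) - φ t0 - φ' t0 * (τ / K)))
      (fun τ => K * (φ' (t0 + τ / K) - φ' t0)) where
  h0 := by simp
  h0' := by simp
  hd := fun τ => by
    have h1 : HasDerivAt (fun τ : ℝ => t0 + τ / K) (1 / K) τ :=
      ((hasDerivAt_id τ).div_const K).const_add t0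
    have h2 := (hφ.hd (t0 + τ / K)).comp τ h1
    have h3 : HasDerivAt (fun τ : ℝ => φ' t0 * (τ / K)) (φ' t0 * (1 / K)) τ :=
      ((hasDerivAt_id τ).div_const K).const_mul _
    refine (((h2.sub_const (φ t0)).sub h3).const_mul (K ^ 2)).congr_deriv ?_
    field_simp
  lo := fun u t hut => by
    have := hφ.lo (t0 + u / K) (t0 + t / K) (by gcongr)
    have e : K * ((t0 + t / K) - (t0 + u / K)) = t - u := by field_simp; ring
    nlinarith
  hi := fun u t hut => by
    have := hφ.hi (t0 + u / K) (t0 + t / K) (by gcongr)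
    have e : K * ((t0 + t / K) - (t0 + u / K)) = t - u := by field_simp; ring
    nlinarith

lemma lint_scale (F : ℝ → ℝ≥0∞) (t0 : ℝ) {K : ℝ} (hK : 0 < K) :
    ∫⁻ τ, F (t0 + τ / K) = ENNReal.ofReal K * ∫⁻ t, F t := by
  have h := lintegral_add_left_eq_self F t0 (μ := volume)
  have h2 : ∫⁻ t, F (t0 + K⁻¹ * t) = ENNReal.ofReal K * ∫⁻ t, F t := by
    have h3 := (Homeomorph.mulLeft₀ K⁻¹ (inv_ne_zero hK.ne')).measurableEmbedding.lintegral_map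
      (μ := volume) (fun t => F (t0 + t))
    simp only [Homeomorph.coe_mulLeft₀] at h3
    rw [← h3, Real.map_volume_mul_left (inv_ne_zero hK.ne'), inv_inv, abs_of_pos hK,
      lintegral_smul_measure, h]
    rfl
  rw [← h2]
  congr 1; ext τ; congr 2; field_simp

lemma narrow1 {φ φ' : ℝ → ℝ} (hφ : Ph φ φ') {f : ℝ → ℂ} (hf : Gd f) {K : ℕ} (hK : 1 ≤ K)
    {t0 : ℝ} (ht0 : t0 ∈ Icc (0:ℝ) 1) (hs : ∀ t, f t ≠ 0 → t0 ≤ t ∧ t ≤ t0 + 1 / K)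
    {s : ℝ} (hs0 : 0 ≤ s) (hs2 : s ≤ 2) {R : ℝ} {A D : ℝ≥0∞} {H : Measure (ℝ × ℝ)} [IsFiniteMeasure H]
    (hH : HB s R D H) (hW : WW s (R / K ^ 2) A) :
    ∫⁻ x, ‖Eop φ f x‖ₑ ^ 2 ∂H ≤ ENNReal.ofReal (18 * K ^ s) * A * (D * Nf f) := by
  have hK1 : (1:ℝ) ≤ K := by exact_mod_cast hK
  have hK0 : (0:ℝ) < K := by linarith
  set p := φ' t0 with hp
  have hp2 : |p| ≤ 2 := by
    have := hφ.abs' t0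
    rw [abs_of_nonneg ht0.1] at this; linarith [ht0.2]
  set φ2 := fun τ => (K:ℝ) ^ 2 * (φ (t0 + τ / K) - φ t0 - φ' t0 * (τ / K)) with hφ2
  set φ2' := fun τ => (K:ℝ) * (φ' (t0 + τ / K) - φ' t0)
  have hPh : Ph φ2 φ2' := hφ.resc t0 hK0
  set f2 : ℝ → ℂ := fun τ => f (t0 + τ / K) with hf2
  have hg2 : Gd f2 := by
    refine ⟨by have := hf.meas; fun_prop, ?_, ?_⟩
    · obtain ⟨C, hC⟩ := hf.bdd; exact ⟨C, fun t => hC _⟩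
    · intro τ hτ
      by_contra h
      obtain ⟨h1, h2⟩ := hs _ h
      apply hτ
      constructor
      · have : 0 ≤ τ / K := by linarith
        by_contra h3; push Not at h3
        have := div_neg_of_neg_of_pos h3 hK0; linarith
      · have : τ / K ≤ 1 / K := by linarith
        rwa [div_le_div_iff_of_pos_right hK0] at this
  set T : ℝ × ℝ → ℝ × ℝ := fun x => ((x.1 + x.2 * p) / K, x.2 / K ^ 2) with hT
  have hTm : Measurable T := by fun_prop
  have hN : Nf f2 = ENNReal.ofReal K * Nf f := lint_scale (fun t => ‖f t‖ₑ ^ 2) t0 hK0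
  have hE : ∀ x, ‖Eop φ f x‖ₑ ^ 2 = ENNReal.ofReal ((K:ℝ) ^ 2)⁻¹ * ‖Eop φ2 f2 (T x)‖ₑ ^ 2 := by
    intro x
    have e1 : Eop φ2 f2 (T x) * ee (x.1 * t0 + x.2 * φ t0) = K * Eop φ f x := by
      unfold Eop
      rw [← integral_mul_const, ← integral_add_left_eq_self (fun t => f t * ee (x.1 * t + x.2 * φ t)) t0]
      have := Measure.integral_comp_mul_left
        (fun t => f (t0 + t) * ee (x.1 * (t0 + t) + x.2 * φ (t0 + t))) ((K:ℝ)⁻¹)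
      rw [inv_inv, abs_of_pos hK0] at this
      rw [Complex.real_smul] at this
      rw [show ((K:ℕ):ℂ) = (((K:ℕ):ℝ):ℂ) by simp, ← this]
      congr 1; ext τ
      simp only [hf2, hT]
      rw [mul_assoc, ← ee_add, ← div_eq_inv_mul]
      congr 2
      simp only [hφ2]; field_simp; ring
    have e2 : ‖Eop φ2 f2 (T x)‖ₑ ^ 2 = ENNReal.ofReal ((K:ℝ) ^ 2) * ‖Eop φ f x‖ₑ ^ 2 := by
      have : ‖Eop φ2 f2 (T x)‖ = K * ‖Eop φ f x‖ := by
        have := congrArg norm e1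
        rwa [norm_mul, norm_mul, norm_ee, mul_one, Complex.norm_natCast] at this
      rw [enorm_sq_eq, enorm_sq_eq, ← ENNReal.ofReal_mul (by positivity), this, mul_pow]
    rw [e2, ← mul_assoc, ← ENNReal.ofReal_mul (by positivity), inv_mul_cancel₀ (by positivity)]
    simp
  have hHB : HB s (R / K ^ 2) (ENNReal.ofReal (18 * K * K ^ s) * D) (H.map T) := by
    constructor
    · rw [Measure.map_apply hTm (measurableSet_lt (by fun_prop) (by fun_prop))]
      convert hH.slab using 2
      ext x
      simp only [hT, mem_preimage, mem_setOf_eq]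
      rw [abs_div, abs_of_pos (show (0:ℝ) < K ^ 2 by positivity),
        div_lt_div_iff_of_pos_right (by positivity)]
    · intro y r hr
      rw [Measure.map_apply hTm measurableSet_closedBall]
      set c : ℕ → ℝ := fun i => K ^ 2 * y.2 - K ^ 2 * r + (2 * i + 1) * (K * r) with hc
      have hKr : 0 < K * r := by positivity
      have hcov : T ⁻¹' closedBall y r ⊆ ⋃ i ∈ Finset.range (K + 1),
          closedBall (K * y.1 - c i * p, c i) (3 * K * r) := by
        intro x hx
        rw [mem_preimage, mem_closedBall, Prod.dist_eq, max_le_iff, Real.dist_eq, Real.dist_eq] at hx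
        obtain ⟨h1, h2⟩ := hx
        simp only [hT] at h1 h2
        have h3 : |x.1 + x.2 * p - K * y.1| ≤ K * r := by
          rw [show x.1 + x.2 * p - K * y.1 = K * ((x.1 + x.2 * p) / K - y.1) by field_simp, abs_mul,
            abs_of_pos hK0]
          gcongr
        have h4 : |x.2 - K ^ 2 * y.2| ≤ K ^ 2 * r := by
          rw [show x.2 - K ^ 2 * y.2 = K ^ 2 * (x.2 / K ^ 2 - y.2) by field_simp, abs_mul,
            abs_of_pos (show (0:ℝ) < K ^ 2 by positivity)]
          gcongr
        rw [abs_le] at h3 h4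
        set z := (x.2 - K ^ 2 * y.2 + K ^ 2 * r) / (2 * (K * r)) with hz
        have hz0 : 0 ≤ z := div_nonneg (by linarith) (by positivity)
        have hzK : z ≤ K := by
          rw [hz, div_le_iff₀ (by positivity)]; nlinarith [h4.2]
        have h5 := Nat.floor_le hz0
        have h6 := Nat.lt_floor_add_one z
        have hzz : x.2 = K ^ 2 * y.2 - K ^ 2 * r + 2 * z * (K * r) := by
          rw [hz]; field_simp; ring
        refine mem_iUnion₂.2 ⟨⌊z⌋₊, ?_, ?_⟩
        · rw [Finset.mem_range, Nat.lt_succ_iff]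
          exact Nat.floor_le_of_le hzK
        · have h7 : |x.2 - c ⌊z⌋₊| ≤ K * r := by
            rw [hzz, abs_le]; simp only [hc]
            constructor <;> nlinarith
          rw [mem_closedBall, Prod.dist_eq, max_le_iff, Real.dist_eq, Real.dist_eq]
          refine ⟨?_, h7.trans (by linarith)⟩
          have h8 : |(x.2 - c ⌊z⌋₊) * p| ≤ 2 * (K * r) := by
            rw [abs_mul, mul_comm]; exact mul_le_mul hp2 h7 (abs_nonneg _) (by norm_num)
          rw [abs_le] at h8 ⊢
          constructor <;> simp only <;> nlinarith [h8.1, h8.2, h3.1, h3.2]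
      calc H (T ⁻¹' closedBall y r) ≤ _ := measure_mono hcov
        _ ≤ ∑ i ∈ Finset.range (K + 1), H (closedBall (K * y.1 - c i * p, c i) (3 * K * r)) :=
            measure_biUnion_finset_le _ _
        _ ≤ ∑ i ∈ Finset.range (K + 1), D * ENNReal.ofReal ((3 * K * r) ^ s) :=
            Finset.sum_le_sum fun i _ => hH.ball _ _ (by nlinarith)
        _ = D * ENNReal.ofReal ((K + 1) * (3 * K * r) ^ s) := by
            rw [Finset.sum_const, Finset.card_range, nsmul_eq_mul, ENNReal.ofReal_mul (by positivity)]
            rw [show ((K:ℝ) + 1) = ((K + 1 : ℕ) : ℝ) by push_cast; ring, ENNReal.ofReal_natCast]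
            ring
        _ ≤ D * ENNReal.ofReal (18 * K * K ^ s * r ^ s) := by
            refine mul_le_mul_right (ENNReal.ofReal_le_ofReal ?_) _
            rw [Real.mul_rpow (by positivity) (by positivity), Real.mul_rpow (by positivity) (by positivity)]
            have h3 : (3:ℝ) ^ s ≤ 9 := by
              calc (3:ℝ) ^ s ≤ 3 ^ (2:ℝ) := Real.rpow_le_rpow_of_exponent_le (by norm_num) hs2
                _ = 9 := by norm_num
            have : ((K:ℝ) + 1) * 3 ^ s ≤ 18 * K := by
              have : (0:ℝ) < 3 ^ s := by positivity
              nlinarith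
            calc ((K:ℝ) + 1) * (3 ^ s * K ^ s * r ^ s) = (((K:ℝ) + 1) * 3 ^ s) * (K ^ s * r ^ s) := by ring
              _ ≤ (18 * K) * (K ^ s * r ^ s) := by gcongr
              _ = _ := by ring
        _ = _ := by
            rw [ENNReal.ofReal_mul (by positivity)]; ring
  have hfin : IsFiniteMeasure (H.map T) := inferInstance
  have := hW φ2 φ2' hPh f2 hg2 _ (H.map T) hfin hHB
  have hEm : Measurable (fun x => ‖Eop φ2 f2 x‖ₑ ^ 2) :=
    (continuous_Eop hPh.cont hg2.integrable).measurable.enorm.pow_const 2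
  rw [lintegral_map hEm hTm] at this
  simp_rw [hE]
  rw [lintegral_const_mul' _ _ (by simp)]
  calc _ ≤ ENNReal.ofReal ((K:ℝ) ^ 2)⁻¹ * (A * (ENNReal.ofReal (18 * K * K ^ s) * D * Nf f2)) := by gcongr
    _ = (ENNReal.ofReal ((K:ℝ) ^ 2)⁻¹ * ENNReal.ofReal (18 * K * K ^ s) * ENNReal.ofReal K) * A * (D * Nf f) := by
        rw [hN]; ring
    _ = _ := by
        rw [← ENNReal.ofReal_mul (by positivity), ← ENNReal.ofReal_mul (by positivity)]
        congr 3; field_simp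
end

section
/-- pieces -/
def pc (K : ℕ) (f : ℝ → ℂ) (j : ℕ) (t : ℝ) : ℂ := if ⌊(K:ℝ) * t⌋₊ = j then f t else 0

lemma pc_gd {K : ℕ} {f : ℝ → ℂ} (hf : Gd f) (j : ℕ) : Gd (pc K f j) where
  meas := by
    unfold pc
    refine Measurable.ite ?_ hf.meas measurable_const
    exact measurableSet_eq_fun (by fun_prop) (by fun_prop)
  bdd := by
    obtain ⟨C, hC⟩ := hf.bdd
    refine ⟨C, fun t => ?_⟩
    unfold pc; split_ifs
    · exact hC t
    · rw [norm_zero]; exact (norm_nonneg _).trans (hC 0)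
  supp := fun t ht => by simp [pc, hf.supp t ht]

lemma pc_supp {K : ℕ} (hK : 1 ≤ K) {f : ℝ → ℂ} (hf : Gd f) {j : ℕ} {t : ℝ} (h : pc K f j t ≠ 0) :
    (j:ℝ) / K ≤ t ∧ t < (j:ℝ) / K + 1 / K ∧ t ∈ Icc (0:ℝ) 1 := by
  have hK0 : (0:ℝ) < K := by exact_mod_cast hK
  have ht : t ∈ Icc (0:ℝ) 1 := by
    by_contra h1; exact h ((pc_gd hf j).supp t h1)
  have h1 : ⌊(K:ℝ) * t⌋₊ = j := by
    by_contra h1; apply h; simp [pc, h1]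
  have h0 : 0 ≤ (K:ℝ) * t := mul_nonneg hK0.le ht.1
  have h2 := Nat.floor_le h0
  have h3 := Nat.lt_floor_add_one ((K:ℝ) * t)
  rw [h1] at h2 h3
  refine ⟨?_, ?_, ht⟩
  · rw [div_le_iff₀ hK0]; linarith
  · rw [← add_div, lt_div_iff₀ hK0]; linarith

lemma pc_sum {K : ℕ} {f : ℝ → ℂ} (hf : Gd f) (t : ℝ) : f t = ∑ j ∈ Finset.range (K + 1), pc K f j t := by
  unfold pc
  rw [Finset.sum_ite_eq]
  split_ifs with h
  · rfl
  · apply hf.supp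
    intro ht; apply h
    rw [Finset.mem_range, Nat.lt_succ_iff]
    apply Nat.floor_le_of_le
    nlinarith [ht.2, (Nat.cast_nonneg K : (0:ℝ) ≤ K)]

lemma pc_N {K : ℕ} {f : ℝ → ℂ} (hf : Gd f) : ∑ j ∈ Finset.range (K + 1), Nf (pc K f j) ≤ Nf f := by
  unfold Nf
  rw [← lintegral_finsetSum _ (fun j _ => (pc_gd hf j).meas.enorm.pow_const 2)]
  refine lintegral_mono fun t => ?_
  simp only
  have : ∀ j, ‖pc K f j t‖ₑ ^ 2 = if ⌊(K:ℝ) * t⌋₊ = j then ‖f t‖ₑ ^ 2 else 0 := by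
    intro j; unfold pc; split_ifs <;> simp
  simp_rw [this]
  rw [Finset.sum_ite_eq]
  split_ifs
  · exact le_rfl
  · exact zero_le

lemma pc_N1 {K : ℕ} {f : ℝ → ℂ} (j : ℕ) : Nf (pc K f j) ≤ Nf f := by
  unfold Nf
  refine lintegral_mono fun t => ?_
  simp only [pc]; split_ifs <;> simp

lemma pc_E {K : ℕ} {φ : ℝ → ℝ} (hφ : Continuous φ) {f : ℝ → ℂ} (hf : Gd f) (x : ℝ × ℝ) :
    Eop φ f x = ∑ j ∈ Finset.range (K + 1), Eop φ (pc K f j) x := by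
  unfold Eop
  rw [← integral_finsetSum]
  · congr 1; ext t
    rw [← Finset.sum_mul, ← pc_sum hf]
  · intro j _
    have := (pc_gd (K := K) hf j).meas
    have hm := hφ.measurable
    refine (pc_gd (K := K) hf j).integrable.mono (by apply Measurable.aestronglyMeasurable; fun_prop) ?_
    exact Filter.Eventually.of_forall fun t => by simp [norm_ee]

lemma mul_le_sq_add (a b : ℝ≥0∞) : a * b ≤ a ^ 2 + b ^ 2 := by
  rcases le_total a b with h | h
  · calc a * b ≤ b * b := by gcongr
      _ ≤ _ := by rw [← sq]; exact le_add_self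
  · calc a * b ≤ a * a := by gcongr
      _ ≤ _ := by rw [← sq]; exact le_self_add

/-- neighbours -/
def nb (i j : ℕ) : Prop := i ≤ j + 1 ∧ j ≤ i + 1
instance (i j : ℕ) : Decidable (nb i j) := by unfold nb; infer_instance

lemma card_nb (n i : ℕ) : ((Finset.range n).filter (fun j => nb i j)).card ≤ 3 := by
  refine (Finset.card_le_card (t := {i - 1, i, i + 1}) ?_).trans Finset.card_le_three
  intro j hj
  obtain ⟨h1, h2⟩ : i ≤ j + 1 ∧ j ≤ i + 1 := (Finset.mem_filter.1 hj).2
  simp only [Finset.mem_insert, Finset.mem_singleton]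
  omega

lemma split_sq (n : ℕ) (a : ℕ → ℝ≥0∞) : (∑ j ∈ Finset.range n, a j) ^ 2 ≤
    6 * ∑ j ∈ Finset.range n, a j ^ 2 +
      ∑ i ∈ Finset.range n, ∑ j ∈ Finset.range n, if nb i j then 0 else a i * a j := by
  have e : (∑ j ∈ Finset.range n, a j) ^ 2 =
      (∑ i ∈ Finset.range n, ∑ j ∈ Finset.range n, if nb i j then a i * a j else 0) +
      ∑ i ∈ Finset.range n, ∑ j ∈ Finset.range n, if nb i j then 0 else a i * a j := by
    rw [sq, Finset.sum_mul_sum, ← Finset.sum_add_distrib]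
    refine Finset.sum_congr rfl fun i _ => ?_
    rw [← Finset.sum_add_distrib]
    refine Finset.sum_congr rfl fun j _ => ?_
    split_ifs <;> simp
  have hs : ∀ i, ∑ j ∈ Finset.range n, (if nb i j then a i ^ 2 else 0) ≤ 3 * a i ^ 2 := by
    intro i
    rw [← Finset.sum_filter, Finset.sum_const, nsmul_eq_mul]
    gcongr
    exact_mod_cast card_nb n i
  rw [e]
  refine add_le_add ?_ le_rfl
  calc _ ≤ ∑ i ∈ Finset.range n, ∑ j ∈ Finset.range n,
        ((if nb i j then a i ^ 2 else 0) + (if nb j i then a j ^ 2 else 0)) := by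
        refine Finset.sum_le_sum fun i _ => Finset.sum_le_sum fun j _ => ?_
        have : nb i j ↔ nb j i := by unfold nb; omega
        by_cases h : nb i j
        · rw [if_pos h, if_pos h, if_pos (this.1 h)]; exact mul_le_sq_add _ _
        · simp [h]
    _ = (∑ i ∈ Finset.range n, ∑ j ∈ Finset.range n, (if nb i j then a i ^ 2 else 0)) +
        ∑ j ∈ Finset.range n, ∑ i ∈ Finset.range n, (if nb j i then a j ^ 2 else 0) := by
        simp_rw [Finset.sum_add_distrib]
        congr 1
        exact Finset.sum_comm
    _ ≤ (∑ i ∈ Finset.range n, 3 * a i ^ 2) + ∑ i ∈ Finset.range n, 3 * a i ^ 2 :=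
        add_le_add (Finset.sum_le_sum fun i _ => hs i) (Finset.sum_le_sum fun i _ => hs i)
    _ = _ := by
        rw [← Finset.mul_sum, ← two_mul, ← mul_assoc]; norm_num

lemma step {K : ℕ} (hK : 1 ≤ K) {s : ℝ} (hs0 : 0 ≤ s) (hs2 : s ≤ 2) {R : ℝ} (hR : K ≤ R) {A : ℝ≥0∞}
    (hW : WW s (R / K ^ 2) A) :
    WW s R (6 * (ENNReal.ofReal (18 * K ^ s) * A) +
      (K + 1) ^ 2 * (CB (1 / K) * ENNReal.ofReal (R ^ (s / 2)))) := by
  intro φ φ' hφ f hf D H hfin hH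
  have hK1 : (1:ℝ) ≤ K := by exact_mod_cast hK
  have hK0 : (0:ℝ) < K := by linarith
  have hR1 : 1 ≤ R := hK1.trans hR
  have hm : ∀ j, Measurable (fun x => ‖Eop φ (pc K f j) x‖ₑ) := fun j =>
    (continuous_Eop hφ.cont (pc_gd hf j).integrable).measurable.enorm
  set Y := CB (1 / K) * ENNReal.ofReal (R ^ (s / 2)) with hY
  have hpt : ∀ x, ‖Eop φ f x‖ₑ ^ 2 ≤ 6 * ∑ j ∈ Finset.range (K + 1), ‖Eop φ (pc K f j) x‖ₑ ^ 2 +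
      ∑ i ∈ Finset.range (K + 1), ∑ j ∈ Finset.range (K + 1),
        if nb i j then 0 else ‖Eop φ (pc K f i) x‖ₑ * ‖Eop φ (pc K f j) x‖ₑ := by
    intro x
    refine le_trans ?_ (split_sq _ _)
    gcongr
    rw [pc_E (K := K) hφ.cont hf]
    exact enorm_sum_le _ _
  have hnar : ∀ j ∈ Finset.range (K + 1), ∫⁻ x, ‖Eop φ (pc K f j) x‖ₑ ^ 2 ∂H ≤
      ENNReal.ofReal (18 * K ^ s) * A * (D * Nf (pc K f j)) := by
    intro j hj
    refine narrow1 hφ (pc_gd hf j) hK (t0 := (j:ℝ) / K) ⟨by positivity, ?_⟩ ?_ hs0 hs2 hH hW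
    · rw [div_le_one hK0]
      exact_mod_cast Nat.lt_succ_iff.1 (Finset.mem_range.1 hj)
    · intro t ht
      obtain ⟨h1, h2, -⟩ := pc_supp hK hf ht
      exact ⟨h1, h2.le⟩
  have hbr1 : ∀ i j, i + 2 ≤ j → ∫⁻ x, ‖Eop φ (pc K f i) x‖ₑ * ‖Eop φ (pc K f j) x‖ₑ ∂H ≤
      Y * (D * Nf f) := by
    intro i j hij
    refine (broad hφ (pc_gd hf i) (pc_gd hf j) hR1 (κ := 1 / K) (by positivity) ?_ ?_ hH).trans ?_
    · rw [show 2 * (1 / (K:ℝ)) * R = 2 * (R / K) by ring]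
      have : 1 ≤ R / K := by rwa [le_div_iff₀ hK0, one_mul]
      linarith
    · intro t u ht hu
      obtain ⟨h1, h2, -⟩ := pc_supp hK hf ht
      obtain ⟨h3, -, -⟩ := pc_supp hK hf hu
      have h4 : ((i:ℝ) + 2) / K ≤ j / K := by
        gcongr; exact_mod_cast hij
      rw [add_div] at h4
      have h5 : (2:ℝ) / K = 1 / K + 1 / K := by ring
      linarith
    · gcongr
      calc sqh (Nf (pc K f i) * Nf (pc K f j)) ≤ sqh (Nf f ^ 2) := by
            apply sqh_mono; rw [sq]; exact mul_le_mul' (pc_N1 i) (pc_N1 j)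
        _ = _ := sqh_sq _
  have hbr : ∀ i j, ∫⁻ x, (if nb i j then 0 else ‖Eop φ (pc K f i) x‖ₑ * ‖Eop φ (pc K f j) x‖ₑ) ∂H ≤
      Y * (D * Nf f) := by
    intro i j
    by_cases h : nb i j
    · simp [h]
    · simp only [h, if_false]
      unfold nb at h
      rcases lt_or_ge i j with h1 | h1
      · exact hbr1 i j (by omega)
      · simp_rw [mul_comm (‖Eop φ (pc K f i) _‖ₑ)]
        exact hbr1 j i (by omega)
  have hmm : ∀ i j, Measurable (fun x => if nb i j then 0 else ‖Eop φ (pc K f i) x‖ₑ * ‖Eop φ (pc K f j) x‖ₑ) := by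
    intro i j
    by_cases h : nb i j
    · simp [h]
    · simp only [h, if_false]; exact (hm i).mul (hm j)
  calc _ ≤ _ := lintegral_mono hpt
    _ = 6 * ∑ j ∈ Finset.range (K + 1), ∫⁻ x, ‖Eop φ (pc K f j) x‖ₑ ^ 2 ∂H +
        ∑ i ∈ Finset.range (K + 1), ∑ j ∈ Finset.range (K + 1),
        ∫⁻ x, (if nb i j then 0 else ‖Eop φ (pc K f i) x‖ₑ * ‖Eop φ (pc K f j) x‖ₑ) ∂H := by
        have hms : Measurable (fun x => ∑ j ∈ Finset.range (K + 1), ‖Eop φ (pc K f j) x‖ₑ ^ 2) :=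
          Finset.measurable_sum _ fun j _ => (hm j).pow_const 2
        rw [lintegral_add_left (hms.const_mul 6), lintegral_const_mul _ hms,
          lintegral_finsetSum _ (fun j _ => (hm j).pow_const 2),
          lintegral_finsetSum _ (fun i _ => Finset.measurable_sum _ fun j _ => hmm i j)]
        congr 1
        refine Finset.sum_congr rfl fun i _ => ?_
        rw [lintegral_finsetSum _ (fun j _ => hmm i j)]
    _ ≤ 6 * ∑ j ∈ Finset.range (K + 1), ENNReal.ofReal (18 * K ^ s) * A * (D * Nf (pc K f j)) +
        ∑ i ∈ Finset.range (K + 1), ∑ j ∈ Finset.range (K + 1), Y * (D * Nf f) := by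
        refine add_le_add (mul_le_mul_right (Finset.sum_le_sum hnar) _)
          (Finset.sum_le_sum fun i _ => Finset.sum_le_sum fun j _ => hbr i j)
    _ ≤ 6 * (ENNReal.ofReal (18 * K ^ s) * A * (D * Nf f)) + (K + 1) ^ 2 * (Y * (D * Nf f)) := by
        refine add_le_add (mul_le_mul_right ?_ _) (le_of_eq ?_)
        · rw [← Finset.mul_sum, ← Finset.mul_sum]
          gcongr
          exact pc_N hf
        · simp only [Finset.sum_const, Finset.card_range, nsmul_eq_mul]
          push_cast; ring
    _ = _ := by ring

lemma WW.mono {s R : ℝ} {A B : ℝ≥0∞} (h : WW s R A) (hAB : A ≤ B) : WW s R B := by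
  intro φ φ' hφ f hf D H hfin hH
  exact (h φ φ' hφ f hf D H hfin hH).trans (by gcongr)

theorem wolff {s ε : ℝ} (hs0 : 0 ≤ s) (hs2 : s ≤ 2) (hε : 0 < ε) :
    ∃ B : ℝ, 0 < B ∧ ∀ R : ℝ, 1 ≤ R → WW s R (ENNReal.ofReal (B * R ^ (s / 2 + ε))) := by
  obtain ⟨K, hK2, hKε⟩ : ∃ K : ℕ, 2 ≤ K ∧ 216 ≤ (K:ℝ) ^ (2 * ε) := by
    have h1 : Filter.Tendsto (fun n : ℕ => (n:ℝ) ^ (2 * ε)) Filter.atTop Filter.atTop :=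
      (tendsto_rpow_atTop (by positivity)).comp tendsto_natCast_atTop_atTop
    obtain ⟨K, h2, h3⟩ := ((Filter.eventually_ge_atTop 2).and (h1.eventually_ge_atTop 216)).exists
    exact ⟨K, h2, h3⟩
  have hK2' : (2:ℝ) ≤ K := by exact_mod_cast hK2
  have hK0 : (0:ℝ) < K := by linarith
  set CK : ℝ := (((K:ℝ≥0∞) + 1) ^ 2 * CB (1 / K)).toReal with hCK
  have hCKe : ENNReal.ofReal CK = ((K:ℝ≥0∞) + 1) ^ 2 * CB (1 / K) := by
    apply ENNReal.ofReal_toReal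
    exact ENNReal.mul_ne_top (by simp) (CB_ne _)
  have hCK0 : 0 ≤ CK := ENNReal.toReal_nonneg
  set B : ℝ := 1000000 * K ^ 2 + 2 * CK with hB
  have hB0 : 0 < B := by positivity
  refine ⟨B, hB0, ?_⟩
  have key : ∀ n : ℕ, ∀ R : ℝ, 1 ≤ R → R < ((K:ℝ) ^ 2) ^ n →
      WW s R (ENNReal.ofReal (B * R ^ (s / 2 + ε))) := by
    intro n
    induction n with
    | zero => intro R h1 h2; simp at h2; linarith
    | succ n ih =>
      intro R h1 h2
      have hR0 : 0 < R := by linarith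
      have hRp : 1 ≤ R ^ (s / 2 + ε) := Real.one_le_rpow h1 (by positivity)
      rcases lt_or_ge R ((K:ℝ) ^ 2) with h3 | h3
      · refine (WW_triv s h1).mono (ENNReal.ofReal_le_ofReal ?_)
        calc 1000000 * R ≤ B * 1 := by rw [hB]; nlinarith
          _ ≤ _ := by gcongr
      · have h4 := ih (R / K ^ 2) (by rwa [le_div_iff₀ (by positivity), one_mul])
          (by rw [div_lt_iff₀ (by positivity)]; rwa [pow_succ] at h2)
        refine (step (by omega) hs0 hs2 (by nlinarith) h4).mono ?_
        rw [← mul_assoc ((K + 1 : ℝ≥0∞) ^ 2), ← hCKe, ← ENNReal.ofReal_mul hCK0,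
          show (6:ℝ≥0∞) = ENNReal.ofReal 6 by norm_num, ← ENNReal.ofReal_mul (by positivity),
          ← ENNReal.ofReal_mul (by positivity), ← ENNReal.ofReal_add (by positivity) (by positivity)]
        apply ENNReal.ofReal_le_ofReal
        have e1 : (R / (K:ℝ) ^ 2) ^ (s / 2 + ε) = R ^ (s / 2 + ε) / (K ^ s * K ^ (2 * ε)) := by
          rw [Real.div_rpow hR0.le (by positivity), ← Real.rpow_natCast, ← Real.rpow_mul hK0.le,
            ← Real.rpow_add hK0]
          congr 2; push_cast; ring
        have e2 : 6 * (18 * (K:ℝ) ^ s * (B * (R / (K:ℝ) ^ 2) ^ (s / 2 + ε))) =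
            B * R ^ (s / 2 + ε) * (108 / K ^ (2 * ε)) := by
          rw [e1]; field_simp; ring
        have e3 : 108 / (K:ℝ) ^ (2 * ε) ≤ 1 / 2 := by
          rw [div_le_iff₀ (by positivity)]; linarith
        have e4 : R ^ (s / 2) ≤ R ^ (s / 2 + ε) := Real.rpow_le_rpow_of_exponent_le h1 (by linarith)
        have e5 : B * R ^ (s / 2 + ε) * (108 / K ^ (2 * ε)) ≤ B * R ^ (s / 2 + ε) * (1 / 2) := by gcongr
        have e6 : CK * R ^ (s / 2) ≤ B / 2 * R ^ (s / 2 + ε) := by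
          have : CK ≤ B / 2 := by rw [hB]; nlinarith [sq_nonneg (K:ℝ)]
          gcongr
        rw [e2]; linarith
  intro R hR
  obtain ⟨n, hn⟩ := pow_unbounded_of_one_lt R (show (1:ℝ) < (K:ℝ) ^ 2 by nlinarith)
  exact key n R hR hn
end

section
lemma circ_phase : ∃ φ φ' : ℝ → ℝ, Ph φ φ' ∧ ∀ t ∈ Icc (0:ℝ) (1/2), φ t = 1 - √(1 - t ^ 2) := by
  set g : ℝ → ℝ := fun t => 1 / ((1 - min (t ^ 2) (1 / 4)) * √(1 - min (t ^ 2) (1 / 4))) with hg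
  have hlo : ∀ t, (3:ℝ) / 4 ≤ 1 - min (t ^ 2) (1 / 4) := fun t => by
    have := min_le_right (t ^ 2) (1 / 4 : ℝ); linarith
  have hhi : ∀ t, 1 - min (t ^ 2) (1 / 4) ≤ (1:ℝ) := fun t => by
    have : 0 ≤ min (t ^ 2) (1 / 4 : ℝ) := le_min (by positivity) (by norm_num)
    linarith
  have hpos : ∀ t, 0 < (1 - min (t ^ 2) (1 / 4 : ℝ)) * √(1 - min (t ^ 2) (1 / 4)) := fun t =>
    mul_pos (by linarith [hlo t]) (Real.sqrt_pos.2 (by linarith [hlo t]))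
  have hgc : Continuous g := by
    rw [hg]
    refine Continuous.div continuous_const (by fun_prop) fun t => (hpos t).ne'
  have hg1 : ∀ t, 1 ≤ g t := fun t => by
    rw [hg]; dsimp only
    rw [le_div_iff₀ (hpos t), one_mul]
    exact mul_le_one₀ (hhi t) (Real.sqrt_nonneg _) (Real.sqrt_le_one.2 (hhi t))
  have hg2 : ∀ t, g t ≤ 2 := fun t => by
    rw [hg]; dsimp only
    rw [div_le_iff₀ (hpos t)]
    have h1 : (3:ℝ) / 4 ≤ √(1 - min (t ^ 2) (1 / 4)) := by
      apply Real.le_sqrt_of_sq_le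
      linarith [hlo t]
    nlinarith [hlo t]
  set φ' : ℝ → ℝ := fun t => ∫ u in (0:ℝ)..t, g u with hφ'
  have hd' : ∀ t, HasDerivAt φ' (g t) t := fun t =>
    intervalIntegral.integral_hasDerivAt_right (hgc.intervalIntegrable _ _)
      (hgc.stronglyMeasurableAtFilter _ _) hgc.continuousAt
  have hc' : Continuous φ' := continuous_iff_continuousAt.2 fun t => (hd' t).continuousAt
  set φ : ℝ → ℝ := fun t => ∫ u in (0:ℝ)..t, φ' u with hφ
  have hd : ∀ t, HasDerivAt φ (φ' t) t := fun t =>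
    intervalIntegral.integral_hasDerivAt_right (hc'.intervalIntegrable _ _)
      (hc'.stronglyMeasurableAtFilter _ _) hc'.continuousAt
  have hsub : ∀ u t, φ' t - φ' u = ∫ x in u..t, g x := fun u t => by
    rw [hφ']
    exact intervalIntegral.integral_interval_sub_left (hgc.intervalIntegrable _ _)
      (hgc.intervalIntegrable _ _)
  refine ⟨φ, φ', ⟨by simp [hφ], by simp [hφ'], hd, ?_, ?_⟩, ?_⟩
  · intro u t hut
    rw [hsub]
    have := intervalIntegral.integral_mono_on (μ := volume) (f := fun _ => (1:ℝ)) (g := g) hut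
      (by simp) (hgc.intervalIntegrable _ _) (fun x _ => hg1 x)
    simpa using this
  · intro u t hut
    rw [hsub]
    have := intervalIntegral.integral_mono_on (μ := volume) (g := fun _ => (2:ℝ)) (f := g) hut
      (hgc.intervalIntegrable _ _) (by simp) (fun x _ => hg2 x)
    simp only [intervalIntegral.integral_const, smul_eq_mul] at this
    linarith
  · have hp : ∀ x ∈ Icc (0:ℝ) (1/2), (3:ℝ)/4 ≤ 1 - x ^ 2 := fun x hx => by nlinarith [hx.1, hx.2]
    have hds : ∀ x ∈ Icc (0:ℝ) (1/2), HasDerivAt (fun x : ℝ => √(1 - x ^ 2)) (- x / √(1 - x ^ 2)) x := by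
      intro x hx
      have h1 : HasDerivAt (fun x : ℝ => 1 - x ^ 2) (- (2 * x)) x := by
        simpa using ((hasDerivAt_pow 2 x).const_sub 1)
      have := h1.sqrt (by linarith [hp x hx])
      refine this.congr_deriv ?_
      have := Real.sqrt_pos.2 (show 0 < 1 - x ^ 2 by linarith [hp x hx])
      field_simp
    have e1 : ∀ t ∈ Icc (0:ℝ) (1/2), φ' t = t / √(1 - t ^ 2) := by
      intro t ht
      have := intervalIntegral.integral_eq_sub_of_hasDerivAt (f := fun x => x / √(1 - x ^ 2))
        (f' := g) (a := 0) (b := t) (fun x hx => ?_) (hgc.intervalIntegrable _ _)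
      · rw [hφ']; simpa using this
      · rw [uIcc_of_le ht.1] at hx
        have hx' : x ∈ Icc (0:ℝ) (1/2) := ⟨hx.1, hx.2.trans ht.2⟩
        have hs := Real.sqrt_pos.2 (show 0 < 1 - x ^ 2 by linarith [hp x hx'])
        refine ((hasDerivAt_id x).div (hds x hx') hs.ne').congr_deriv ?_
        have hm : min (x ^ 2) (1 / 4 : ℝ) = x ^ 2 := min_eq_left (by nlinarith [hx'.1, hx'.2])
        rw [hg]; dsimp only [id]
        rw [hm]
        have h2 := Real.sq_sqrt (show 0 ≤ 1 - x ^ 2 by linarith [hp x hx'])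
        have h3 : 1 - x ^ 2 ≠ 0 := by have := hp x hx'; linarith
        field_simp
        rw [h2]; ring
    intro t ht
    have := intervalIntegral.integral_eq_sub_of_hasDerivAt (f := fun x => 1 - √(1 - x ^ 2))
        (f' := φ') (a := 0) (b := t) (fun x hx => ?_) (hc'.intervalIntegrable _ _)
    · rw [hφ]; simpa using this
    · rw [uIcc_of_le ht.1] at hx
      have hx' : x ∈ Icc (0:ℝ) (1/2) := ⟨hx.1, hx.2.trans ht.2⟩
      refine ((hds x hx').const_sub 1).congr_deriv ?_
      rw [e1 x hx']; ring

/-- Frostman measures -/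
structure FM (s D M : ℝ) (μ : Measure ℂ) : Prop where
  ball : ∀ x r, 0 < r → μ (closedBall x r) ≤ ENNReal.ofReal (D * r ^ s)
  supp : μ {x | M < ‖x‖} = 0

lemma FM.mass {s D M : ℝ} (hM : 0 < M) {μ : Measure ℂ} (h : FM s D M μ) :
    μ univ ≤ ENNReal.ofReal (D * M ^ s) := by
  have : (univ : Set ℂ) ⊆ {x | M < ‖x‖} ∪ closedBall 0 M := by
    intro x _
    rcases lt_or_ge M ‖x‖ with h | h
    · left; exact h
    · right; simpa using h
  calc _ ≤ _ := measure_mono this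
    _ ≤ _ := measure_union_le _ _
    _ ≤ _ := by rw [h.supp, zero_add]; exact h.ball _ _ hM

lemma arc {s ε D M : ℝ} (hs0 : 0 ≤ s) (hs2 : s ≤ 2) (hε : 0 < ε) (hD : 0 ≤ D) (hM : 1 ≤ M) :
    ∃ C : ℝ, 0 ≤ C ∧ ∀ μ : Measure ℂ, FM s D M μ → ∀ r : ℝ, 1 ≤ r →
      ∫⁻ t in Icc (0:ℝ) (1/2), ‖∫ x, ee (r * (x.re * √(1 - t ^ 2) + x.im * t)) ∂μ‖ₑ ^ 2 ≤
        ENNReal.ofReal (C * r ^ (-(s / 2 - ε))) := by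
  obtain ⟨B, hB, hW⟩ := wolff hs0 hs2 hε
  obtain ⟨φ, φ', hφ, hφe⟩ := circ_phase
  refine ⟨(D * M ^ s) * (B * M ^ (s / 2 + ε) * (D * 2 ^ s)), by positivity, fun μ hμ r hr => ?_⟩
  have hm := hμ.mass (by linarith)
  haveI : IsFiniteMeasure μ := ⟨hm.trans_lt ENNReal.ofReal_lt_top⟩
  have hr0 : 0 < r := by linarith
  set P : ℝ → ℂ := fun t => ∫ x, ee (r * (x.re * √(1 - t ^ 2) + x.im * t)) ∂μ with hP
  have hce : Continuous (fun p : ℝ × ℂ => ee (r * (p.2.re * √(1 - p.1 ^ 2) + p.2.im * p.1))) := by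
    refine continuous_ee.comp ?_
    fun_prop
  have hPc : Continuous P := by
    apply continuous_of_dominated (bound := fun t => 1)
    · intro t
      exact (hce.comp (continuous_const.prodMk continuous_id)).aestronglyMeasurable
    · intro ξ; exact Filter.Eventually.of_forall fun t => by simp [norm_ee]
    · simp
    · refine Filter.Eventually.of_forall fun x => ?_
      exact hce.comp (continuous_id.prodMk continuous_const)
  set m := (μ univ).toReal with hmdef
  have hPb : ∀ t, ‖P t‖ ≤ m := fun t => by
    refine (norm_integral_le_integral_norm _).trans ?_
    simp [norm_ee, hmdef, Measure.real]
  set f : ℝ → ℂ := (Icc (0:ℝ) (1/2)).indicator (fun t => (starRingEnd ℂ) (P t)) with hf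
  have hfG : Gd f := by
    refine ⟨?_, ⟨m, fun t => ?_⟩, fun t ht => ?_⟩
    · exact (by fun_prop : Continuous fun t => (starRingEnd ℂ) (P t)).measurable.indicator
        measurableSet_Icc
    · refine (norm_indicator_le_norm_self _ _).trans ?_
      simpa using hPb t
    · exact indicator_of_notMem (fun h => ht ⟨h.1, h.2.trans (by norm_num)⟩) _
  have hN : Nf f = ∫⁻ t in Icc (0:ℝ) (1/2), ‖P t‖ₑ ^ 2 := by
    rw [← lintegral_indicator measurableSet_Icc]
    unfold Nf
    congr 1; ext t
    by_cases ht : t ∈ Icc (0:ℝ) (1/2)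
    · rw [hf, indicator_of_mem ht, indicator_of_mem ht, RCLike.enorm_conj]
    · rw [hf, indicator_of_notMem ht, indicator_of_notMem ht]; simp
  rw [← hN]
  have hNf : Nf f ≠ ∞ := by
    rw [hN]
    refine (lt_of_le_of_lt (setLIntegral_mono (g := fun _ => ENNReal.ofReal m ^ 2) (by fun_prop)
      fun t _ => ?_) ?_).ne
    · gcongr; rw [← ofReal_norm]; exact ENNReal.ofReal_le_ofReal (hPb t)
    · rw [setLIntegral_const]
      exact ENNReal.mul_lt_top (ENNReal.pow_lt_top ENNReal.ofReal_lt_top) (by simp)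
  -- duality
  set H : Measure (ℝ × ℝ) := μ.map (fun x : ℂ => (r * x.im, - (r * x.re))) with hH
  have hqm : Measurable (fun x : ℂ => (r * x.im, - (r * x.re))) := by fun_prop
  have key1 : ∫ t, f t * P t = ∫ x, ee (r * x.re) * Eop φ f (r * x.im, - (r * x.re)) ∂μ := by
    calc ∫ t, f t * P t = ∫ t, ∫ x, f t * ee (r * (x.re * √(1 - t ^ 2) + x.im * t)) ∂μ := by
          congr 1; ext t; rw [integral_const_mul]
      _ = ∫ x, (∫ t, f t * ee (r * (x.re * √(1 - t ^ 2) + x.im * t))) ∂μ := by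
          apply integral_integral_swap
          have : Integrable (fun p : ℝ × ℂ => f p.1 * (1:ℂ)) (volume.prod μ) :=
            hfG.integrable.mul_prod (integrable_const _)
          refine this.mono ?_ ?_
          · exact (hfG.meas.comp measurable_fst).aestronglyMeasurable.mul hce.aestronglyMeasurable
          · exact Filter.Eventually.of_forall fun t => by simp [norm_ee, Function.uncurry]
      _ = _ := by
          congr 1; ext x
          unfold Eop
          rw [← integral_const_mul]
          congr 1; ext t
          by_cases ht : t ∈ Icc (0:ℝ) (1/2)
          · rw [hφe t ht, mul_left_comm, ← ee_add]
            congr 2; ring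
          · rw [hf, indicator_of_notMem ht]; simp
  have key2 : Nf f = ‖∫ t, f t * P t‖ₑ := by
    have e : ∀ t, f t * P t = ((‖f t‖ ^ 2 : ℝ) : ℂ) := fun t => by
      by_cases ht : t ∈ Icc (0:ℝ) (1/2)
      · rw [hf, indicator_of_mem ht, RCLike.norm_conj, ← Complex.normSq_eq_norm_sq,
          Complex.normSq_eq_conj_mul_self]
      · rw [hf, indicator_of_notMem ht]; simp
    simp_rw [e]
    rw [integral_complex_ofReal, ← ofReal_norm, Complex.norm_real, Real.norm_of_nonneg
      (integral_nonneg fun _ => by positivity), ofReal_integral_eq_lintegral_ofReal]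
    · unfold Nf; congr 1; ext t; rw [enorm_sq_eq]
    · refine (hfG.integrable.norm.const_mul m).mono
        (hfG.meas.norm.pow_const 2).aestronglyMeasurable ?_
      refine Filter.Eventually.of_forall fun t => ?_
      have : ‖f t‖ ≤ m := by
        refine (norm_indicator_le_norm_self _ _).trans ?_
        simpa using hPb t
      have h0 : 0 ≤ m := ENNReal.toReal_nonneg
      rw [Real.norm_of_nonneg (by positivity), Real.norm_of_nonneg (by positivity), sq]
      gcongr
    · exact Filter.Eventually.of_forall fun _ => by positivity
  have hEc : Continuous (Eop φ f) := continuous_Eop hφ.cont hfG.integrable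
  have key3 : Nf f ^ 2 ≤ μ univ * ∫⁻ x, ‖Eop φ f x‖ₑ ^ 2 ∂H := by
    rw [hH, lintegral_map (by fun_prop) hqm]
    have : Nf f ≤ ∫⁻ x, 1 * ‖Eop φ f (r * x.im, - (r * x.re))‖ₑ ∂μ := by
      rw [key2, key1]
      refine (enorm_integral_le_lintegral_enorm _).trans (lintegral_mono fun x => ?_)
      rw [enorm_mul, enorm_ee]
    refine (pow_le_pow_left₀ zero_le this 2).trans ?_
    refine (cs_sq (by fun_prop) ?_).trans ?_
    · exact ((hEc.measurable.comp hqm).enorm).aemeasurable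
    · simp
  haveI : IsFiniteMeasure H := by rw [hH]; infer_instance
  have hHB : HB s (r * M) (ENNReal.ofReal (D * 2 ^ s * r ^ (-s))) H := by
    constructor
    · rw [hH, Measure.map_apply hqm (by measurability)]
      refine measure_mono_null ?_ hμ.supp
      intro x hx
      simp only [mem_preimage, mem_setOf_eq, abs_neg, abs_mul, abs_of_pos hr0] at hx ⊢
      exact (lt_of_mul_lt_mul_left hx hr0.le).trans_le (Complex.abs_re_le_norm x)
    · intro y ρ hρ
      rw [hH, Measure.map_apply hqm isClosed_closedBall.measurableSet]
      rw [← ENNReal.ofReal_mul (by positivity)]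
      have : (fun x : ℂ => (r * x.im, - (r * x.re))) ⁻¹' closedBall y ρ ⊆
          closedBall (⟨-y.2 / r, y.1 / r⟩ : ℂ) (2 * (ρ / r)) := by
        intro x hx
        simp only [mem_preimage, mem_closedBall, Prod.dist_eq, Real.dist_eq, sup_le_iff] at hx
        rw [mem_closedBall, Complex.dist_eq]
        refine (Complex.norm_le_abs_re_add_abs_im _).trans ?_
        simp only [Complex.sub_re, Complex.sub_im]
        have e1 : x.re - -y.2 / r = - ((-(r * x.re) - y.2) / r) := by field_simp; ring
        have e2 : x.im - y.1 / r = (r * x.im - y.1) / r := by field_simp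
        rw [e1, e2, abs_neg, abs_div, abs_div, abs_of_pos hr0, two_mul]
        exact add_le_add (by gcongr; exact hx.2) (by gcongr; exact hx.1)
      refine (measure_mono this).trans ((hμ.ball _ _ (by positivity)).trans ?_)
      refine ENNReal.ofReal_le_ofReal (le_of_eq ?_)
      rw [Real.mul_rpow (by norm_num) (by positivity), Real.div_rpow (by linarith) hr0.le,
        Real.rpow_neg hr0.le]
      ring
  have hfin := hW (r * M) (by nlinarith) φ φ' hφ f hfG _ H inferInstance hHB
  have key4 : Nf f ^ 2 ≤ (ENNReal.ofReal (D * M ^ s) * (ENNReal.ofReal (B * (r * M) ^ (s / 2 + ε)) *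
      ENNReal.ofReal (D * 2 ^ s * r ^ (-s)))) * Nf f := by
    refine key3.trans ?_
    rw [mul_assoc, mul_assoc]
    exact mul_le_mul' hm hfin
  have key5 : Nf f ≤ ENNReal.ofReal (D * M ^ s) * (ENNReal.ofReal (B * (r * M) ^ (s / 2 + ε)) *
      ENNReal.ofReal (D * 2 ^ s * r ^ (-s))) := by
    by_cases h0 : Nf f = 0
    · rw [h0]; exact zero_le
    · rw [sq] at key4
      exact (ENNReal.mul_le_mul_iff_left h0 hNf).1 key4
  refine key5.trans (le_of_eq ?_)
  rw [← ENNReal.ofReal_mul (by positivity), ← ENNReal.ofReal_mul (by positivity)]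
  congr 1
  rw [Real.mul_rpow hr0.le (by linarith)]
  have : r ^ (-(s / 2 - ε)) = r ^ (s / 2 + ε) * r ^ (-s) := by
    rw [← Real.rpow_add hr0]; congr 1; ring
  rw [this]; ring
end

section
/-- point on the circle -/
def cis (θ : ℝ) : ℂ := Complex.exp (θ * Complex.I)

lemma cis_add (a b : ℝ) : cis (a + b) = cis a * cis b := by
  unfold cis; rw [← Complex.exp_add]; push_cast; ring_nf
lemma cis_re (a : ℝ) : (cis a).re = Real.cos a := by
  unfold cis; exact Complex.exp_ofReal_mul_I_re a
lemma cis_im (a : ℝ) : (cis a).im = Real.sin a := by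
  unfold cis; exact Complex.exp_ofReal_mul_I_im a
@[simp] lemma norm_cis (a : ℝ) : ‖cis a‖ = 1 := by
  unfold cis; exact Complex.norm_exp_ofReal_mul_I a
lemma cis_ne (a : ℝ) : cis a ≠ 0 := by
  intro h; have := norm_cis a; rw [h] at this; simp at this
lemma continuous_cis : Continuous cis := by unfold cis; fun_prop
lemma conj_cis (a : ℝ) : (starRingEnd ℂ) (cis a) = cis (-a) := by
  apply Complex.ext <;> simp [cis_re, cis_im]
lemma cis_zero : cis 0 = 1 := by simp [cis]
lemma cis_neg_mul (a : ℝ) : cis (-a) * cis a = 1 := by rw [← cis_add]; simp [cis_zero]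
lemma cis_mul_neg (a : ℝ) : cis a * cis (-a) = 1 := by rw [← cis_add]; simp [cis_zero]

/-- Fourier transform of measures -/
def FTm (μ : Measure ℂ) (ξ : ℂ) : ℂ := ∫ x, ee (inner ℝ ξ x) ∂μ

lemma FM.rot {s D M : ℝ} {μ : Measure ℂ} (h : FM s D M μ) (a : ℝ) :
    FM s D M (μ.map (fun x => cis a * x)) := by
  have hm : Measurable (fun x : ℂ => cis a * x) := by fun_prop
  constructor
  · intro x r hr
    rw [Measure.map_apply hm isClosed_closedBall.measurableSet]
    refine (measure_mono ?_).trans (h.ball (cis (-a) * x) r hr)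
    intro y hy
    simp only [mem_preimage, mem_closedBall, Complex.dist_eq] at hy ⊢
    have : y - cis (-a) * x = cis (-a) * (cis a * y - x) := by
      linear_combination (-y) * cis_neg_mul a
    rw [this, norm_mul, norm_cis, one_mul]; exact hy
  · rw [Measure.map_apply hm (by measurability)]
    refine measure_mono_null ?_ h.supp
    intro x hx; simpa using hx

lemma inner_cis (a : ℝ) (x y : ℂ) : inner ℝ x (cis a * y) = inner ℝ (cis (-a) * x) y := by
  simp only [Complex.inner, map_mul, conj_cis, neg_neg]
  congr 1; ring

lemma FTm_rot (μ : Measure ℂ) (a : ℝ) (ξ : ℂ) :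
    FTm (μ.map (fun x => cis a * x)) ξ = FTm μ (cis (-a) * ξ) := by
  unfold FTm
  rw [integral_map (by fun_prop)]
  · simp_rw [inner_cis]
  · apply Continuous.aestronglyMeasurable
    exact continuous_ee.comp (by fun_prop)

lemma arc_sub {g : ℝ → ℝ≥0∞} : ∫⁻ θ in Icc (0:ℝ) (1/2), g (Real.sin θ) ≤
    2 * ∫⁻ t in Icc (0:ℝ) (1/2), g t := by
  have hpi := Real.pi_gt_three
  have hsub : Icc (0:ℝ) (1/2) ⊆ Icc (-(Real.pi/2)) (Real.pi/2) := Icc_subset_Icc (by linarith) (by linarith)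
  have h := lintegral_image_eq_lintegral_abs_deriv_mul (s := Icc (0:ℝ) (1/2)) measurableSet_Icc
    (f := Real.sin) (f' := Real.cos) (fun x _ => (Real.hasDerivAt_sin x).hasDerivWithinAt)
    (Real.injOn_sin.mono hsub) g
  have h1 : ∫⁻ t in Real.sin '' Icc (0:ℝ) (1/2), g t ≤ ∫⁻ t in Icc (0:ℝ) (1/2), g t := by
    refine lintegral_mono_set ?_
    rintro _ ⟨t, ht, rfl⟩
    exact ⟨Real.sin_nonneg_of_nonneg_of_le_pi ht.1 (by linarith [ht.2]),
      (Real.sin_le ht.1).trans ht.2⟩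
  have h2 : ∫⁻ θ in Icc (0:ℝ) (1/2), g (Real.sin θ) ≤
      2 * ∫⁻ θ in Icc (0:ℝ) (1/2), ENNReal.ofReal |Real.cos θ| * g (Real.sin θ) := by
    rw [← lintegral_const_mul' _ _ (by simp)]
    refine setLIntegral_mono' measurableSet_Icc fun t ht => ?_
    have hc : 1 / 2 ≤ |Real.cos t| := by
      refine le_trans ?_ (le_abs_self _)
      have := Real.one_sub_sq_div_two_le_cos (x := t)
      nlinarith [ht.1, ht.2]
    have : 1 ≤ 2 * ENNReal.ofReal |Real.cos t| := by
      rw [show (2:ℝ≥0∞) = ENNReal.ofReal 2 by simp, ← ENNReal.ofReal_mul (by norm_num),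
        ENNReal.one_le_ofReal]
      linarith
    rw [← mul_assoc]
    calc g (Real.sin t) = 1 * g (Real.sin t) := by rw [one_mul]
      _ ≤ _ := by gcongr
  rw [← h] at h2
  exact h2.trans (by gcongr)

/-- Wolff's averaged decay -/
theorem decay {s ε D M : ℝ} (hs0 : 0 ≤ s) (hs2 : s ≤ 2) (hε : 0 < ε) (hD : 0 ≤ D) (hM : 1 ≤ M) :
    ∃ C : ℝ, 0 ≤ C ∧ ∀ μ : Measure ℂ, FM s D M μ → ∀ ξ : ℂ, 1 ≤ ‖ξ‖ →
      ∫⁻ τ in Icc (-(1/4) : ℝ) (1/4), ‖FTm μ (cis τ * ξ)‖ₑ ^ 2 ≤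
        ENNReal.ofReal (C * ‖ξ‖ ^ (-(s / 2 - ε))) := by
  obtain ⟨C, hC, h⟩ := arc hs0 hs2 hε hD hM
  refine ⟨2 * C, by positivity, fun μ hμ ξ hξ => ?_⟩
  set r := ‖ξ‖ with hr
  obtain ⟨α, hα⟩ : ∃ α : ℝ, ξ = r * cis α := ⟨ξ.arg, by
    rw [hr, cis]; exact (Complex.norm_mul_exp_arg_mul_I ξ).symm⟩
  set ν := μ.map (fun x => cis (-(α - 1/4)) * x) with hν
  have hνF := hμ.rot (-(α - 1/4))
  have e1 : ∀ τ : ℝ, FTm μ (cis τ * ξ) =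
      ∫ x, ee (r * (x.re * Real.cos (τ + 1/4) + x.im * Real.sin (τ + 1/4))) ∂ν := by
    intro τ
    have : FTm μ (cis τ * ξ) = FTm ν (r * cis (τ + 1/4)) := by
      rw [hν, FTm_rot, hα]
      congr 1
      rw [mul_left_comm, mul_left_comm _ (r:ℂ), ← cis_add, ← cis_add]
      congr 2; ring
    rw [this, FTm]
    congr 1; ext x
    congr 1
    simp [Complex.inner, cis_re, cis_im]
    ring
  have e2 : ∫⁻ τ in Icc (-(1/4) : ℝ) (1/4), ‖FTm μ (cis τ * ξ)‖ₑ ^ 2 =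
      ∫⁻ θ in Icc (0 : ℝ) (1/2),
        ‖∫ x, ee (r * (x.re * √(1 - Real.sin θ ^ 2) + x.im * Real.sin θ)) ∂ν‖ₑ ^ 2 := by
    rw [← lintegral_indicator measurableSet_Icc, ← lintegral_indicator measurableSet_Icc,
      ← lintegral_sub_right_eq_self _ (1/4 : ℝ)]
    congr 1; ext θ
    by_cases hθ : θ ∈ Icc (0:ℝ) (1/2)
    · rw [indicator_of_mem hθ, indicator_of_mem (show θ - 1/4 ∈ Icc (-(1/4):ℝ) (1/4) from
        ⟨by linarith [hθ.1], by linarith [hθ.2]⟩), e1]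
      have : Real.cos θ = √(1 - Real.sin θ ^ 2) := by
        rw [← Real.cos_eq_sqrt_one_sub_sin_sq] <;> linarith [Real.pi_gt_three, hθ.1, hθ.2]
      rw [← this, sub_add_cancel]
    · rw [indicator_of_notMem hθ, indicator_of_notMem]
      intro h; exact hθ ⟨by linarith [h.1], by linarith [h.2]⟩
  rw [e2]
  refine (arc_sub (g := fun t => ‖∫ x, ee (r * (x.re * √(1 - t ^ 2) + x.im * t)) ∂ν‖ₑ ^ 2)).trans ?_
  refine (mul_le_mul_right (h ν hνF r hξ) _).trans (le_of_eq ?_)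
  rw [show (2:ℝ≥0∞) = ENNReal.ofReal 2 by simp, ← ENNReal.ofReal_mul (by norm_num), mul_assoc]
end

section
lemma gK_C (b : ℝ) (w : ℂ) : gK ℂ b w = (Real.pi / b) * Real.exp (-Real.pi ^ 2 * ‖w‖ ^ 2 / b) := by
  unfold gK
  rw [Complex.finrank_real_complex]
  norm_num

lemma gK_ball {s D : ℝ} (hs0 : 0 ≤ s) (hs2 : s ≤ 2) (hD : 0 ≤ D) :
    ∃ C : ℝ, 0 ≤ C ∧ ∀ (M : ℝ) (μ : Measure ℂ), FM s D M μ → ∀ b : ℝ, 0 < b → ∀ z : ℂ,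
      ∫⁻ y, ENNReal.ofReal (gK ℂ b (z - y)) ∂μ ≤ ENNReal.ofReal (C * b ^ ((s - 2) / 2)) := by
  set a : ℕ → ℝ := fun k => Real.exp (-k) * ((k:ℝ) + 1) ^ 2 with ha
  have hsum : Summable a := by
    have h := (summable_nat_add_iff 1).2 (Real.summable_pow_mul_exp_neg_nat_mul 2 one_pos)
    refine (h.mul_left (Real.exp 1)).congr fun k => ?_
    rw [ha]; push_cast
    rw [mul_left_comm, ← Real.exp_add, mul_comm]
    congr 2; ring
  have ha0 : ∀ k, 0 ≤ a k := fun k => by rw [ha]; positivity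
  refine ⟨Real.pi * D * ∑' k, a k, by
    have h0 : 0 ≤ ∑' k, a k := tsum_nonneg ha0
    positivity, fun M μ hμ b hb z => ?_⟩
  have hsb : 0 < √b := Real.sqrt_pos.2 hb
  have hpt : ∀ y : ℂ, ENNReal.ofReal (gK ℂ b (z - y)) ≤
      ∑' k : ℕ, (closedBall z ((k + 1) * √b)).indicator
        (fun _ => ENNReal.ofReal (Real.pi / b * Real.exp (-k))) y := by
    intro y
    set k := ⌊‖z - y‖ / √b⌋₊ with hk
    have h1 : (k:ℝ) ≤ ‖z - y‖ / √b := Nat.floor_le (by positivity)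
    have h2 : ‖z - y‖ / √b ≤ k + 1 := (Nat.lt_floor_add_one _).le
    refine le_trans ?_ (ENNReal.le_tsum k)
    rw [indicator_of_mem]
    · refine ENNReal.ofReal_le_ofReal ?_
      rw [gK_C]
      gcongr
      have h3 : (k:ℝ) ^ 2 ≤ ‖z - y‖ ^ 2 / b := by
        have := pow_le_pow_left₀ (by positivity) h1 2
        rwa [div_pow, Real.sq_sqrt hb.le] at this
      have h4 : (k:ℝ) ≤ (k:ℝ) ^ 2 := by exact_mod_cast Nat.le_self_pow two_ne_zero k
      have h5 : 1 ≤ Real.pi ^ 2 := by nlinarith [Real.pi_gt_three]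
      have h6 : (0:ℝ) ≤ (k:ℝ) ^ 2 := by positivity
      rw [mul_div_assoc]
      nlinarith
    · rw [mem_closedBall, dist_comm, Complex.dist_eq]
      rwa [div_le_iff₀ hsb] at h2
  calc ∫⁻ y, ENNReal.ofReal (gK ℂ b (z - y)) ∂μ ≤ ∫⁻ y, ∑' k : ℕ, (closedBall z ((k + 1) * √b)).indicator
        (fun _ => ENNReal.ofReal (Real.pi / b * Real.exp (-k))) y ∂μ := lintegral_mono hpt
    _ = ∑' k : ℕ, ENNReal.ofReal (Real.pi / b * Real.exp (-k)) * μ (closedBall z ((k + 1) * √b)) := by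
        rw [lintegral_tsum]
        · congr 1; ext k
          rw [lintegral_indicator isClosed_closedBall.measurableSet, setLIntegral_const]
        · intro k
          exact (measurable_const.indicator isClosed_closedBall.measurableSet).aemeasurable
    _ ≤ ∑' k : ℕ, ENNReal.ofReal (Real.pi * D * b ^ ((s - 2) / 2) * a k) := by
        refine ENNReal.tsum_le_tsum fun k => ?_
        refine (mul_le_mul_right (hμ.ball z _ (by positivity)) _).trans ?_
        rw [← ENNReal.ofReal_mul (by positivity)]
        refine ENNReal.ofReal_le_ofReal ?_
        have e1 : (((k:ℝ) + 1) * √b) ^ s ≤ ((k:ℝ) + 1) ^ 2 * b ^ (s / 2) := by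
          rw [Real.mul_rpow (by positivity) hsb.le, Real.sqrt_eq_rpow, ← Real.rpow_mul hb.le,
            ← Real.rpow_natCast ((k:ℝ) + 1) 2]
          push_cast
          rw [show 1 / 2 * s = s / 2 by ring]
          gcongr
          linarith [(Nat.cast_nonneg k : (0:ℝ) ≤ k)]
        have e2 : b ^ ((s - 2) / 2) = b ^ (s / 2) / b := by
          rw [show (s - 2) / 2 = s / 2 - 1 by ring, Real.rpow_sub_one hb.ne']
        rw [e2, ha]
        calc _ ≤ Real.pi / b * Real.exp (-k) * (D * (((k:ℝ) + 1) ^ 2 * b ^ (s / 2))) := by gcongr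
          _ = _ := by ring
    _ = _ := by
        rw [← ENNReal.ofReal_tsum_of_nonneg, tsum_mul_left]
        · congr 1; ring
        · intro k; have := ha0 k; positivity
        · exact hsum.mul_left _

lemma FTm_cont (μ : Measure ℂ) [IsFiniteMeasure μ] : Continuous (FTm μ) := by
  unfold FTm
  apply continuous_of_dominated (bound := fun t => 1)
  · intro t
    exact (continuous_ee.comp (by fun_prop)).aestronglyMeasurable
  · intro ξ; exact Filter.Eventually.of_forall fun t => by simp [norm_ee]
  · simp
  · exact Filter.Eventually.of_forall fun x => continuous_ee.comp (by fun_prop)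

lemma FTm_bd (μ : Measure ℂ) [IsFiniteMeasure μ] (ξ : ℂ) : ‖FTm μ ξ‖ₑ ≤ μ univ := by
  refine (enorm_integral_le_lintegral_enorm _).trans ?_
  simp [enorm_ee]

lemma GF_int {X : Type*} [MeasurableSpace X] (P : Measure X) [IsFiniteMeasure P] {q : X → ℂ}
    (hq : Measurable q) {b : ℝ} (hb : 0 < b) :
    Integrable (fun z : ℂ × X => (Real.exp (-b * ‖z.1‖ ^ 2) : ℂ) * ee (inner ℝ z.1 (q z.2)))
      (volume.prod P) := by
  have h1 : Integrable (fun z : ℂ × X => ((Real.exp (-b * ‖z.1‖ ^ 2) : ℝ) : ℂ) * (1:ℂ))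
      (volume.prod P) := by
    have h0 : Integrable (fun z : ℂ => ((Real.exp (-b * ‖z‖ ^ 2) : ℝ) : ℂ)) :=
      (integrable_gauss (V := ℂ) hb).ofReal
    exact h0.mul_prod (g := fun _ : X => (1:ℂ)) (integrable_const _)
  refine h1.mono ?_ (Filter.Eventually.of_forall fun z => by simp [norm_ee])
  apply Measurable.aestronglyMeasurable
  refine Measurable.mul (by fun_prop) (measurable_ee.comp ?_)
  exact (measurable_fst).inner (hq.comp measurable_snd)

lemma GF {X : Type*} [MeasurableSpace X] (P : Measure X) [IsFiniteMeasure P] {q : X → ℂ}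
    (hq : Measurable q) {b : ℝ} (hb : 0 < b) :
    ∫ ξ : ℂ, (Real.exp (-b * ‖ξ‖ ^ 2) : ℂ) * (∫ p, ee (inner ℝ ξ (q p)) ∂P) =
      ((∫ p, gK ℂ b (q p) ∂P : ℝ) : ℂ) := by
  simp_rw [← integral_const_mul]
  rw [integral_integral_swap (GF_int P hq hb), ← integral_complex_ofReal]
  congr 1; ext p
  exact gauss_FT hb (q p)

lemma energy {s D M : ℝ} (hM : 0 < M) {C : ℝ}
    {μ : Measure ℂ} (hμ : FM s D M μ) {b : ℝ} (hb : 0 < b)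
    (hC : ∀ z : ℂ, ∫⁻ y, ENNReal.ofReal (gK ℂ b (z - y)) ∂μ ≤ ENNReal.ofReal (C * b ^ ((s - 2) / 2))) :
    ∫⁻ ξ : ℂ, ENNReal.ofReal (Real.exp (-b * ‖ξ‖ ^ 2)) * ‖FTm μ ξ‖ₑ ^ 2 ≤
      ENNReal.ofReal (D * M ^ s) * ENNReal.ofReal (C * b ^ ((s - 2) / 2)) := by
  have hm := hμ.mass hM
  haveI : IsFiniteMeasure μ := ⟨hm.trans_lt ENNReal.ofReal_lt_top⟩
  have hq : Measurable (fun p : ℂ × ℂ => p.1 - p.2) := by fun_prop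
  have e : ∀ ξ : ℂ, ∫ p : ℂ × ℂ, ee (inner ℝ ξ (p.1 - p.2)) ∂(μ.prod μ) = ((‖FTm μ ξ‖ ^ 2 : ℝ) : ℂ) := by
    intro ξ
    rw [← Complex.normSq_eq_norm_sq, ← Complex.mul_conj]
    unfold FTm
    rw [← integral_conj, ← integral_prod_mul]
    congr 1; ext p
    rw [conj_ee, ← ee_add, inner_sub_right]; congr 1
  have h := GF (μ.prod μ) hq hb
  simp_rw [e] at h
  have hint : Integrable (fun ξ : ℂ => Real.exp (-b * ‖ξ‖ ^ 2) * ‖FTm μ ξ‖ ^ 2) := by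
    have := (GF_int (μ.prod μ) hq hb).integral_prod_left
    have h3 : Integrable (fun ξ : ℂ => ((Real.exp (-b * ‖ξ‖ ^ 2) * ‖FTm μ ξ‖ ^ 2 : ℝ) : ℂ)) := by
      refine this.congr (Filter.Eventually.of_forall fun ξ => ?_)
      simp only
      rw [integral_const_mul, e]; push_cast; ring
    exact h3.re
  have h' : ∫ ξ : ℂ, Real.exp (-b * ‖ξ‖ ^ 2) * ‖FTm μ ξ‖ ^ 2 =
      ∫ p : ℂ × ℂ, gK ℂ b (p.1 - p.2) ∂(μ.prod μ) := by
    apply Complex.ofReal_injective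
    rw [← h, ← integral_complex_ofReal]
    congr 1; ext ξ; push_cast; ring
  have h2 : ∫⁻ ξ : ℂ, ENNReal.ofReal (Real.exp (-b * ‖ξ‖ ^ 2)) * ‖FTm μ ξ‖ₑ ^ 2 =
      ENNReal.ofReal (∫ ξ : ℂ, Real.exp (-b * ‖ξ‖ ^ 2) * ‖FTm μ ξ‖ ^ 2) := by
    rw [ofReal_integral_eq_lintegral_ofReal hint]
    · congr 1; ext ξ; rw [enorm_sq_eq, ENNReal.ofReal_mul (Real.exp_nonneg _)]
    · exact Filter.Eventually.of_forall fun ξ => by positivity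
  rw [h2, h']
  refine (ENNReal.ofReal_le_ofReal (le_abs_self _)).trans ?_
  rw [← Real.norm_eq_abs, ofReal_norm]
  refine (enorm_integral_le_lintegral_enorm _).trans ?_
  have hme : Measurable fun p : ℂ × ℂ => ‖gK ℂ b (p.1 - p.2)‖ₑ :=
    ((continuous_gK b).comp (by fun_prop : Continuous fun p : ℂ × ℂ => p.1 - p.2)).measurable.enorm
  rw [lintegral_prod _ hme.aemeasurable]
  calc _ ≤ ∫⁻ x, ENNReal.ofReal (C * b ^ ((s - 2) / 2)) ∂μ := by
        refine lintegral_mono fun x => (le_of_eq ?_).trans (hC x)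
        congr 1; ext y
        rw [← ofReal_norm, Real.norm_of_nonneg (gK_nonneg hb _)]
    _ ≤ _ := by
        rw [lintegral_const, mul_comm]; gcongr
end

section
/-- mollified correlation -/
def Sm (μ : Measure ℂ) (b τ : ℝ) (w : ℂ) : ℝ :=
  ∫ p : ℂ × ℂ, gK ℂ b (w - (p.2 - cis τ * p.1)) ∂(μ.prod μ)

variable {μ : Measure ℂ} [IsFiniteMeasure μ]

lemma gK_le {b : ℝ} (hb : 0 < b) (w : ℂ) : gK ℂ b w ≤ Real.pi / b := by
  rw [gK_C]
  refine mul_le_of_le_one_right (by positivity) (Real.exp_le_one_iff.2 ?_)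
  rw [neg_mul, neg_div]; exact neg_nonpos.2 (by positivity)

lemma cont_Sm_arg (b : ℝ) : Continuous fun z : (ℝ × ℂ) × (ℂ × ℂ) =>
    gK ℂ b (z.1.2 - (z.2.2 - cis z.1.1 * z.2.1)) := by
  refine (continuous_gK b).comp ?_
  have := continuous_cis
  fun_prop

lemma Sm_nonneg {b : ℝ} (hb : 0 < b) (τ : ℝ) (w : ℂ) : 0 ≤ Sm μ b τ w :=
  integral_nonneg fun _ => gK_nonneg hb _

lemma Sm_cont {b : ℝ} (hb : 0 < b) : Continuous fun z : ℝ × ℂ => Sm μ b z.1 z.2 := by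
  unfold Sm
  apply continuous_of_dominated (bound := fun t => Real.pi / b)
  · intro z
    exact ((cont_Sm_arg b).comp (g := fun z : (ℝ × ℂ) × (ℂ × ℂ) =>
      gK ℂ b (z.1.2 - (z.2.2 - cis z.1.1 * z.2.1))) (f := fun p : ℂ × ℂ => (z, p))
      (continuous_const.prodMk continuous_id)).aestronglyMeasurable
  · intro z
    refine Filter.Eventually.of_forall fun t => ?_
    rw [Real.norm_of_nonneg (gK_nonneg hb _)]; exact gK_le hb _
  · simp
  · exact Filter.Eventually.of_forall fun x =>
      (cont_Sm_arg b).comp (g := fun z : (ℝ × ℂ) × (ℂ × ℂ) =>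
      gK ℂ b (z.1.2 - (z.2.2 - cis z.1.1 * z.2.1))) (f := fun z : ℝ × ℂ => (z, x))
      (continuous_id.prodMk continuous_const)

lemma Sm_int {b : ℝ} (hb : 0 < b) (τ : ℝ) (w : ℂ) :
    Integrable (fun p : ℂ × ℂ => gK ℂ b (w - (p.2 - cis τ * p.1))) (μ.prod μ) := by
  refine Integrable.of_bound (C := Real.pi / b) ?_ ?_
  · exact ((cont_Sm_arg b).comp (g := fun z : (ℝ × ℂ) × (ℂ × ℂ) =>
      gK ℂ b (z.1.2 - (z.2.2 - cis z.1.1 * z.2.1))) (f := fun p : ℂ × ℂ => ((τ, w), p))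
      (continuous_const.prodMk continuous_id)).aestronglyMeasurable
  · refine Filter.Eventually.of_forall fun t => ?_
    rw [Real.norm_of_nonneg (gK_nonneg hb _)]; exact gK_le hb _

lemma Sm_lint {b : ℝ} (hb : 0 < b) (τ : ℝ) (w : ℂ) : ENNReal.ofReal (Sm μ b τ w) =
    ∫⁻ p : ℂ × ℂ, ENNReal.ofReal (gK ℂ b (w - (p.2 - cis τ * p.1))) ∂(μ.prod μ) :=
  ofReal_integral_eq_lintegral_ofReal (Sm_int hb τ w)
    (Filter.Eventually.of_forall fun _ => gK_nonneg hb _)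

lemma Sm_meas1 {b : ℝ} (τ : ℝ) (w : ℂ) :
    Measurable (fun p : ℂ × ℂ => ENNReal.ofReal (gK ℂ b (w - (p.2 - cis τ * p.1)))) :=
  ((cont_Sm_arg b).comp (g := fun z : (ℝ × ℂ) × (ℂ × ℂ) =>
      gK ℂ b (z.1.2 - (z.2.2 - cis z.1.1 * z.2.1))) (f := fun p : ℂ × ℂ => ((τ, w), p))
      (continuous_const.prodMk continuous_id)).measurable.ennreal_ofReal

lemma Sm_sup {b : ℝ} (hb : 0 < b) {G : ℝ≥0∞}
    (hG : ∀ z : ℂ, ∫⁻ y, ENNReal.ofReal (gK ℂ b (z - y)) ∂μ ≤ G) (τ : ℝ) (w : ℂ) :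
    ENNReal.ofReal (Sm μ b τ w) ≤ μ univ * G := by
  rw [Sm_lint hb, lintegral_prod _ (Sm_meas1 τ w).aemeasurable]
  calc _ ≤ ∫⁻ x, G ∂μ := by
        refine lintegral_mono fun x => (le_of_eq ?_).trans (hG (w + cis τ * x))
        congr 1; ext y; congr 2; ring
    _ = _ := by rw [lintegral_const, mul_comm]

lemma Sm_L1 {b : ℝ} (hb : 0 < b) (τ : ℝ) :
    ∫⁻ w, ENNReal.ofReal (Sm μ b τ w) ≤ μ univ * μ univ := by
  simp_rw [Sm_lint hb]
  rw [lintegral_lintegral_swap]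
  · have : ∀ p : ℂ × ℂ, ∫⁻ w : ℂ, ENNReal.ofReal (gK ℂ b (w - (p.2 - cis τ * p.1))) = 1 := by
      intro p
      rw [lintegral_sub_right_eq_self (fun w => ENNReal.ofReal (gK ℂ b w)), lintegral_gK hb]
    simp_rw [this]
    rw [lintegral_const, one_mul, ← univ_prod_univ, Measure.prod_prod]
  · refine Measurable.aemeasurable ?_
    exact ((cont_Sm_arg b).comp (g := fun z : (ℝ × ℂ) × (ℂ × ℂ) =>
      gK ℂ b (z.1.2 - (z.2.2 - cis z.1.1 * z.2.1))) (f := fun z : ℂ × (ℂ × ℂ) => ((τ, z.1), z.2))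
      (by fun_prop)).measurable.ennreal_ofReal

lemma Sm_N (τ : ℝ) (w ξ : ℂ) : ∫ p : ℂ × ℂ, ee (inner ℝ ξ (w - (p.2 - cis τ * p.1))) ∂(μ.prod μ) =
    (FTm μ (cis (-τ) * ξ) * (starRingEnd ℂ) (FTm μ ξ)) * ee (inner ℝ w ξ) := by
  unfold FTm
  rw [← integral_conj, ← integral_prod_mul, mul_comm, ← integral_const_mul]
  congr 1; ext p
  rw [conj_ee, ← ee_add, ← ee_add, ← inner_cis]
  congr 1
  rw [inner_sub_right, inner_sub_right, real_inner_comm]; ring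

lemma Sm_F {b : ℝ} (hb : 0 < b) (τ : ℝ) (w : ℂ) : (Sm μ b τ w : ℂ) =
    ∫ ξ : ℂ, (Real.exp (-b * ‖ξ‖ ^ 2) : ℂ) *
      (FTm μ (cis (-τ) * ξ) * (starRingEnd ℂ) (FTm μ ξ)) * ee (inner ℝ w ξ) := by
  unfold Sm
  rw [← GF _ (q := fun p : ℂ × ℂ => w - (p.2 - cis τ * p.1)) (by fun_prop) hb]
  congr 1; ext ξ
  rw [Sm_N]; ring

lemma Sm_Fint {b : ℝ} (hb : 0 < b) (τ : ℝ) : Integrable (fun ξ : ℂ => (Real.exp (-b * ‖ξ‖ ^ 2) : ℂ) *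
      (FTm μ (cis (-τ) * ξ) * (starRingEnd ℂ) (FTm μ ξ))) := by
  have hc := FTm_cont μ
  refine Integrable.mul_bdd (c := μ.real univ * μ.real univ) (integrable_gauss (V := ℂ) hb).ofReal ?_ ?_
  · apply Continuous.aestronglyMeasurable
    fun_prop
  · refine Filter.Eventually.of_forall fun ξ => ?_
    have hb : ∀ ξ, ‖FTm μ ξ‖ ≤ μ.real univ := fun ξ => by
      have := ENNReal.toReal_mono (measure_ne_top μ univ) (FTm_bd μ ξ)
      simpa [Measure.real] using this
    rw [norm_mul, RCLike.norm_conj]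
    exact mul_le_mul (hb _) (hb _) (norm_nonneg _) (by positivity)

lemma Sm_diff {b b' : ℝ} (hb : 0 < b) (hb' : 0 < b') (τ : ℝ) :
    ∫⁻ w, ‖Sm μ b' τ w - Sm μ b τ w‖ₑ ^ 2 ≤
      ∫⁻ ξ : ℂ, ENNReal.ofReal ((Real.exp (-b' * ‖ξ‖ ^ 2) - Real.exp (-b * ‖ξ‖ ^ 2)) ^ 2) *
        (‖FTm μ (cis (-τ) * ξ)‖ₑ ^ 2 * ‖FTm μ ξ‖ₑ ^ 2) := by
  have hi := (Sm_Fint (μ := μ) hb' τ).sub (Sm_Fint (μ := μ) hb τ)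
  have h := PL (m := (volume : Measure ℂ)) (q := fun ξ : ℂ => ξ) measurable_id (c := 1)
    (by rw [show (fun ξ : ℂ => ξ) = id from rfl, Measure.map_id, one_smul]) hi
  rw [one_mul] at h
  have hee : ∀ w : ℂ, Continuous fun ξ : ℂ => ee (inner ℝ w ξ) := fun w =>
    continuous_ee.comp (by fun_prop)
  have hi2 : ∀ {b : ℝ} (_ : 0 < b) (w : ℂ), Integrable (fun ξ : ℂ => (Real.exp (-b * ‖ξ‖ ^ 2) : ℂ) *
      (FTm μ (cis (-τ) * ξ) * (starRingEnd ℂ) (FTm μ ξ)) * ee (inner ℝ w ξ)) := by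
    intro b hb w
    exact (Sm_Fint (μ := μ) hb τ).mul_bdd (c := 1) (hee w).aestronglyMeasurable
      (Filter.Eventually.of_forall fun ξ => (norm_ee _).le)
  refine le_trans (le_of_eq ?_) (h.trans (le_of_eq ?_))
  · congr 1; ext w
    have : ((Sm μ b' τ w - Sm μ b τ w : ℝ) : ℂ) = ∫ ξ : ℂ,
      ((fun ξ : ℂ => (Real.exp (-b' * ‖ξ‖ ^ 2) : ℂ) *
        (FTm μ (cis (-τ) * ξ) * (starRingEnd ℂ) (FTm μ ξ))) - (fun ξ : ℂ =>
        (Real.exp (-b * ‖ξ‖ ^ 2) : ℂ) *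
        (FTm μ (cis (-τ) * ξ) * (starRingEnd ℂ) (FTm μ ξ)))) ξ * ee (inner ℝ w ξ) := by
      rw [Complex.ofReal_sub, Sm_F hb, Sm_F hb', ← integral_sub (hi2 hb' w) (hi2 hb w)]
      congr 1; ext ξ
      simp only [Pi.sub_apply]; ring
    rw [← this, ← ofReal_norm, ← ofReal_norm, Complex.norm_real]
  · congr 1; ext ξ
    simp only [Pi.sub_apply]
    rw [← sub_mul, ← Complex.ofReal_sub, enorm_mul, enorm_mul, RCLike.enorm_conj, mul_pow, mul_pow,
      enorm_sq_eq ((_ : ℝ) : ℂ), Complex.norm_real, Real.norm_eq_abs, sq_abs]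

lemma m_bd {β b r : ℝ} (hβ0 : 0 ≤ β) (hβ2 : β ≤ 2) (hb : 0 < b) (hr : 0 < r) :
    (Real.exp (-(b / 4) * r ^ 2) - Real.exp (-b * r ^ 2)) ^ 2 * r ^ (-β) ≤
      b ^ (β / 2) * Real.exp (-(b / 2) * r ^ 2) := by
  set u := b * r ^ 2 with hu
  have hu0 : 0 < u := by positivity
  have e1 : Real.exp (-(b / 4) * r ^ 2) - Real.exp (-b * r ^ 2) =
      Real.exp (-u / 4) * (1 - Real.exp (-(3 / 4) * u)) := by
    rw [mul_sub, ← Real.exp_add, mul_one, hu]; congr 2 <;> ring_nf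
  have e2 : Real.exp (-(b / 2) * r ^ 2) = Real.exp (-u / 4) ^ 2 := by
    rw [← Real.exp_nat_mul, hu]; congr 1; push_cast; ring
  have h0 : 0 ≤ 1 - Real.exp (-(3 / 4) * u) := by
    have := Real.exp_le_one_iff.2 (show -(3 / 4) * u ≤ 0 by nlinarith); linarith
  have h1 : 1 - Real.exp (-(3 / 4) * u) ≤ 1 := by
    have := Real.exp_pos (-(3 / 4) * u); linarith
  have h2 : 1 - Real.exp (-(3 / 4) * u) ≤ u := by
    have := Real.add_one_le_exp (-(3 / 4) * u); linarith
  have e3 : r ^ (-β) = b ^ (β / 2) * u ^ (-(β / 2)) := by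
    rw [hu, Real.mul_rpow hb.le (by positivity), ← mul_assoc, ← Real.rpow_add hb,
      ← Real.rpow_natCast r 2, ← Real.rpow_mul hr.le]
    simp
    ring_nf
  have h3 : (1 - Real.exp (-(3 / 4) * u)) ^ 2 * u ^ (-(β / 2)) ≤ 1 := by
    rcases le_total 1 u with h | h
    · have h4 : u ^ (-(β / 2)) ≤ 1 := Real.rpow_le_one_of_one_le_of_nonpos h (by linarith)
      have h5 : (1 - Real.exp (-(3 / 4) * u)) ^ 2 ≤ 1 := pow_le_one₀ h0 h1
      exact mul_le_one₀ h5 (by positivity) h4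
    · have h5 : (1 - Real.exp (-(3 / 4) * u)) ^ 2 ≤ u ^ 2 := pow_le_pow_left₀ h0 h2 2
      calc _ ≤ u ^ 2 * u ^ (-(β / 2)) := by gcongr
        _ = u ^ (2 - β / 2) := by
          rw [← Real.rpow_natCast u 2, ← Real.rpow_add hu0]; congr 1
        _ ≤ 1 := Real.rpow_le_one hu0.le h (by linarith)
  rw [e1, e2, e3, mul_pow]
  have h4 : 0 ≤ Real.exp (-u / 4) ^ 2 * b ^ (β / 2) := by positivity
  nlinarith [mul_le_mul_of_nonneg_left h3 h4]

lemma Sm_diff2 {β C1 b : ℝ} (hβ0 : 0 ≤ β) (hβ2 : β ≤ 2) (hC1 : 0 ≤ C1) (hb : 0 < b)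
    (hσ : ∀ ξ : ℂ, ξ ≠ 0 → ∫⁻ τ in Icc (-(1/4) : ℝ) (1/4), ‖FTm μ (cis τ * ξ)‖ₑ ^ 2 ≤
        ENNReal.ofReal (C1 * ‖ξ‖ ^ (-β))) :
    ∫⁻ τ in Icc (-(1/4) : ℝ) (1/4), ∫⁻ w, ‖Sm μ (b / 4) τ w - Sm μ b τ w‖ₑ ^ 2 ≤
      ENNReal.ofReal (C1 * b ^ (β / 2)) *
      ∫⁻ ξ : ℂ, ENNReal.ofReal (Real.exp (-(b / 2) * ‖ξ‖ ^ 2)) * ‖FTm μ ξ‖ₑ ^ 2 := by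
  have hc := FTm_cont μ
  have hcis := continuous_cis
  have hb4 : 0 < b / 4 := by positivity
  refine (lintegral_mono fun τ => Sm_diff hb hb4 τ).trans ?_
  rw [lintegral_lintegral_swap, ← lintegral_const_mul' _ _ ENNReal.ofReal_ne_top]
  · have hne : ∀ᵐ ξ : ℂ, ξ ≠ 0 := by simp [ae_iff]
    refine lintegral_mono_ae (hne.mono fun ξ hξ => ?_)
    rw [lintegral_const_mul' _ _ ENNReal.ofReal_ne_top, lintegral_mul_const']
    · have hs : ∫⁻ τ in Icc (-(1/4) : ℝ) (1/4), ‖FTm μ (cis (-τ) * ξ)‖ₑ ^ 2 =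
          ∫⁻ τ in Icc (-(1/4) : ℝ) (1/4), ‖FTm μ (cis τ * ξ)‖ₑ ^ 2 := by
        rw [← lintegral_indicator measurableSet_Icc, ← lintegral_indicator measurableSet_Icc,
          ← lintegral_neg_eq_self]
        congr 1; ext τ
        by_cases hτ : τ ∈ Icc (-(1/4) : ℝ) (1/4)
        · rw [indicator_of_mem hτ, indicator_of_mem (show -τ ∈ Icc (-(1/4) : ℝ) (1/4) from
            ⟨by linarith [hτ.2], by linarith [hτ.1]⟩), neg_neg]
        · rw [indicator_of_notMem hτ, indicator_of_notMem]
          intro h; exact hτ ⟨by linarith [h.2], by linarith [h.1]⟩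
      rw [hs, ← mul_assoc, ← mul_assoc]
      refine mul_le_mul_left ?_ _
      refine (mul_le_mul_right (hσ ξ hξ) _).trans ?_
      rw [← ENNReal.ofReal_mul (by positivity), ← ENNReal.ofReal_mul (by positivity)]
      refine ENNReal.ofReal_le_ofReal ?_
      have := m_bd hβ0 hβ2 hb (norm_pos_iff.2 hξ)
      nlinarith [mul_le_mul_of_nonneg_left this hC1]
    · exact ENNReal.pow_ne_top (by simp)
  · refine Measurable.aemeasurable ?_
    have h1 : Continuous fun z : ℝ × ℂ => FTm μ (cis (-z.1) * z.2) := by fun_prop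
    have h2 : Continuous fun z : ℝ × ℂ => FTm μ z.2 := by fun_prop
    have h3 : Continuous fun z : ℝ × ℂ =>
      (Real.exp (-(b / 4) * ‖z.2‖ ^ 2) - Real.exp (-b * ‖z.2‖ ^ 2)) ^ 2 := by fun_prop
    exact h3.measurable.ennreal_ofReal.mul
      ((h1.measurable.enorm.pow_const 2).mul (h2.measurable.enorm.pow_const 2))
end

section
/-- measure with density -/
def dens (ρ : ℂ → ℝ) : Measure ℂ := volume.withDensity (fun x => ENNReal.ofReal (ρ x))

/-- Frostman densities -/
structure FR (s D M : ℝ) (ρ : ℂ → ℝ) : Prop where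
  cont : Continuous ρ
  nn : ∀ x, 0 ≤ ρ x
  supp : ∀ x, M < ‖x‖ → ρ x = 0
  fm : FM s D M (dens ρ)

/-- correlation -/
def nu (ρ : ℂ → ℝ) (τ : ℝ) (w : ℂ) : ℝ := ∫ x, ρ (w + cis τ * x) ∂(dens ρ)

namespace FR
variable {s D M : ℝ} {ρ : ℂ → ℝ}

lemma cs (h : FR s D M ρ) : HasCompactSupport ρ :=
  HasCompactSupport.of_support_subset_isCompact (isCompact_closedBall (0:ℂ) M) (by
    intro x hx
    by_contra h'
    exact hx (h.supp x (by simpa using h')))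

lemma int (h : FR s D M ρ) : Integrable ρ := h.cont.integrable_of_hasCompactSupport h.cs

lemma bdd (h : FR s D M ρ) : ∃ B, 0 ≤ B ∧ ∀ x, ρ x ≤ B := by
  obtain ⟨B, hB⟩ := h.cs.exists_bound_of_continuous h.cont
  exact ⟨B, (norm_nonneg _).trans (hB 0), fun x => (le_abs_self _).trans (hB x)⟩

lemma fin (h : FR s D M ρ) : IsFiniteMeasure (dens ρ) :=
  isFiniteMeasure_withDensity_ofReal h.int.hasFiniteIntegral

lemma integral (h : FR s D M ρ) (g : ℂ → ℝ) : ∫ x, g x ∂(dens ρ) = ∫ x, ρ x * g x := by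
  unfold dens
  rw [integral_withDensity_eq_integral_toReal_smul h.cont.measurable.ennreal_ofReal (by simp)]
  congr 1; ext x
  rw [ENNReal.toReal_ofReal (h.nn x), smul_eq_mul]

lemma inner_eq (h : FR s D M ρ) (b : ℝ) (v : ℂ) :
    ∫ y, gK ℂ b (v - y) ∂(dens ρ) = ∫ y, ρ y * gK ℂ b (v - y) := h.integral _

lemma inner_bd (h : FR s D M ρ) {B : ℝ} (hB : ∀ x, ρ x ≤ B) {b : ℝ} (hb : 0 < b) (v : ℂ) :
    ‖∫ y, gK ℂ b (v - y) ∂(dens ρ)‖ ≤ B := by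
  rw [h.inner_eq]
  have hi : Integrable (gK ℂ b) := by
    have : HasFiniteIntegral (gK ℂ b) := by
      unfold HasFiniteIntegral
      have := lintegral_gK (V := ℂ) hb
      rw [show (∫⁻ a, ‖gK ℂ b a‖ₑ) = ∫⁻ w : ℂ, ENNReal.ofReal (gK ℂ b w) from ?_, this]
      · simp
      · congr 1; ext w; rw [← ofReal_norm, Real.norm_of_nonneg (gK_nonneg hb _)]
    exact ⟨(continuous_gK b).aestronglyMeasurable, this⟩
  have h1 : ∫ w, gK ℂ b w = 1 := by
    rw [integral_eq_lintegral_of_nonneg_ae (Filter.Eventually.of_forall fun w => gK_nonneg hb w)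
      (continuous_gK b).aestronglyMeasurable, lintegral_gK hb]; simp
  have hi2 : Integrable (fun y => gK ℂ b (v - y)) := hi.comp_sub_left v
  rw [Real.norm_of_nonneg (integral_nonneg fun y => mul_nonneg (h.nn y) (gK_nonneg hb _))]
  calc _ ≤ ∫ y, B * gK ℂ b (v - y) := by
        refine integral_mono_of_nonneg (Filter.Eventually.of_forall fun y =>
          mul_nonneg (h.nn y) (gK_nonneg hb _)) (hi2.const_mul B)
          (Filter.Eventually.of_forall fun y => mul_le_mul_of_nonneg_right (hB y) (gK_nonneg hb _))
    _ = B := by rw [integral_const_mul, integral_sub_left_eq_self, h1, mul_one]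

lemma inner_tendsto (h : FR s D M ρ) (v : ℂ) :
    Filter.Tendsto (fun j : ℕ => ∫ y, gK ℂ ((1/4) ^ j) (v - y) ∂(dens ρ)) Filter.atTop (𝓝 (ρ v)) := by
  have hf : Integrable (fun x => (ρ x : ℂ)) := h.int.ofReal
  have hc : Continuous (fun x => (ρ x : ℂ)) := Complex.continuous_ofReal.comp h.cont
  have h1 := Real.tendsto_integral_gaussian_smul' hf (v := v) hc.continuousAt
  have h2 := (Complex.continuous_re.tendsto _).comp
    (h1.comp (tendsto_pow_atTop_atTop_of_one_lt (show (1:ℝ) < 4 by norm_num)))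
  refine (h2.congr fun j => ?_)
  simp only [Function.comp_apply]
  rw [h.inner_eq, ← Complex.ofReal_re (∫ y, ρ y * gK ℂ ((1/4) ^ j) (v - y)), ← integral_complex_ofReal]
  congr 2; ext y
  rw [gK_C, Complex.finrank_real_complex]
  push_cast
  rw [show ((2:ℂ) / 2) = 1 by norm_num, Complex.cpow_one, smul_eq_mul, mul_comm]
  congr 2
  · rw [div_pow, one_pow, div_div_eq_mul_div, div_one]
  · congr 1
    rw [div_pow, one_pow, div_div_eq_mul_div, div_one]; ring

lemma Sm_tendsto (h : FR s D M ρ) (τ : ℝ) (w : ℂ) :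
    Filter.Tendsto (fun j : ℕ => Sm (dens ρ) ((1/4) ^ j) τ w) Filter.atTop (𝓝 (nu ρ τ w)) := by
  haveI := h.fin
  obtain ⟨B, hB0, hB⟩ := h.bdd
  have e : ∀ j : ℕ, Sm (dens ρ) ((1/4) ^ j) τ w =
      ∫ x, (∫ y, gK ℂ ((1/4) ^ j) ((w + cis τ * x) - y) ∂(dens ρ)) ∂(dens ρ) := by
    intro j
    unfold Sm
    rw [integral_prod _ (Sm_int (by positivity) τ w)]
    congr 1; ext x; congr 1; ext y; congr 1; ring
  simp_rw [e]
  refine tendsto_integral_of_dominated_convergence (fun _ => B) ?_ (integrable_const _) ?_ ?_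
  · intro j
    have := (Sm_int (μ := dens ρ) (b := (1/4) ^ j) (by positivity) τ w).integral_prod_left
    refine this.aestronglyMeasurable.congr (Filter.Eventually.of_forall fun x => ?_)
    simp only
    congr 1; ext y; congr 1; ring
  · intro j
    exact Filter.Eventually.of_forall fun x => h.inner_bd hB (by positivity) _
  · exact Filter.Eventually.of_forall fun x => h.inner_tendsto _

lemma nu_nonneg (h : FR s D M ρ) (τ : ℝ) (w : ℂ) : 0 ≤ nu ρ τ w := integral_nonneg fun _ => h.nn _

lemma nu_cont (h : FR s D M ρ) : Continuous fun z : ℝ × ℂ => nu ρ z.1 z.2 := by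
  haveI := h.fin
  obtain ⟨B, hB0, hB⟩ := h.bdd
  have hc : Continuous fun z : (ℝ × ℂ) × ℂ => ρ (z.1.2 + cis z.1.1 * z.2) := by
    have := continuous_cis
    have := h.cont
    fun_prop
  unfold nu
  apply continuous_of_dominated (bound := fun t => B)
  · intro z
    exact (hc.comp (g := fun z : (ℝ × ℂ) × ℂ => ρ (z.1.2 + cis z.1.1 * z.2))
      (f := fun x : ℂ => (z, x)) (by fun_prop)).aestronglyMeasurable
  · intro z
    refine Filter.Eventually.of_forall fun t => ?_
    rw [Real.norm_of_nonneg (h.nn _)]; exact hB _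
  · simp
  · exact Filter.Eventually.of_forall fun x =>
      hc.comp (g := fun z : (ℝ × ℂ) × ℂ => ρ (z.1.2 + cis z.1.1 * z.2))
        (f := fun z : ℝ × ℂ => (z, x)) (by fun_prop)

end FR

lemma tele3 {X : Type*} [MeasurableSpace X] {P : Measure X} {f : ℕ → X → ℝ}
    (hf : ∀ j, AEStronglyMeasurable (f j) P) {a0 a q : ℝ≥0∞} (h0 : eLpNorm (f 0) 3 P ≤ a0)
    (h1 : ∀ j, eLpNorm (f (j + 1) - f j) 3 P ≤ a * q ^ j) (J : ℕ) :
    eLpNorm (f J) 3 P ≤ a0 + a * (1 - q)⁻¹ := by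
  have h : eLpNorm (f J) 3 P ≤ a0 + a * ∑ j ∈ Finset.range J, q ^ j := by
    induction J with
    | zero => simpa using h0
    | succ J ih =>
      calc eLpNorm (f (J + 1)) 3 P = eLpNorm (f J + (f (J + 1) - f J)) 3 P := by
            congr 1; abel
        _ ≤ _ := eLpNorm_add_le (hf J) ((hf _).sub (hf _)) (by norm_num)
        _ ≤ (a0 + a * ∑ j ∈ Finset.range J, q ^ j) + a * q ^ J := add_le_add ih (h1 J)
        _ = _ := by rw [Finset.sum_range_succ, mul_add, add_assoc]
  refine h.trans ?_
  rw [← ENNReal.tsum_geometric]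
  gcongr
  exact ENNReal.sum_le_tsum _

lemma eL3 {X : Type*} [MeasurableSpace X] {P : Measure X} (f : X → ℝ) :
    eLpNorm f 3 P = (∫⁻ x, ‖f x‖ₑ ^ 3 ∂P) ^ (1 / 3 : ℝ) := by
  rw [eLpNorm_eq_lintegral_rpow_enorm_toReal (by norm_num) (by norm_num)]
  norm_num

lemma L3_le {X : Type*} [MeasurableSpace X] {P : Measure X} {f : X → ℝ}
    (hf : Measurable f) {G : ℝ≥0∞} (hG : ∀ x, ‖f x‖ₑ ≤ G) :
    ∫⁻ x, ‖f x‖ₑ ^ 3 ∂P ≤ G * ∫⁻ x, ‖f x‖ₑ ^ 2 ∂P := by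
  rw [← lintegral_const_mul _ (by fun_prop)]
  refine lintegral_mono fun x => ?_
  rw [pow_succ, mul_comm]
  gcongr
  exact hG x
end

section
/-- the angular measure -/
def I1 : Measure ℝ := volume.restrict (Icc (-(1/4) : ℝ) (1/4))
instance : IsFiniteMeasure I1 := by unfold I1; infer_instance
lemma I1_univ : I1 univ ≤ 1 := by
  unfold I1
  rw [Measure.restrict_apply_univ, Real.volume_Icc]
  rw [ENNReal.ofReal_le_one]; norm_num

lemma decay' {s ε D M : ℝ} (hs0 : 0 ≤ s) (hs2 : s ≤ 2) (hε : 0 < ε) (hD : 0 ≤ D) (hM : 1 ≤ M)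
    (hβ : 0 ≤ s / 2 - ε) :
    ∃ C : ℝ, 0 ≤ C ∧ ∀ μ : Measure ℂ, FM s D M μ → ∀ ξ : ℂ, ξ ≠ 0 →
      ∫⁻ τ in Icc (-(1/4) : ℝ) (1/4), ‖FTm μ (cis τ * ξ)‖ₑ ^ 2 ≤
        ENNReal.ofReal (C * ‖ξ‖ ^ (-(s / 2 - ε))) := by
  obtain ⟨C, hC, h⟩ := decay hs0 hs2 hε hD hM
  refine ⟨C + (D * M ^ s) ^ 2, by positivity, fun μ hμ ξ hξ => ?_⟩
  rcases le_or_gt 1 ‖ξ‖ with h1 | h1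
  · refine (h μ hμ ξ h1).trans (ENNReal.ofReal_le_ofReal ?_)
    gcongr
    exact le_add_of_nonneg_right (by positivity)
  · have hm := hμ.mass (by linarith)
    haveI : IsFiniteMeasure μ := ⟨hm.trans_lt ENNReal.ofReal_lt_top⟩
    have hr : 1 ≤ ‖ξ‖ ^ (-(s / 2 - ε)) :=
      Real.one_le_rpow_of_pos_of_le_one_of_nonpos (norm_pos_iff.2 hξ) h1.le (by linarith)
    calc _ ≤ ∫⁻ τ in Icc (-(1/4) : ℝ) (1/4), ENNReal.ofReal (D * M ^ s) ^ 2 := by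
          refine lintegral_mono fun τ => ?_
          gcongr
          exact (FTm_bd μ _).trans hm
      _ ≤ ENNReal.ofReal (D * M ^ s) ^ 2 := by
          rw [lintegral_const]
          exact mul_le_of_le_one_right zero_le I1_univ
      _ ≤ _ := by
          rw [← ENNReal.ofReal_pow (by positivity)]
          refine ENNReal.ofReal_le_ofReal ?_
          have : 0 ≤ (D * M ^ s) ^ 2 := by positivity
          nlinarith

theorem L3 {s D M : ℝ} (hs : 8 / 5 < s) (hs2 : s ≤ 2) (hD : 0 ≤ D) (hM : 1 ≤ M) :
    ∃ K : ℝ≥0∞, K ≠ ∞ ∧ ∀ ρ : ℂ → ℝ, FR s D M ρ →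
      ∫⁻ z : ℝ × ℂ, ENNReal.ofReal (nu ρ z.1 z.2) ^ 3 ∂(I1.prod volume) ≤ K := by
  have hs0 : 0 ≤ s := by linarith
  set ε : ℝ := 5 * s / 4 - 2 with hε
  have hε0 : 0 < ε := by rw [hε]; linarith
  obtain ⟨C1, hC1, hdec⟩ := decay' hs0 hs2 hε0 hD hM (by rw [hε]; linarith)
  obtain ⟨Cg, hCg, hgk⟩ := gK_ball (D := D) hs0 hs2 hD
  set β := s / 2 - ε with hβ
  have hβ0 : 0 ≤ β := by rw [hβ, hε]; linarith
  have hβ2 : β ≤ 2 := by rw [hβ, hε]; linarith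
  set m := D * M ^ s with hm
  have hm0 : 0 ≤ m := by rw [hm]; positivity
  set A : ℝ := (5 * (m * Cg)) * (C1 * (m * (2 * Cg))) with hA
  have hA0 : 0 ≤ A := by rw [hA]; positivity
  set q : ℝ≥0∞ := ENNReal.ofReal ((1/4 : ℝ) ^ (ε / 6)) with hq
  have hq1 : q < 1 := by
    rw [hq, ENNReal.ofReal_lt_one]
    exact Real.rpow_lt_one (by norm_num) (by norm_num) (by positivity)
  set a0 : ℝ≥0∞ := (ENNReal.ofReal (m * Cg) * (ENNReal.ofReal (m * Cg) * (ENNReal.ofReal m * ENNReal.ofReal m))) ^ (1 / 3 : ℝ)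
  set a : ℝ≥0∞ := ENNReal.ofReal A ^ (1 / 3 : ℝ)
  have hL : a0 + a * (1 - q)⁻¹ ≠ ∞ := by
    refine ENNReal.add_ne_top.2 ⟨ENNReal.rpow_ne_top_of_nonneg (by norm_num) (by finiteness),
      ENNReal.mul_ne_top (ENNReal.rpow_ne_top_of_nonneg (by norm_num) (by finiteness)) ?_⟩
    rw [Ne, ENNReal.inv_eq_top, tsub_eq_zero_iff_le, not_le]; exact hq1
  refine ⟨(a0 + a * (1 - q)⁻¹) ^ 3, ENNReal.pow_ne_top hL, fun ρ hρ => ?_⟩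
  haveI := hρ.fin
  set μ := dens ρ with hμ
  have hmass : μ univ ≤ ENNReal.ofReal m := hρ.fm.mass (by linarith)
  set f : ℕ → ℝ × ℂ → ℝ := fun j z => Sm μ ((1/4) ^ j) z.1 z.2 with hf
  have hfc : ∀ j, Continuous (f j) := fun j => Sm_cont (by positivity)
  set P : Measure (ℝ × ℂ) := I1.prod volume with hP
  -- sup bounds
  have hsup : ∀ b : ℝ, 0 < b → ∀ τ w, ‖Sm μ b τ w‖ₑ ≤ ENNReal.ofReal (m * Cg * b ^ ((s - 2) / 2)) := by
    intro b hb τ w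
    rw [← ofReal_norm, Real.norm_of_nonneg (Sm_nonneg hb _ _), mul_assoc, ENNReal.ofReal_mul hm0]
    refine (Sm_sup hb (hgk M μ hρ.fm b hb) τ w).trans ?_
    gcongr
  have h0 : eLpNorm (f 0) 3 P ≤ a0 := by
    rw [eL3]
    refine ENNReal.rpow_le_rpow ?_ (by norm_num)
    have hs1 : ∀ z, ‖f 0 z‖ₑ ≤ ENNReal.ofReal (m * Cg) := fun z => by
      have := hsup 1 one_pos z.1 z.2
      simpa [hf] using this
    refine (L3_le (hfc 0).measurable hs1).trans ?_
    gcongr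
    calc ∫⁻ z, ‖f 0 z‖ₑ ^ 2 ∂P ≤ ∫⁻ z, ENNReal.ofReal (m * Cg) * ‖f 0 z‖ₑ ∂P := by
          refine lintegral_mono fun z => ?_
          rw [sq]; gcongr; exact hs1 z
      _ = ENNReal.ofReal (m * Cg) * ∫⁻ z, ‖f 0 z‖ₑ ∂P := by
          rw [lintegral_const_mul _ (hfc 0).measurable.enorm]
      _ ≤ _ := by
          gcongr
          rw [hP, lintegral_prod _ (hfc 0).measurable.enorm.aemeasurable]
          calc _ ≤ ∫⁻ τ, ENNReal.ofReal m * ENNReal.ofReal m ∂I1 := by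
                refine lintegral_mono fun τ => ?_
                have := Sm_L1 (μ := μ) (b := (1/4) ^ 0) (by norm_num) τ
                refine le_trans (le_of_eq ?_) (this.trans (mul_le_mul' hmass hmass))
                congr 1; ext w
                rw [← ofReal_norm, hf, Real.norm_of_nonneg (Sm_nonneg (by norm_num) _ _)]
            _ ≤ _ := by
                rw [lintegral_const]
                exact mul_le_of_le_one_right zero_le I1_univ
  have h1 : ∀ j, eLpNorm (f (j + 1) - f j) 3 P ≤ a * q ^ j := by
    intro j
    set b : ℝ := (1/4) ^ j with hb
    have hb0 : 0 < b := by rw [hb]; positivity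
    have hb4 : ((1/4 : ℝ) ^ (j + 1)) = b / 4 := by rw [hb, pow_succ]; ring
    set e := (s - 2) / 2 with he
    have he0 : e ≤ 0 := by rw [he]; linarith
    have hx : ∀ c : ℝ, 1 ≤ c → (b / c) ^ e ≤ c * b ^ e := by
      intro c hc
      have hc0 : 0 < c := by linarith
      rw [Real.div_rpow hb0.le hc0.le, div_eq_mul_inv, ← Real.rpow_neg hc0.le, mul_comm]
      gcongr
      calc c ^ (-e) ≤ c ^ (1:ℝ) := Real.rpow_le_rpow_of_exponent_le hc (by rw [he]; linarith)
        _ = c := Real.rpow_one c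
    have hs1 : ∀ z, ‖(f (j + 1) - f j) z‖ₑ ≤ ENNReal.ofReal (5 * (m * Cg) * b ^ e) := fun z => by
      have e1 := hsup (b / 4) (by positivity) z.1 z.2
      have e2 := hsup b hb0 z.1 z.2
      have e3 : f (j + 1) z = Sm μ (b / 4) z.1 z.2 := by simp only [hf]; rw [hb4]
      rw [Pi.sub_apply, e3]
      refine (enorm_sub_le).trans ((add_le_add e1 e2).trans ?_)
      rw [← ENNReal.ofReal_add (by positivity) (by positivity)]
      refine ENNReal.ofReal_le_ofReal ?_
      have := mul_le_mul_of_nonneg_left (hx 4 (by norm_num)) (mul_nonneg hm0 hCg)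
      linarith
    rw [eL3]
    have key : ∫⁻ z, ‖(f (j + 1) - f j) z‖ₑ ^ 3 ∂P ≤ ENNReal.ofReal (A * b ^ (ε / 2)) := by
      refine (L3_le ((hfc _).sub (hfc _)).measurable hs1).trans ?_
      have hL2 : ∫⁻ z, ‖(f (j + 1) - f j) z‖ₑ ^ 2 ∂P ≤
          ENNReal.ofReal (C1 * b ^ (β / 2)) * (ENNReal.ofReal m * ENNReal.ofReal (Cg * (b / 2) ^ e)) := by
        have hmm : Measurable fun z => ‖(f (j + 1) - f j) z‖ₑ ^ 2 :=
          ((hfc _).sub (hfc _)).measurable.enorm.pow_const 2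
        rw [hP, lintegral_prod _ hmm.aemeasurable]
        have := Sm_diff2 (μ := μ) hβ0 hβ2 hC1 hb0 (hdec μ hρ.fm)
        refine le_trans (le_of_eq ?_) (this.trans ?_)
        · unfold I1
          congr 1; ext τ; congr 1; ext w
          simp only [hf, Pi.sub_apply]; rw [hb4]
        · gcongr
          exact energy (by linarith) hρ.fm (by positivity) (hgk M μ hρ.fm (b / 2) (by positivity))
      refine (mul_le_mul_right hL2 _).trans ?_
      rw [← ENNReal.ofReal_mul (by positivity), ← ENNReal.ofReal_mul (by positivity),
        ← ENNReal.ofReal_mul (by positivity)]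
      refine ENNReal.ofReal_le_ofReal ?_
      have e4 : b ^ (ε / 2) = b ^ e * b ^ (β / 2) * b ^ e := by
        rw [← Real.rpow_add hb0, ← Real.rpow_add hb0]; congr 1
        rw [he, hβ, hε]; ring
      calc _ ≤ 5 * (m * Cg) * b ^ e * (C1 * b ^ (β / 2) * (m * (Cg * (2 * b ^ e)))) := by
            gcongr; exact hx 2 (by norm_num)
        _ = _ := by rw [e4, hA]; ring
    refine (ENNReal.rpow_le_rpow key (by norm_num)).trans (le_of_eq ?_)
    rw [ENNReal.ofReal_mul hA0, ENNReal.mul_rpow_of_nonneg _ _ (by norm_num)]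
    congr 1
    rw [ENNReal.ofReal_rpow_of_nonneg (by positivity) (by norm_num), hq,
      ← ENNReal.ofReal_pow (by positivity)]
    congr 1
    rw [hb, ← Real.rpow_mul (by positivity), ← Real.rpow_natCast, ← Real.rpow_natCast,
      ← Real.rpow_mul (by norm_num), ← Real.rpow_mul (by norm_num)]
    congr 1; ring
  have hfin := tele3 (fun j => (hfc j).aestronglyMeasurable) h0 h1
  have hJ : ∀ J, ∫⁻ z, ‖f J z‖ₑ ^ 3 ∂P ≤ (a0 + a * (1 - q)⁻¹) ^ 3 := by
    intro J
    have := pow_le_pow_left₀ zero_le (hfin J) 3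
    rw [eL3, ← ENNReal.rpow_natCast, ← ENNReal.rpow_mul] at this
    norm_num at this ⊢
    exact this
  have hlim : ∀ z : ℝ × ℂ, ENNReal.ofReal (nu ρ z.1 z.2) ^ 3 =
      Filter.liminf (fun J => ‖f J z‖ₑ ^ 3) Filter.atTop := by
    intro z
    symm
    apply Filter.Tendsto.liminf_eq
    have h2 := (hρ.Sm_tendsto z.1 z.2).enorm
    rw [← ofReal_norm (nu ρ z.1 z.2), Real.norm_of_nonneg (hρ.nu_nonneg _ _)] at h2
    exact ((ENNReal.continuous_pow 3).tendsto _).comp h2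
  simp_rw [hlim]
  refine (lintegral_liminf_le fun J => (hfc J).measurable.enorm.pow_const 3).trans ?_
  refine Filter.liminf_le_of_le (by isBoundedDefault) fun c hc => ?_
  obtain ⟨J, hJ'⟩ := hc.exists
  exact hJ'.trans (hJ J)
end

section
section abs
variable {X U : Type*} [MeasurableSpace X] [MeasurableSpace U] {Q : Measure X} {L : Measure U}
  [SFinite Q] [SFinite L] {g : X → U → ℝ≥0∞}

lemma corr_sq (hg : Measurable (Function.uncurry g)) :
    ∫⁻ z : U × U, (∫⁻ p, g p z.1 * g p z.2 ∂Q) ^ 2 ∂(L.prod L) =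
      ∫⁻ p, ∫⁻ p', (∫⁻ u, g p u * g p' u ∂L) ^ 2 ∂Q ∂Q := by
  have e1 : ∀ z : U × U, (∫⁻ p, g p z.1 * g p z.2 ∂Q) ^ 2 =
      ∫⁻ p, ∫⁻ p', (g p z.1 * g p' z.1) * (g p z.2 * g p' z.2) ∂Q ∂Q := by
    intro z
    have hm : Measurable fun p => g p z.1 * g p z.2 :=
      (hg.comp (f := fun p => (p, z.1)) (by fun_prop)).mul (hg.comp (f := fun p => (p, z.2)) (by fun_prop))
    rw [sq, ← lintegral_mul_const _ hm]
    congr 1; ext p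
    rw [← lintegral_const_mul _ hm]
    congr 1; ext p'; ring
  simp_rw [e1]
  have hm4 : Measurable fun y : ((U × U) × X) × X =>
      (g y.1.2 y.1.1.1 * g y.2 y.1.1.1) * (g y.1.2 y.1.1.2 * g y.2 y.1.1.2) :=
    ((hg.comp (f := fun y : ((U × U) × X) × X => (y.1.2, y.1.1.1)) (by fun_prop)).mul
      (hg.comp (f := fun y : ((U × U) × X) × X => (y.2, y.1.1.1)) (by fun_prop))).mul
      ((hg.comp (f := fun y : ((U × U) × X) × X => (y.1.2, y.1.1.2)) (by fun_prop)).mul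
      (hg.comp (f := fun y : ((U × U) × X) × X => (y.2, y.1.1.2)) (by fun_prop)))
  rw [lintegral_lintegral_swap (hm4.lintegral_prod_right').aemeasurable]
  congr 1; ext p
  rw [lintegral_lintegral_swap]
  · congr 1; ext p'
    have hm : Measurable fun u => g p u * g p' u :=
      (hg.comp (f := fun u => (p, u)) (by fun_prop)).mul (hg.comp (f := fun u => (p', u)) (by fun_prop))
    rw [lintegral_prod_mul (f := fun u => g p u * g p' u) (g := fun u => g p u * g p' u)
      hm.aemeasurable hm.aemeasurable, sq]
  · refine Measurable.aemeasurable ?_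
    exact hm4.comp (g := fun y : ((U × U) × X) × X =>
      (g y.1.2 y.1.1.1 * g y.2 y.1.1.1) * (g y.1.2 y.1.1.2 * g y.2 y.1.1.2))
      (f := fun y : (U × U) × X => ((y.1, p), y.2)) (by fun_prop)

lemma corr_one (hg : Measurable (Function.uncurry g)) :
    ∫⁻ z : U × U, (∫⁻ p, g p z.1 * g p z.2 ∂Q) ∂(L.prod L) = ∫⁻ p, (∫⁻ u, g p u ∂L) ^ 2 ∂Q := by
  rw [lintegral_lintegral_swap]
  · congr 1; ext p
    have hm : Measurable fun u => g p u := hg.comp (f := fun u => (p, u)) (by fun_prop)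
    rw [lintegral_prod_mul (f := fun u => g p u) (g := fun u => g p u)
      hm.aemeasurable hm.aemeasurable, sq]
  · refine Measurable.aemeasurable ?_
    exact (hg.comp (f := fun y : (U × U) × X => (y.2, y.1.1)) (by fun_prop)).mul
      (hg.comp (f := fun y : (U × U) × X => (y.2, y.1.2)) (by fun_prop))

lemma corr_supp {Y : Type*} [MeasurableSpace Y] {L : Measure Y} {h : Y → ℝ≥0∞} (hh : Measurable h) :
    (∫⁻ z, h z ∂L) ^ 2 ≤ (∫⁻ z, h z ^ 2 ∂L) * L {z | h z ≠ 0} := by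
  have hS : MeasurableSet {z | h z ≠ 0} := hh (measurableSet_singleton 0).compl
  have := cs_sq (m := L) (f := h) (g := {z | h z ≠ 0}.indicator 1) hh.aemeasurable
    (measurable_one.indicator hS).aemeasurable
  have e1 : ∫⁻ z, h z * {z | h z ≠ 0}.indicator 1 z ∂L = ∫⁻ z, h z ∂L := by
    congr 1; ext z
    by_cases hz : h z = 0
    · simp [hz]
    · rw [indicator_of_mem (show z ∈ {z | h z ≠ 0} from hz)]; simp
  have e2 : ∫⁻ z, ({z | h z ≠ 0}.indicator 1 z : ℝ≥0∞) ^ 2 ∂L = L {z | h z ≠ 0} := by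
    rw [← lintegral_indicator_one hS]
    congr 1; ext z
    by_cases hz : z ∈ {z | h z ≠ 0}
    · simp only [indicator_of_mem hz]; simp
    · simp only [indicator_of_notMem hz]; simp
  rwa [e1, e2] at this
end abs

lemma lint_rot (θ : ℝ) (x : ℂ) {F : ℂ → ℝ≥0∞} : ∫⁻ u, F (x + cis θ * u) = ∫⁻ y, F y := by
  have h := (rotation (Circle.exp θ)).measurePreserving
  have h2 : ∫⁻ u, F (x + (rotation (Circle.exp θ)) u) = ∫⁻ y, F (x + y) :=
    h.lintegral_comp_emb (rotation (Circle.exp θ)).toHomeomorph.measurableEmbedding (fun y => F (x + y))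
  rw [lintegral_add_left_eq_self] at h2
  rw [← h2]
  congr 1

/-- angular measure for the rotations -/
def I0 : Measure ℝ := volume.restrict (Icc (0 : ℝ) (1/4))
instance : IsFiniteMeasure I0 := by unfold I0; infer_instance
lemma I0_univ : I0 univ = ENNReal.ofReal (1/4) := by
  unfold I0
  rw [Measure.restrict_apply_univ, Real.volume_Icc]; simp

lemma I0_conv {F : ℝ → ℝ≥0∞} : ∫⁻ θ, ∫⁻ θ', F (θ' - θ) ∂I0 ∂I0 ≤ ∫⁻ τ, F τ ∂I1 := by
  have h : ∀ θ ∈ Icc (0:ℝ) (1/4), ∫⁻ θ', F (θ' - θ) ∂I0 ≤ ∫⁻ τ, F τ ∂I1 := by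
    intro θ hθ
    unfold I0 I1
    rw [← lintegral_indicator measurableSet_Icc, ← lintegral_indicator measurableSet_Icc,
      
      ← lintegral_sub_right_eq_self ((Icc (-(1/4):ℝ) (1/4)).indicator F) θ]
    refine lintegral_mono fun θ' => ?_
    by_cases h : θ' ∈ Icc (0:ℝ) (1/4)
    · rw [indicator_of_mem h, indicator_of_mem (show θ' - θ ∈ Icc (-(1/4):ℝ) (1/4) from
        ⟨by linarith [h.1, hθ.2], by linarith [h.2, hθ.1]⟩)]
    · rw [indicator_of_notMem h]; exact zero_le
  calc _ ≤ ∫⁻ θ, (∫⁻ τ, F τ ∂I1) ∂I0 := by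
        unfold I0
        exact setLIntegral_mono' measurableSet_Icc h
    _ ≤ _ := by
        rw [lintegral_const, I0_univ]
        refine mul_le_of_le_one_right zero_le ?_
        rw [ENNReal.ofReal_le_one]; norm_num

namespace FR
variable {s D M : ℝ} {ρ : ℂ → ℝ}

lemma lint (h : FR s D M ρ) (g : ℂ → ℝ≥0∞) (hg : Measurable g) :
    ∫⁻ x, g x ∂(dens ρ) = ∫⁻ x, ENNReal.ofReal (ρ x) * g x := by
  unfold dens
  rw [lintegral_withDensity_eq_lintegral_mul _ h.cont.measurable.ennreal_ofReal hg]
  rfl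

lemma nu_eq (h : FR s D M ρ) (τ : ℝ) (w : ℂ) : ENNReal.ofReal (nu ρ τ w) =
    ∫⁻ x, ENNReal.ofReal (ρ (w + cis τ * x)) ∂(dens ρ) := by
  haveI := h.fin
  obtain ⟨B, hB0, hB⟩ := h.bdd
  have := h.cont
  refine ofReal_integral_eq_lintegral_ofReal ?_ (Filter.Eventually.of_forall fun _ => h.nn _)
  refine Integrable.of_bound (C := B) ?_ (Filter.Eventually.of_forall fun x => ?_)
  · exact (by fun_prop : Continuous fun x => ρ (w + cis τ * x)).aestronglyMeasurable
  · rw [Real.norm_of_nonneg (h.nn _)]; exact hB _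

/-- triple correlation -/
def hh (ρ : ℂ → ℝ) (z : ℂ × ℂ) : ℝ≥0∞ := ∫⁻ p : ℝ × ℂ, ENNReal.ofReal (ρ (p.2 + cis p.1 * z.1)) *
  ENNReal.ofReal (ρ (p.2 + cis p.1 * z.2)) ∂(I0.prod (dens ρ))

lemma gm (h : FR s D M ρ) : Measurable (Function.uncurry
    (fun (p : ℝ × ℂ) (u : ℂ) => ENNReal.ofReal (ρ (p.2 + cis p.1 * u)))) := by
  have := h.cont
  have := continuous_cis
  exact (by fun_prop : Continuous fun y : (ℝ × ℂ) × ℂ => ρ (y.1.2 + cis y.1.1 * y.2)).measurable.ennreal_ofReal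

lemma hh_meas (h : FR s D M ρ) : Measurable (hh ρ) := by
  haveI := h.fin
  have h0 := h.gm
  unfold hh
  have : Measurable fun y : (ℂ × ℂ) × (ℝ × ℂ) => ENNReal.ofReal (ρ (y.2.2 + cis y.2.1 * y.1.1)) *
      ENNReal.ofReal (ρ (y.2.2 + cis y.2.1 * y.1.2)) :=
    (h0.comp (f := fun y : (ℂ × ℂ) × (ℝ × ℂ) => (y.2, y.1.1)) (by fun_prop)).mul
      (h0.comp (f := fun y : (ℂ × ℂ) × (ℝ × ℂ) => (y.2, y.1.2)) (by fun_prop))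
  exact this.lintegral_prod_right'

lemma hh_int (h : FR s D M ρ) : ∫⁻ z, hh ρ z =
    ENNReal.ofReal (1/4) * dens ρ univ * (dens ρ univ) ^ 2 := by
  haveI := h.fin
  unfold hh
  rw [Measure.volume_eq_prod, corr_one (g := fun (p : ℝ × ℂ) (u : ℂ) =>
    ENNReal.ofReal (ρ (p.2 + cis p.1 * u))) h.gm]
  have : ∀ p : ℝ × ℂ, ∫⁻ u, ENNReal.ofReal (ρ (p.2 + cis p.1 * u)) = dens ρ univ := by
    intro p
    rw [lint_rot (F := fun y => ENNReal.ofReal (ρ y)), dens, withDensity_apply _ MeasurableSet.univ,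
      Measure.restrict_univ]
  simp_rw [this]
  rw [lintegral_const, ← univ_prod_univ, Measure.prod_prod, I0_univ, mul_comm]

lemma inner_corr (h : FR s D M ρ) (p p' : ℝ × ℂ) :
    ∫⁻ u, ENNReal.ofReal (ρ (p.2 + cis p.1 * u)) * ENNReal.ofReal (ρ (p'.2 + cis p'.1 * u)) =
      ENNReal.ofReal (nu ρ (p'.1 - p.1) (p'.2 - cis (p'.1 - p.1) * p.2)) := by
  have hc := h.cont
  rw [h.nu_eq, h.lint _ (by
    exact (by fun_prop : Continuous fun x =>
      ρ (p'.2 - cis (p'.1 - p.1) * p.2 + cis (p'.1 - p.1) * x)).measurable.ennreal_ofReal),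
    ← lint_rot p.1 p.2 (F := fun x => ENNReal.ofReal (ρ x) *
      ENNReal.ofReal (ρ (p'.2 - cis (p'.1 - p.1) * p.2 + cis (p'.1 - p.1) * x)))]
  congr 1; ext u
  congr 3
  have : cis p'.1 = cis (p'.1 - p.1) * cis p.1 := by rw [← cis_add]; congr 1; ring
  rw [this]; ring_nf

lemma hh_sq (h : FR s D M ρ) : ∫⁻ z, hh ρ z ^ 2 ≤
    ∫⁻ z : ℝ × ℂ, ENNReal.ofReal (nu ρ z.1 z.2) ^ 3 ∂(I1.prod volume) := by
  haveI := h.fin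
  have hc := h.cont
  have hcis := continuous_cis
  have hnc := h.nu_cont
  unfold hh
  rw [Measure.volume_eq_prod, corr_sq (g := fun (p : ℝ × ℂ) (u : ℂ) =>
    ENNReal.ofReal (ρ (p.2 + cis p.1 * u))) h.gm]
  simp_rw [h.inner_corr]
  -- the four-fold integrand is continuous
  have hm4 : Measurable fun y : (ℝ × ℂ) × (ℝ × ℂ) => ENNReal.ofReal
      (nu ρ (y.2.1 - y.1.1) (y.2.2 - cis (y.2.1 - y.1.1) * y.1.2)) ^ 2 :=
    (hnc.comp (f := fun y : (ℝ × ℂ) × (ℝ × ℂ) =>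
      (y.2.1 - y.1.1, y.2.2 - cis (y.2.1 - y.1.1) * y.1.2)) (by fun_prop)).measurable.ennreal_ofReal.pow_const 2
  rw [lintegral_prod _ (hm4.lintegral_prod_right').aemeasurable]
  have key : ∀ τ : ℝ, ∫⁻ x, ∫⁻ x', ENNReal.ofReal (nu ρ τ (x' - cis τ * x)) ^ 2 ∂(dens ρ) ∂(dens ρ) =
      ∫⁻ w, ENNReal.ofReal (nu ρ τ w) ^ 3 := by
    intro τ
    have hnτ : Measurable fun w => ENNReal.ofReal (nu ρ τ w) :=
      (hnc.comp (f := fun w : ℂ => (τ, w)) (by fun_prop)).measurable.ennreal_ofReal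
    have e1 : ∀ x, ∫⁻ x', ENNReal.ofReal (nu ρ τ (x' - cis τ * x)) ^ 2 ∂(dens ρ) =
        ∫⁻ w, ENNReal.ofReal (nu ρ τ w) ^ 2 * ENNReal.ofReal (ρ (w + cis τ * x)) := by
      intro x
      have hm : Measurable fun x' => ENNReal.ofReal (nu ρ τ (x' - cis τ * x)) ^ 2 :=
        (hnτ.comp (f := fun x' => x' - cis τ * x) (by fun_prop)).pow_const 2
      rw [h.lint _ hm, ← lintegral_add_right_eq_self (fun x' => ENNReal.ofReal (ρ x') *
        ENNReal.ofReal (nu ρ τ (x' - cis τ * x)) ^ 2) (cis τ * x)]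
      congr 1; ext w
      rw [add_sub_cancel_right, mul_comm]
    simp_rw [e1]
    rw [lintegral_lintegral_swap]
    · congr 1; ext w
      rw [lintegral_const_mul', ← h.nu_eq, ← pow_succ]
      exact ENNReal.pow_ne_top ENNReal.ofReal_ne_top
    · refine Measurable.aemeasurable ?_
      exact ((hnτ.comp measurable_snd).pow_const 2).mul
        (by fun_prop : Continuous fun y : ℂ × ℂ => ρ (y.2 + cis τ * y.1)).measurable.ennreal_ofReal
  calc _ = ∫⁻ θ, ∫⁻ θ', ∫⁻ x, ∫⁻ x', ENNReal.ofReal (nu ρ (θ' - θ) (x' - cis (θ' - θ) * x)) ^ 2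
        ∂(dens ρ) ∂(dens ρ) ∂I0 ∂I0 := by
        congr 1; ext θ
        have e : ∀ x, ∫⁻ p' : ℝ × ℂ, ENNReal.ofReal (nu ρ (p'.1 - θ) (p'.2 - cis (p'.1 - θ) * x)) ^ 2
            ∂(I0.prod (dens ρ)) = ∫⁻ θ', ∫⁻ x', ENNReal.ofReal (nu ρ (θ' - θ) (x' - cis (θ' - θ) * x)) ^ 2
            ∂(dens ρ) ∂I0 := by
          intro x
          rw [lintegral_prod]
          exact (hm4.comp (f := fun y : ℝ × ℂ => ((θ, x), y)) (by fun_prop)).aemeasurable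
        simp_rw [e]
        rw [lintegral_lintegral_swap]
        refine Measurable.aemeasurable ?_
        have : Measurable fun y : (ℂ × ℝ) × ℂ => ENNReal.ofReal
            (nu ρ (y.1.2 - θ) (y.2 - cis (y.1.2 - θ) * y.1.1)) ^ 2 :=
            hm4.comp (f := fun y : (ℂ × ℝ) × ℂ => ((θ, y.1.1), (y.1.2, y.2))) (by fun_prop)
        exact this.lintegral_prod_right'
    _ = ∫⁻ θ, ∫⁻ θ', (∫⁻ w, ENNReal.ofReal (nu ρ (θ' - θ) w) ^ 3) ∂I0 ∂I0 := by simp_rw [key]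
    _ ≤ _ := I0_conv (F := fun τ => ∫⁻ w, ENNReal.ofReal (nu ρ τ w) ^ 3)
    _ = _ := by
        rw [lintegral_prod]
        exact (hnc.measurable.ennreal_ofReal.pow_const 3).aemeasurable

end FR
end

section
/-- cross product -/
def crs (u v : ℂ) : ℝ := u.re * v.im - u.im * v.re

lemma crs_cis (θ : ℝ) (u v : ℂ) : crs (cis θ * u) (cis θ * v) = crs u v := by
  have h : (cis θ).re ^ 2 + (cis θ).im ^ 2 = 1 := by
    have := norm_cis θ
    rw [← sq_eq_sq₀ (norm_nonneg _) zero_le_one, Complex.sq_norm, Complex.normSq_apply] at this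
    linarith
  unfold crs
  simp only [Complex.mul_re, Complex.mul_im]
  linear_combination (u.re * v.im - u.im * v.re) * h

lemma crs_null : volume {z : ℂ × ℂ | crs z.1 z.2 = 0} = 0 := by
  have hm : MeasurableSet {z : ℂ × ℂ | crs z.1 z.2 = 0} := by
    have : Continuous fun z : ℂ × ℂ => crs z.1 z.2 := by
      unfold crs
      fun_prop
    exact (isClosed_singleton.preimage this).measurableSet
  rw [Measure.volume_eq_prod, Measure.measure_prod_null hm]
  have h0 : ∀ᵐ u : ℂ, u ≠ 0 := by
    rw [ae_iff]; simp
  filter_upwards [h0] with u hu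
  let L : ℂ →ₗ[ℝ] ℝ := u.re • Complex.imLm - u.im • Complex.reLm
  have e : Prod.mk u ⁻¹' {z : ℂ × ℂ | crs z.1 z.2 = 0} = (LinearMap.ker L : Set ℂ) := by
    ext v
    simp [L, crs]
  rw [e]
  refine Measure.addHaar_submodule _ _ fun h => hu ?_
  have h1 : ∀ v, L v = 0 := fun v => by
    have : v ∈ LinearMap.ker L := by rw [h]; trivial
    simpa using this
  have a := h1 Complex.I
  have b := h1 1
  simp [L] at a b
  exact Complex.ext a b

/-- triangle reconstruction -/
def TriA (w : ℂ × ℂ) : ℝ := (w.1.re ^ 2 + w.1.im ^ 2 - w.2.re ^ 2) / (2 * w.1.re)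
def TriG (σ : ℝ) (w : ℂ × ℂ) : ℂ × ℂ := (w.1.re * cis w.2.im,
  cis w.2.im * (TriA w + (σ * √(w.1.im ^ 2 - TriA w ^ 2) : ℝ) * Complex.I))

def TriD : Set (ℂ × ℂ) := {w | 0 < w.1.re ∧ 0 < w.1.im ^ 2 - TriA w ^ 2}

lemma TriG_diff (σ : ℝ) : DifferentiableOn ℝ (TriG σ) TriD := by
  intro w hw
  have h1 : DifferentiableAt ℝ (fun w : ℂ × ℂ => w.1.re) w :=
    (Complex.reCLM.comp (ContinuousLinearMap.fst ℝ ℂ ℂ)).differentiableAt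
  have h2 : DifferentiableAt ℝ (fun w : ℂ × ℂ => w.1.im) w :=
    (Complex.imCLM.comp (ContinuousLinearMap.fst ℝ ℂ ℂ)).differentiableAt
  have h3 : DifferentiableAt ℝ (fun w : ℂ × ℂ => w.2.re) w :=
    (Complex.reCLM.comp (ContinuousLinearMap.snd ℝ ℂ ℂ)).differentiableAt
  have h4 : DifferentiableAt ℝ (fun w : ℂ × ℂ => w.2.im) w :=
    (Complex.imCLM.comp (ContinuousLinearMap.snd ℝ ℂ ℂ)).differentiableAt
  have ha : DifferentiableAt ℝ TriA w := by
    unfold TriA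
    have hne : 2 * w.1.re ≠ 0 := by have := hw.1; positivity
    have hn : DifferentiableAt ℝ (fun w : ℂ × ℂ => w.1.re ^ 2 + w.1.im ^ 2 - w.2.re ^ 2) w :=
      ((h1.pow 2).add (h2.pow 2)).sub (h3.pow 2)
    have hd : DifferentiableAt ℝ (fun w : ℂ × ℂ => 2 * w.1.re) w := h1.const_mul 2
    have hi : DifferentiableAt ℝ (fun w : ℂ × ℂ => (2 * w.1.re)⁻¹) w :=
      (differentiableAt_inv hne).comp w hd
    simp_rw [div_eq_mul_inv]
    exact hn.mul hi
  have hb : DifferentiableAt ℝ (fun w : ℂ × ℂ => √(w.1.im ^ 2 - TriA w ^ 2)) w :=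
    ((h2.pow 2).sub (ha.pow 2)).sqrt hw.2.ne'
  have of : ∀ {f : ℂ × ℂ → ℝ}, DifferentiableAt ℝ f w → DifferentiableAt ℝ (fun w => (f w : ℂ)) w :=
    fun hf => (Complex.ofRealCLM.differentiableAt).comp w hf
  have hc : DifferentiableAt ℝ (fun w : ℂ × ℂ => cis w.2.im) w := by
    unfold cis
    have := of h4
    fun_prop
  refine DifferentiableAt.differentiableWithinAt ?_
  unfold TriG
  exact DifferentiableAt.prodMk ((of h1).mul hc) (hc.mul ((of ha).add ((of (hb.const_mul σ)).mul_const _)))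

lemma TriG_rec {u v : ℂ} (h : crs u v ≠ 0) : ∃ w ∈ TriD, w.1.re = ‖u‖ ∧ w.1.im = ‖v‖ ∧ w.2.re = ‖v - u‖ ∧
    (TriG 1 w = (u, v) ∨ TriG (-1) w = (u, v)) := by
  have hu : u ≠ 0 := by rintro rfl; simp [crs] at h
  have hr : 0 < ‖u‖ := by positivity
  set α := Complex.arg u
  have hα : u = cis α * (‖u‖ : ℂ) := by
    have := Complex.norm_mul_exp_arg_mul_I u
    rw [mul_comm]; exact this.symm
  set q := cis (-α) * v with hq
  have hv : v = cis α * q := by rw [hq, ← mul_assoc, cis_mul_neg, one_mul]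
  have hc : crs u v = ‖u‖ * q.im := by
    conv_lhs => rw [hα, hv]
    rw [crs_cis]; simp [crs]
  have hb : q.im ≠ 0 := by rintro h0; rw [h0] at hc; simp [hc] at h
  have hvn : ‖v‖ ^ 2 = q.re ^ 2 + q.im ^ 2 := by
    rw [hv, norm_mul, norm_cis, one_mul, Complex.sq_norm, Complex.normSq_apply]; ring
  have hvu : ‖v - u‖ ^ 2 = (q.re - ‖u‖) ^ 2 + q.im ^ 2 := by
    have : v - u = cis α * (q - (‖u‖ : ℂ)) := by rw [mul_sub, ← hv, ← hα]
    rw [this, norm_mul, norm_cis, one_mul, Complex.sq_norm, Complex.normSq_apply]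
    simp; ring
  let w : ℂ × ℂ := (⟨‖u‖, ‖v‖⟩, ⟨‖v - u‖, α⟩)
  have haw : TriA w = q.re := by
    simp only [TriA, w]
    rw [hvn, hvu]; field_simp; ring
  have hw2 : w.1.im ^ 2 - TriA w ^ 2 = q.im ^ 2 := by
    rw [haw]; simp only [w]; rw [hvn]; ring
  refine ⟨w, ⟨hr, ?_⟩, rfl, rfl, rfl, ?_⟩
  · rw [hw2]; positivity
  · have e : ∀ σ : ℝ, σ * |q.im| = q.im → TriG σ w = (u, v) := by
      intro σ hσ
      unfold TriG
      rw [hw2, haw, Real.sqrt_sq_eq_abs, hσ]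
      refine Prod.ext ?_ ?_
      · simp only [w]; rw [mul_comm]; exact hα.symm
      · simp only [w]; rw [Complex.re_add_im]; exact hv.symm
    rcases le_or_gt 0 q.im with h0 | h0
    · left; apply e; rw [abs_of_nonneg h0, one_mul]
    · right; apply e; rw [abs_of_neg h0]; ring

/-- the set of all differences -/
def S0 (E : Set ℂ) : Set (ℂ × ℂ) := (fun y : ℝ × ℂ × ℂ × ℂ =>
  (cis (-y.1) * (y.2.2.1 - y.2.1), cis (-y.1) * (y.2.2.2 - y.2.1))) '' (Icc (0:ℝ) (1/4) ×ˢ (E ×ˢ (E ×ˢ E)))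

lemma S0_compact {E : Set ℂ} (hE : IsCompact E) : IsCompact (S0 E) := by
  refine (isCompact_Icc.prod (hE.prod (hE.prod hE))).image ?_
  have := continuous_cis
  fun_prop

lemma hh_supp {s D M δ : ℝ} {ρ : ℂ → ℝ} (h : FR s D M ρ) {E : Set ℂ}
    (hs : ∀ x, ρ x ≠ 0 → ∃ y ∈ E, dist x y ≤ δ) {z : ℂ × ℂ} (hz : FR.hh ρ z ≠ 0) :
    z ∈ cthickening (2 * δ) (S0 E) := by
  haveI := h.fin
  have hc := h.cont
  have : ∃ p : ℝ × ℂ, p.1 ∈ Icc (0:ℝ) (1/4) ∧ ρ p.2 ≠ 0 ∧ ρ (p.2 + cis p.1 * z.1) ≠ 0 ∧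
      ρ (p.2 + cis p.1 * z.2) ≠ 0 := by
    by_contra hcon
    push Not at hcon
    apply hz
    unfold FR.hh
    have a1 : ∀ᵐ p ∂(I0.prod (dens ρ)), p.1 ∈ Icc (0:ℝ) (1/4) := by
      have : ∀ᵐ t ∂I0, t ∈ Icc (0:ℝ) (1/4) := by
        unfold I0; exact ae_restrict_mem measurableSet_Icc
      exact Measure.quasiMeasurePreserving_fst.ae this
    have a2 : ∀ᵐ p ∂(I0.prod (dens ρ)), ρ p.2 ≠ 0 := by
      have : ∀ᵐ t ∂(dens ρ), ρ t ≠ 0 := by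
        unfold dens
        rw [ae_withDensity_iff h.cont.measurable.ennreal_ofReal]
        filter_upwards with x hx h0
        simp [h0] at hx
      exact Measure.quasiMeasurePreserving_snd.ae this
    rw [lintegral_eq_zero_of_ae_eq_zero]
    filter_upwards [a1, a2] with p h1 h2
    by_cases h3 : ρ (p.2 + cis p.1 * z.1) = 0
    · simp [h3]
    · simp [hcon p h1 h2 h3]
  obtain ⟨p, hp, h1, h2, h3⟩ := this
  obtain ⟨x, hx, hx'⟩ := hs _ h1
  obtain ⟨y, hy, hy'⟩ := hs _ h2
  obtain ⟨w, hw, hw'⟩ := hs _ h3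
  refine mem_cthickening_of_dist_le z (cis (-p.1) * (y - x), cis (-p.1) * (w - x)) _ _ 
    ⟨(p.1, x, y, w), ⟨hp, hx, hy, hw⟩, rfl⟩ ?_
  have key : ∀ u t : ℂ, dist (p.2 + cis p.1 * u) t ≤ δ → dist u (cis (-p.1) * (t - x)) ≤ 2 * δ := by
    intro u t ht
    have : u - cis (-p.1) * (t - x) = cis (-p.1) * ((p.2 + cis p.1 * u - t) - (p.2 - x)) := by
      have := cis_neg_mul p.1
      linear_combination (-u) * this
    rw [dist_eq_norm, this, norm_mul, norm_cis, one_mul]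
    rw [dist_eq_norm] at ht hx'
    linarith [norm_sub_le (p.2 + cis p.1 * u - t) (p.2 - x)]
  exact max_le (key _ _ hy') (key _ _ hw')

theorem S0_pos {E : Set ℂ} (hE : IsCompact E) {s D M : ℝ} {m0 : ℝ≥0∞} (hm0 : m0 ≠ 0) (hs : 8/5 < s) (hs2 : s ≤ 2)
    (hD : 0 ≤ D) (hM : 1 ≤ M)
    (happ : ∀ δ > 0, ∃ ρ, FR s D M ρ ∧ m0 ≤ dens ρ univ ∧ ∀ x, ρ x ≠ 0 → ∃ y ∈ E, dist x y ≤ δ) :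
    volume (S0 E) ≠ 0 := by
  obtain ⟨K, hK, hL⟩ := L3 hs hs2 hD hM
  have hlow : ∀ δ > 0, (ENNReal.ofReal (1/4) * m0 * m0 ^ 2) ^ 2 ≤ K * volume (cthickening (2 * δ) (S0 E)) := by
    intro δ hδ
    obtain ⟨ρ, hρ, hm, hsp⟩ := happ δ hδ
    calc (ENNReal.ofReal (1/4) * m0 * m0 ^ 2) ^ 2
        ≤ (ENNReal.ofReal (1/4) * dens ρ univ * (dens ρ univ) ^ 2) ^ 2 := by gcongr
      _ = (∫⁻ z, FR.hh ρ z) ^ 2 := by rw [hρ.hh_int]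
      _ ≤ _ := corr_supp hρ.hh_meas
      _ ≤ _ := by
        refine mul_le_mul' (hρ.hh_sq.trans (hL ρ hρ)) (measure_mono fun z hz => hh_supp hρ hsp hz)
  intro h0
  have ht := tendsto_measure_cthickening_of_isCompact (μ := volume) (S0_compact hE)
  rw [h0] at ht
  have ht2 : Filter.Tendsto (fun r => K * volume (cthickening r (S0 E))) (𝓝[>] 0) (𝓝 (K * 0)) :=
    ENNReal.Tendsto.const_mul (ht.mono_left nhdsWithin_le_nhds) (Or.inr hK)
  have : (ENNReal.ofReal (1/4) * m0 * m0 ^ 2) ^ 2 ≤ K * 0 := by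
    refine ge_of_tendsto ht2 ?_
    filter_upwards [self_mem_nhdsWithin] with r hr
    have := hlow (r / 2) (half_pos hr)
    rwa [mul_div_cancel₀ r two_ne_zero] at this
  rw [mul_zero, nonpos_iff_eq_zero] at this
  have h4 : ENNReal.ofReal (1/4) ≠ 0 := by simp
  simp [hm0] at this

/-- encoded nondegenerate triangles -/
def TC (E : Set ℂ) : Set (ℂ × ℂ) := {w | ∃ x ∈ E, ∃ y ∈ E, ∃ z ∈ E, crs (y - x) (z - x) ≠ 0 ∧
  w.1.re = ‖y - x‖ ∧ w.1.im = ‖z - x‖ ∧ w.2.re = ‖z - y‖}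

theorem TC_pos {E : Set ℂ} (h : volume (S0 E) ≠ 0) : volume (TC E) ≠ 0 := by
  intro h0
  apply h
  haveI : (volume : Measure (ℂ × ℂ)).IsAddHaarMeasure := by
    rw [Measure.volume_eq_prod]; infer_instance
  have hG : ∀ σ : ℝ, volume (TriG σ '' (TC E ∩ TriD)) = 0 := fun σ =>
    addHaar_image_eq_zero_of_differentiableOn_of_addHaar_eq_zero _
      ((TriG_diff σ).mono inter_subset_right) (measure_mono_null inter_subset_left h0)
  refine measure_mono_null (t := {z : ℂ × ℂ | crs z.1 z.2 = 0} ∪ (TriG 1 '' (TC E ∩ TriD) ∪ TriG (-1) '' (TC E ∩ TriD)))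
    ?_ (measure_union_null crs_null (measure_union_null (hG _) (hG _)))
  rintro _ ⟨⟨θ, x, y, z⟩, ⟨-, hx, hy, hz⟩, rfl⟩
  simp only at hx hy hz ⊢
  by_cases hc : crs (cis (-θ) * (y - x)) (cis (-θ) * (z - x)) = 0
  · exact Or.inl hc
  obtain ⟨w, hw, h1, h2, h3, h4⟩ := TriG_rec hc
  right
  have hwT : w ∈ TC E := by
    refine ⟨x, hx, y, hy, z, hz, by rwa [crs_cis] at hc, ?_, ?_, ?_⟩
    · rw [h1, norm_mul, norm_cis, one_mul]
    · rw [h2, norm_mul, norm_cis, one_mul]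
    · rw [h3, ← mul_sub, norm_mul, norm_cis, one_mul]; congr 1; ring
  rcases h4 with h4 | h4
  · left; exact ⟨w, ⟨hwT, hw⟩, h4⟩
  · right; exact ⟨w, ⟨hwT, hw⟩, h4⟩
end

section
section frost
variable {α β : Type*} [Fintype α] [DecidableEq α] [DecidableEq β]

/-- fibre sums -/
def fib (p : ℕ → α → β) (m : α → ℝ) (j : ℕ) (Q : β) : ℝ := ∑ q with p j q = Q, m q

lemma frost_max (p : ℕ → α → β) (J : ℕ) (w : ℕ → ℝ) (hw : ∀ j, 0 < w j) :
    ∃ m : α → ℝ, (∀ q, 0 ≤ m q) ∧ (∀ j ≤ J, ∀ Q, fib p m j Q ≤ w j) ∧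
      ∀ q, ∃ j ≤ J, fib p m j (p j q) = w j := by
  let C : Set (α → ℝ) := {m | (∀ q, 0 ≤ m q) ∧ ∀ j ≤ J, ∀ Q, fib p m j Q ≤ w j}
  have hcl : IsClosed C := by
    have h1 : IsClosed {m : α → ℝ | ∀ q, 0 ≤ m q} := by
      simp only [setOf_forall]
      exact isClosed_iInter fun q => isClosed_le continuous_const (continuous_apply q)
    have h2 : IsClosed {m : α → ℝ | ∀ j ≤ J, ∀ Q, fib p m j Q ≤ w j} := by
      simp only [setOf_forall]
      refine isClosed_iInter fun j => isClosed_iInter fun _ => isClosed_iInter fun Q =>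
        isClosed_le ?_ continuous_const
      unfold fib
      fun_prop
    exact h1.inter h2
  have hsub : C ⊆ Icc (fun _ => 0) (fun _ => w 0) := by
    intro m hm
    refine ⟨fun q => hm.1 q, fun q => (?_ : m q ≤ _).trans (hm.2 0 (Nat.zero_le _) (p 0 q))⟩
    exact Finset.single_le_sum (f := m) (fun i _ => hm.1 i) (by simp)
  have hC : IsCompact C := isCompact_Icc.of_isClosed_subset hcl hsub
  have hne : C.Nonempty := ⟨0, fun _ => le_rfl, fun j _ Q => by simp [fib, (hw j).le]⟩
  obtain ⟨m, hm, hmax⟩ := hC.exists_isMaxOn hne (f := fun m : α → ℝ => ∑ q, m q)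
    (by fun_prop)
  refine ⟨m, hm.1, hm.2, fun q => ?_⟩
  by_contra hcon
  push Not at hcon
  have hlt : ∀ j ≤ J, fib p m j (p j q) < w j := fun j hj => lt_of_le_of_ne (hm.2 j hj _) (hcon j hj)
  obtain ⟨j0, hj0, hmin⟩ := Finset.exists_min_image (Finset.range (J+1))
    (fun j => w j - fib p m j (p j q)) ⟨0, by simp⟩
  set ε := w j0 - fib p m j0 (p j0 q)
  have hε : 0 < ε := sub_pos.2 (hlt j0 (by simpa [Nat.lt_succ_iff] using hj0))
  have hsum : ∀ F : Finset α, ∑ x ∈ F, (m x + if x = q then ε else 0) =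
      ∑ x ∈ F, m x + if q ∈ F then ε else 0 := by
    intro F
    rw [Finset.sum_add_distrib, Finset.sum_ite_eq']
  have hmem : (fun x => m x + if x = q then ε else 0) ∈ C := by
    refine ⟨fun x => ?_, fun j hj Q => ?_⟩
    · have := hm.1 x
      dsimp only
      split_ifs <;> linarith
    · unfold fib
      rw [hsum]
      by_cases hQ : p j q = Q
      · subst hQ
        have := hmin j (by simpa [Nat.lt_succ_iff] using hj)
        simp only [Finset.mem_filter, Finset.mem_univ, true_and, if_true]
        unfold fib at this
        change _ + ε ≤ _
        linarith
      · have := hm.2 j hj Q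
        simpa [hQ, fib] using this
  have := hmax hmem
  simp only [mem_setOf_eq] at this
  rw [hsum] at this
  simp at this
  linarith

lemma frost_sum (p : ℕ → α → β) (J : ℕ) (w : ℕ → ℝ) (hw : ∀ j, 0 < w j)
    (hp : ∀ i j, i ≤ j → j ≤ J → ∀ q q', p i q = p i q' → p j q = p j q') :
    ∃ m : α → ℝ, (∀ q, 0 ≤ m q) ∧ (∀ j ≤ J, ∀ Q, fib p m j Q ≤ w j) ∧
      ∃ top : α → ℕ, (∀ q, top q ≤ J) ∧
        ∑ q, m q = ∑ Q ∈ Finset.univ.image (fun q => (top q, p (top q) q)), w Q.1 := by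
  classical
  obtain ⟨m, h0, h1, h2⟩ := frost_max p J w hw
  let top : α → ℕ := fun q => Nat.findGreatest (fun j => fib p m j (p j q) = w j) J
  have htop : ∀ q, fib p m (top q) (p (top q) q) = w (top q) := by
    intro q
    obtain ⟨j, hj, hj'⟩ := h2 q
    exact Nat.findGreatest_spec (P := fun j => fib p m j (p j q) = w j) hj hj'
  have hle : ∀ q, top q ≤ J := fun q => Nat.findGreatest_le J
  have hge : ∀ q j, j ≤ J → fib p m j (p j q) = w j → j ≤ top q := fun q j hj h =>
    Nat.le_findGreatest hj h
  have heq : ∀ q q', p (top q) q = p (top q) q' → top q' = top q := by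
    intro q q' h
    have a : top q ≤ top q' := hge q' _ (hle q) (by rw [← h]; exact htop q)
    have b := hp _ _ a (hle q') _ _ h
    exact le_antisymm (hge q _ (hle q') (by rw [b]; exact htop q')) a
  refine ⟨m, h0, h1, top, hle, ?_⟩
  rw [← Finset.sum_fiberwise_of_maps_to (t := Finset.univ.image (fun q => (top q, p (top q) q)))
    (g := fun q => (top q, p (top q) q)) (fun q hq => Finset.mem_image_of_mem _ hq)]
  refine Finset.sum_congr rfl fun Q hQ => ?_
  obtain ⟨q, -, rfl⟩ := Finset.mem_image.1 hQ
  rw [← htop q]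
  unfold fib
  refine Finset.sum_congr ?_ fun _ _ => rfl
  ext q'
  simp only [Finset.mem_filter, Finset.mem_univ, true_and, Prod.mk.injEq]
  constructor
  · rintro ⟨a, b⟩; rw [a] at b; exact b
  · intro h
    have := heq q q' h.symm
    exact ⟨this, by rw [this]; exact h⟩
end frost

lemma content {E : Set ℂ} {s : ℝ} (h : μH[s] E ≠ 0) : ∃ c : ℝ, 0 < c ∧ ∀ (I : Finset (ℕ × ℤ × ℤ))
    (t : ℕ × ℤ × ℤ → Set ℂ), E ⊆ ⋃ i ∈ I, t i → (∀ i ∈ I, ediam (t i) ≤ ENNReal.ofReal c) →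
    ENNReal.ofReal c ≤ ∑ i ∈ I, ediam (t i) ^ s := by
  by_contra hcon
  push Not at hcon
  have hpos : ∀ n : ℕ, (0:ℝ) < 1 / (n + 1) := fun n => by positivity
  choose I t hE hd hs using fun n : ℕ => hcon (1 / (n + 1)) (hpos n)
  have hlim : Filter.Tendsto (fun n : ℕ => ENNReal.ofReal (1 / ((n:ℝ) + 1))) Filter.atTop (𝓝 0) := by
    rw [← ENNReal.ofReal_zero]
    exact ENNReal.tendsto_ofReal tendsto_one_div_add_atTop_nhds_zero_nat
  apply h
  have := Measure.hausdorffMeasure_le_liminf_sum (ι := fun n => {i // i ∈ I n}) s E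
    (fun n : ℕ => ENNReal.ofReal (1 / ((n:ℝ) + 1))) hlim (fun n i => t n i)
    (Filter.Eventually.of_forall fun n i => hd n _ i.2)
    (Filter.Eventually.of_forall fun n => by
      refine (hE n).trans ?_
      intro x hx
      simp only [mem_iUnion] at hx ⊢
      obtain ⟨i, hi, hx⟩ := hx
      exact ⟨⟨i, hi⟩, hx⟩)
  refine le_antisymm (this.trans ?_) zero_le
  rw [← hlim.liminf_eq]
  refine Filter.liminf_le_liminf (Filter.Eventually.of_forall fun n => ?_)
  rw [Finset.univ_eq_attach, Finset.sum_attach (I n) (fun i => ediam (t n i) ^ s)]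
  exact (hs n).le
end

section
lemma bump_ex {η : ℝ} (hη : 0 < η) : ∃ b : ℂ → ℝ, Continuous b ∧ (∀ x, 0 ≤ b x) ∧ (∀ x, 2 * η ≤ ‖x‖ → b x = 0) ∧
    ∫⁻ x, ENNReal.ofReal (b x) = 1 ∧ ∀ r, 0 < r → ∀ x y, ∫⁻ z in closedBall x r, ENNReal.ofReal (b (z - y)) ≤
      ENNReal.ofReal (r ^ 2 / η ^ 2) := by
  let f : ContDiffBump (0 : ℂ) := ⟨η, 2 * η, hη, by linarith⟩
  have hvol : ∀ x : ℂ, ∀ r : ℝ, 0 < r → volume (closedBall x r) = ENNReal.ofReal (Real.pi * r ^ 2) := by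
    intro x r hr
    rw [Complex.volume_closedBall, ← ENNReal.ofReal_pow hr.le, ← ENNReal.ofReal_coe_nnreal,
      ← ENNReal.ofReal_mul (by positivity), NNReal.coe_real_pi, mul_comm]
  have hb : ∀ x, f.normed volume x ≤ 1 / (Real.pi * η ^ 2) := by
    intro x
    have := f.normed_le_div_measure_closedBall_rIn (μ := volume) x
    rwa [Measure.real, hvol _ _ f.rIn_pos, ENNReal.toReal_ofReal (by positivity)] at this
  refine ⟨f.normed volume, f.continuous_normed, f.nonneg_normed, fun x hx => ?_, ?_, ?_⟩
  · by_contra h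
    have : x ∈ Function.support (f.normed volume) := h
    rw [f.support_normed_eq] at this
    simp only [mem_ball, dist_zero_right] at this
    exact absurd hx (not_le.2 this)
  · rw [← ofReal_integral_eq_lintegral_ofReal f.integrable_normed
      (Filter.Eventually.of_forall f.nonneg_normed), f.integral_normed, ENNReal.ofReal_one]
  · intro r hr x y
    calc _ ≤ ∫⁻ z in closedBall x r, ENNReal.ofReal (1 / (Real.pi * η ^ 2)) :=
          lintegral_mono fun z => ENNReal.ofReal_le_ofReal (hb _)
      _ = _ := by
          rw [setLIntegral_const, hvol _ _ hr, ← ENNReal.ofReal_mul (by positivity)]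
          congr 1
          have := Real.pi_pos
          field_simp

/-- grid -/
def pos (η : ℝ) (q : ℤ × ℤ) : ℂ := ⟨q.1 * η, q.2 * η⟩
def par (j : ℕ) (q : ℤ × ℤ) : ℤ × ℤ := (q.1 / 2 ^ j, q.2 / 2 ^ j)
def fl (η : ℝ) (z : ℂ) : ℤ × ℤ := (⌊z.re / η⌋, ⌊z.im / η⌋)

lemma par_par {i j : ℕ} (h : i ≤ j) {q q' : ℤ × ℤ} (hq : par i q = par i q') : par j q = par j q' := by
  obtain ⟨k, rfl⟩ := Nat.exists_eq_add_of_le h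
  have e : ∀ q, par (i + k) q = par k (par i q) := by
    intro q
    simp only [par, pow_add]
    rw [Int.ediv_ediv_of_nonneg (by positivity), Int.ediv_ediv_of_nonneg (by positivity)]
  rw [e, e, hq]

lemma ediv_bd (a : ℤ) (j : ℕ) : ((a / 2 ^ j : ℤ) : ℝ) * 2 ^ j ≤ a ∧ (a : ℝ) + 1 ≤ ((a / 2 ^ j : ℤ) + 1) * 2 ^ j := by
  have h : (0:ℤ) < 2 ^ j := by positivity
  constructor
  · exact_mod_cast Int.ediv_mul_le a h.ne'
  · exact_mod_cast Int.lt_ediv_add_one_mul_self a h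

lemma floor_bd {η : ℝ} (hη : 0 < η) (x : ℝ) : (⌊x / η⌋ : ℝ) * η ≤ x ∧ x < (⌊x / η⌋ + 1) * η := by
  constructor
  · rw [← le_div_iff₀ hη]; exact Int.floor_le _
  · rw [← div_lt_iff₀ hη]; exact Int.lt_floor_add_one _

/-- cubes -/
def cube (η : ℝ) (i : ℕ × ℤ × ℤ) : Set ℂ := {z | (i.2.1 : ℝ) * (η * 2 ^ i.1) ≤ z.re ∧ z.re ≤ (i.2.1 + 1) * (η * 2 ^ i.1) ∧
  (i.2.2 : ℝ) * (η * 2 ^ i.1) ≤ z.im ∧ z.im ≤ (i.2.2 + 1) * (η * 2 ^ i.1)}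

lemma mem_cube {η : ℝ} (hη : 0 < η) (z : ℂ) (j : ℕ) : z ∈ cube η (j, par j (fl η z)) := by
  have key : ∀ x : ℝ, ((⌊x / η⌋ / 2 ^ j : ℤ) : ℝ) * (η * 2 ^ j) ≤ x ∧ x ≤ ((⌊x / η⌋ / 2 ^ j : ℤ) + 1) * (η * 2 ^ j) := by
    intro x
    obtain ⟨h1, h2⟩ := ediv_bd ⌊x / η⌋ j
    obtain ⟨h3, h4⟩ := floor_bd hη x
    constructor
    · calc _ = (((⌊x / η⌋ / 2 ^ j : ℤ) : ℝ) * 2 ^ j) * η := by ring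
        _ ≤ ⌊x / η⌋ * η := by gcongr
        _ ≤ x := h3
    · calc x ≤ (⌊x / η⌋ + 1) * η := h4.le
        _ ≤ (((⌊x / η⌋ / 2 ^ j : ℤ) + 1) * 2 ^ j) * η := by gcongr
        _ = _ := by ring
  exact ⟨(key _).1, (key _).2, (key _).1, (key _).2⟩

lemma cube_diam {η : ℝ} (hη : 0 < η) (i : ℕ × ℤ × ℤ) : ediam (cube η i) ≤ ENNReal.ofReal (2 * (η * 2 ^ i.1)) := by
  refine Metric.ediam_le fun z hz z' hz' => ?_
  rw [edist_dist]
  refine ENNReal.ofReal_le_ofReal ?_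
  rw [dist_eq_norm]
  refine (Complex.norm_le_abs_re_add_abs_im _).trans ?_
  obtain ⟨a, b, c, d⟩ := hz
  obtain ⟨a', b', c', d'⟩ := hz'
  have h1 : |(z - z').re| ≤ η * 2 ^ i.1 := by
    rw [Complex.sub_re, abs_le]; constructor <;> linarith
  have h2 : |(z - z').im| ≤ η * 2 ^ i.1 := by
    rw [Complex.sub_im, abs_le]; constructor <;> linarith
  linarith

lemma pos_fl {η : ℝ} (hη : 0 < η) (z : ℂ) : dist (pos η (fl η z)) z ≤ 2 * η := by
  rw [dist_eq_norm]
  refine (Complex.norm_le_abs_re_add_abs_im _).trans ?_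
  obtain ⟨a, b⟩ := floor_bd hη z.re
  obtain ⟨c, d⟩ := floor_bd hη z.im
  have h1 : |(pos η (fl η z) - z).re| ≤ η := by
    rw [Complex.sub_re, abs_le]; simp only [pos, fl]; constructor <;> linarith
  have h2 : |(pos η (fl η z) - z).im| ≤ η := by
    rw [Complex.sub_im, abs_le]; simp only [pos, fl]; constructor <;> linarith
  linarith

lemma par_box {η : ℝ} (hη : 0 < η) (x : ℂ) (j : ℕ) {q : ℤ × ℤ} (h : dist (pos η q) x ≤ 3 * (η * 2 ^ j)) :
    par j q ∈ Finset.Icc (⌊x.re / (η * 2 ^ j)⌋ - 3) (⌊x.re / (η * 2 ^ j)⌋ + 3) ×ˢ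
      Finset.Icc (⌊x.im / (η * 2 ^ j)⌋ - 3) (⌊x.im / (η * 2 ^ j)⌋ + 3) := by
  have key : ∀ (a : ℤ) (t : ℝ), |a * η - t| ≤ 3 * (η * 2 ^ j) →
      a / 2 ^ j ∈ Finset.Icc (⌊t / (η * 2 ^ j)⌋ - 3) (⌊t / (η * 2 ^ j)⌋ + 3) := by
    intro a t hat
    have hL : 0 < η * 2 ^ j := by positivity
    obtain ⟨h1, h2⟩ := ediv_bd a j
    obtain ⟨h5, h6⟩ := floor_bd hL t
    rw [abs_le] at hat
    have h3 : ((a / 2 ^ j : ℤ) : ℝ) * (η * 2 ^ j) ≤ a * η := by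
      have := mul_le_mul_of_nonneg_right h1 hη.le
      linarith
    have h4 : (a : ℝ) * η < ((a / 2 ^ j : ℤ) + 1) * (η * 2 ^ j) := by
      have := mul_le_mul_of_nonneg_right h2 hη.le
      linarith
    have h7 : (((a / 2 ^ j : ℤ) : ℝ) - 3) < ⌊t / (η * 2 ^ j)⌋ + 1 := by
      refine lt_of_mul_lt_mul_right ?_ hL.le
      linarith
    have h8 : (⌊t / (η * 2 ^ j)⌋ : ℝ) - 3 < ((a / 2 ^ j : ℤ) : ℝ) + 1 := by
      refine lt_of_mul_lt_mul_right ?_ hL.le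
      linarith
    rw [Finset.mem_Icc]
    have h7' : a / 2 ^ j - 3 < ⌊t / (η * 2 ^ j)⌋ + 1 := by exact_mod_cast h7
    have h8' : ⌊t / (η * 2 ^ j)⌋ - 3 < a / 2 ^ j + 1 := by exact_mod_cast h8
    constructor <;> omega
  rw [dist_eq_norm] at h
  rw [Finset.mem_product]
  exact ⟨key _ _ ((Complex.abs_re_le_norm (pos η q - x)).trans h),
    key _ _ ((Complex.abs_im_le_norm (pos η q - x)).trans h)⟩

/-- discrete Frostman measure at scale `δ0 / 2^J` -/
lemma frost_grid {E : Set ℂ} (hE : IsCompact E) {s : ℝ} (hs : 0 < s) (hs2 : s ≤ 2) {c : ℝ} (hc : 0 < c)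
    (hcont : ∀ (I : Finset (ℕ × ℤ × ℤ)) (t : ℕ × ℤ × ℤ → Set ℂ), E ⊆ ⋃ i ∈ I, t i →
      (∀ i ∈ I, ediam (t i) ≤ ENNReal.ofReal c) → ENNReal.ofReal c ≤ ∑ i ∈ I, ediam (t i) ^ s)
    (J : ℕ) {η : ℝ} (hη : 0 < η) (hJ : 2 * (η * 2 ^ J) = c) :
    ∃ (A : Finset (ℤ × ℤ)) (m : ℤ × ℤ → ℝ), (∀ q, 0 ≤ m q) ∧ (∀ q ∈ A, ∃ y ∈ E, dist (pos η q) y ≤ 2 * η) ∧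
      (∑ q ∈ A, m q ≤ 1) ∧ (min 1 (c / 4) ≤ ∑ q ∈ A, m q) ∧
      ∀ j ≤ J, ∀ x, ∑ q ∈ A with dist (pos η q) x ≤ 3 * (η * 2 ^ j), m q ≤ 49 * (η * 2 ^ j) ^ s := by
  classical
  have hfin : (fl η '' E).Finite := by
    obtain ⟨R, hR⟩ := hE.isBounded.subset_closedBall 0
    refine ((Finset.Icc (⌊-R / η⌋) (⌊R / η⌋) ×ˢ Finset.Icc (⌊-R / η⌋) (⌊R / η⌋)).finite_toSet).subset ?_
    rintro _ ⟨z, hz, rfl⟩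
    have hz' := hR hz
    rw [mem_closedBall, dist_zero_right] at hz'
    have h1 := abs_le.1 ((Complex.abs_re_le_norm z).trans hz')
    have h2 := abs_le.1 ((Complex.abs_im_le_norm z).trans hz')
    simp only [Finset.coe_product, Finset.coe_Icc, fl]
    refine ⟨⟨?_, ?_⟩, ?_, ?_⟩ <;> refine Int.floor_le_floor ?_ <;> gcongr <;> linarith
  let A : Finset (ℤ × ℤ) := hfin.toFinset
  have hA : ∀ q, q ∈ A ↔ q ∈ fl η '' E := fun q => hfin.mem_toFinset
  let p : ℕ → {q // q ∈ A} → ℤ × ℤ := fun j q => if j ≤ J then par j q.1 else 0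
  let w : ℕ → ℝ := fun j => if j ≤ J then (η * 2 ^ j) ^ s else 1
  have hw : ∀ j, 0 < w j := by
    intro j; simp only [w]; split_ifs <;> positivity
  obtain ⟨m, h0, h1, top, htop, hsum⟩ := frost_sum p (J + 1) w hw (by
    intro i j hij hj q q' h
    simp only [p] at h ⊢
    by_cases hjJ : j ≤ J
    · simp only [hjJ, hij.trans hjJ, if_true] at h ⊢
      exact par_par hij h
    · simp [hjJ])
  let m' : ℤ × ℤ → ℝ := fun q => if h : q ∈ A then m ⟨q, h⟩ else 0
  have hm' : ∀ q : {q // q ∈ A}, m' q = m q := fun q => by simp [m']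
  have hS : ∀ (P : ℤ × ℤ → Prop) [DecidablePred P], ∑ q ∈ A with P q, m' q =
      ∑ q : {q // q ∈ A} with P q.1, m q := by
    intro P _
    rw [Finset.sum_filter, Finset.sum_filter, ← Finset.sum_attach, Finset.univ_eq_attach]
    simp_rw [hm']
  have hS' : ∑ q ∈ A, m' q = ∑ q : {q // q ∈ A}, m q := by
    have := hS (fun _ => True)
    simpa using this
  refine ⟨A, m', fun q => ?_, fun q hq => ?_, ?_, ?_, fun j hj x => ?_⟩
  · simp only [m']; split_ifs
    · exact h0 _
    · exact le_rfl
  · obtain ⟨z, hz, rfl⟩ := (hA q).1 hq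
    exact ⟨z, hz, pos_fl hη z⟩
  · rw [hS']
    have := h1 (J+1) le_rfl 0
    simpa [fib, p, w] using this
  · rw [hS', hsum]
    by_cases hex : ∃ q, top q = J + 1
    · obtain ⟨q, hq⟩ := hex
      refine (min_le_left _ _).trans ?_
      have := Finset.single_le_sum (f := fun Q : ℕ × ℤ × ℤ => w Q.1) (fun i _ => (hw i.1).le)
        (Finset.mem_image_of_mem (fun q => (top q, p (top q) q)) (Finset.mem_univ q))
      simpa [hq, w] using this
    · push Not at hex
      have htop' : ∀ q, top q ≤ J := fun q => by have := htop q; have := hex q; omega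
      refine (min_le_right _ _).trans ?_
      set I := Finset.univ.image (fun q => (top q, p (top q) q))
      have hI : ∀ i ∈ I, i.1 ≤ J := by
        intro i hi
        obtain ⟨q, -, rfl⟩ := Finset.mem_image.1 hi
        exact htop' q
      have hle := hcont I (cube η) ?_ ?_
      · have : ENNReal.ofReal c ≤ ENNReal.ofReal (4 * ∑ Q ∈ I, w Q.1) := by
          refine hle.trans ?_
          rw [Finset.mul_sum, ENNReal.ofReal_sum_of_nonneg fun i _ => by have := hw i.1; positivity]
          refine Finset.sum_le_sum fun i hi => ?_
          calc ediam (cube η i) ^ s ≤ ENNReal.ofReal (2 * (η * 2 ^ i.1)) ^ s :=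
                ENNReal.rpow_le_rpow (cube_diam hη i) hs.le
            _ = ENNReal.ofReal ((2 * (η * 2 ^ i.1)) ^ s) := ENNReal.ofReal_rpow_of_nonneg (by positivity) hs.le
            _ ≤ _ := by
              refine ENNReal.ofReal_le_ofReal ?_
              rw [Real.mul_rpow (by norm_num) (by positivity)]
              simp only [w, hI i hi, if_true]
              gcongr
              calc (2:ℝ) ^ s ≤ 2 ^ (2:ℝ) := Real.rpow_le_rpow_of_exponent_le (by norm_num) hs2
                _ = 4 := by norm_num
        rw [ENNReal.ofReal_le_ofReal_iff (by
          have : 0 ≤ ∑ Q ∈ I, w Q.1 := Finset.sum_nonneg fun i _ => (hw i.1).le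
          positivity)] at this
        linarith
      · intro z hz
        have hzA : fl η z ∈ A := (hA _).2 ⟨z, hz, rfl⟩
        simp only [mem_iUnion]
        refine ⟨_, Finset.mem_image_of_mem _ (Finset.mem_univ ⟨fl η z, hzA⟩), ?_⟩
        simp only [p, htop' _, if_true]
        exact mem_cube hη z _
      · intro i hi
        refine (cube_diam hη i).trans (ENNReal.ofReal_le_ofReal ?_)
        rw [← hJ]
        have := hI i hi
        gcongr
        norm_num
  · rw [hS]
    set B := Finset.Icc (⌊x.re / (η * 2 ^ j)⌋ - 3) (⌊x.re / (η * 2 ^ j)⌋ + 3) ×ˢ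
      Finset.Icc (⌊x.im / (η * 2 ^ j)⌋ - 3) (⌊x.im / (η * 2 ^ j)⌋ + 3) with hB
    have hcard : B.card = 49 := by
      rw [hB, Finset.card_product, Int.card_Icc, Int.card_Icc]
      ring_nf
      simp
    rw [← Finset.sum_fiberwise_of_maps_to (t := B) (g := p j) (fun q hq => by
      rw [Finset.mem_filter] at hq
      simp only [p, hj, if_true]
      exact par_box hη x j hq.2)]
    calc _ ≤ ∑ Q ∈ B, w j := by
          refine Finset.sum_le_sum fun Q _ => le_trans ?_ (h1 j (by omega) Q)
          unfold fib
          refine Finset.sum_le_sum_of_subset_of_nonneg ?_ fun q _ _ => h0 q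
          intro q hq
          simp only [Finset.mem_filter] at hq ⊢
          exact ⟨Finset.mem_univ _, hq.2⟩
      _ = _ := by
          rw [Finset.sum_const, hcard]
          simp [w, hj]
end

section
theorem frostman {E : Set ℂ} (hE : IsCompact E) {s : ℝ} (hs : 0 < s) (hs2 : s ≤ 2) (h : μH[s] E ≠ 0) :
    ∃ (D M : ℝ) (m0 : ℝ≥0∞), 0 ≤ D ∧ 1 ≤ M ∧ m0 ≠ 0 ∧
    ∀ δ > 0, ∃ ρ, FR s D M ρ ∧ m0 ≤ dens ρ univ ∧ ∀ x, ρ x ≠ 0 → ∃ y ∈ E, dist x y ≤ δ := by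
  obtain ⟨c, hc, hcont⟩ := content h
  obtain ⟨R, hR⟩ := hE.isBounded.subset_closedBall 0
  set δ0 := c / 2 with hδ0
  have hδ0p : 0 < δ0 := by positivity
  refine ⟨196 + (δ0 ^ s)⁻¹, max 1 (R + 4 * δ0), ENNReal.ofReal (min 1 (c / 4)), by positivity, le_max_left _ _, ?_, ?_⟩
  · have : 0 < min 1 (c / 4) := lt_min one_pos (by positivity)
    simpa using this
  intro δ hδ
  obtain ⟨J, hJ⟩ : ∃ J : ℕ, 4 * (δ0 / 2 ^ J) ≤ δ := by
    obtain ⟨J, hJ⟩ := pow_unbounded_of_one_lt (4 * δ0 / δ) (one_lt_two (α := ℝ))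
    refine ⟨J, ?_⟩
    rw [div_lt_iff₀ hδ] at hJ
    rw [← mul_div_assoc, div_le_iff₀ (by positivity)]
    linarith
  set η := δ0 / 2 ^ J with hηdef
  have hη : 0 < η := by positivity
  have hηJ : η * 2 ^ J = δ0 := by rw [hηdef]; field_simp
  have hηδ : η ≤ δ0 := by
    rw [← hηJ]; exact le_mul_of_one_le_right hη.le (one_le_pow₀ one_le_two)
  obtain ⟨A, m, hm0, hmE, hm1, hmc, hmj⟩ := frost_grid hE hs hs2 hc hcont J hη (by rw [hηJ, hδ0]; ring)
  obtain ⟨b, bc, b0, bs, b1, bb⟩ := bump_ex hη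
  let ρ : ℂ → ℝ := fun z => ∑ q ∈ A, m q * b (z - pos η q)
  have hρc : Continuous ρ := by
    refine continuous_finsetSum _ fun q _ => ?_
    fun_prop
  have hρ0 : ∀ x, 0 ≤ ρ x := fun x => Finset.sum_nonneg fun q _ => mul_nonneg (hm0 q) (b0 _)
  have hρs : ∀ x, ρ x ≠ 0 → ∃ y ∈ E, dist x y ≤ 4 * η := by
    intro x hx
    obtain ⟨q, hq, hqx⟩ := Finset.exists_ne_zero_of_sum_ne_zero hx
    obtain ⟨y, hy, hyq⟩ := hmE q hq
    refine ⟨y, hy, ?_⟩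
    have : dist x (pos η q) < 2 * η := by
      rw [dist_eq_norm]
      by_contra h'
      rw [bs _ (not_lt.1 h')] at hqx
      simp at hqx
    linarith [dist_triangle x (pos η q) y]
  have hdens : ∀ B, MeasurableSet B → dens ρ B = ∑ q ∈ A, ENNReal.ofReal (m q) *
      ∫⁻ z in B, ENNReal.ofReal (b (z - pos η q)) := by
    intro B hB
    unfold dens
    rw [withDensity_apply _ hB]
    have : ∀ z, ENNReal.ofReal (ρ z) = ∑ q ∈ A, ENNReal.ofReal (m q) * ENNReal.ofReal (b (z - pos η q)) := by
      intro z
      simp only [ρ]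
      rw [ENNReal.ofReal_sum_of_nonneg fun q _ => mul_nonneg (hm0 q) (b0 _)]
      refine Finset.sum_congr rfl fun q _ => ENNReal.ofReal_mul (hm0 q)
    simp_rw [this]
    have hbm : ∀ q, Measurable fun z => ENNReal.ofReal (b (z - pos η q)) := fun q =>
      (by fun_prop : Continuous fun z => b (z - pos η q)).measurable.ennreal_ofReal
    rw [lintegral_finsetSum _ fun q _ => (hbm q).const_mul _]
    refine Finset.sum_congr rfl fun q _ => ?_
    rw [lintegral_const_mul _ (hbm q)]
  have hb1 : ∀ q, ∫⁻ z, ENNReal.ofReal (b (z - pos η q)) = 1 := by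
    intro q
    rw [lintegral_sub_right_eq_self (fun z => ENNReal.ofReal (b z)), b1]
  have htot : dens ρ univ = ENNReal.ofReal (∑ q ∈ A, m q) := by
    rw [hdens _ MeasurableSet.univ, ENNReal.ofReal_sum_of_nonneg fun q _ => hm0 q]
    refine Finset.sum_congr rfl fun q _ => ?_
    rw [Measure.restrict_univ, hb1, mul_one]
  have hsupp : ∀ x, max 1 (R + 4 * δ0) < ‖x‖ → ρ x = 0 := by
    intro x hx
    by_contra h'
    obtain ⟨y, hy, hxy⟩ := hρs x h'
    have h1 := hR hy
    rw [mem_closedBall, dist_zero_right] at h1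
    rw [dist_eq_norm] at hxy
    have h2 := norm_sub_norm_le x y
    have h3 := (le_max_right 1 (R + 4 * δ0)).trans_lt hx
    linarith
  -- ball estimate
  have hball : ∀ x r L κ : ℝ, ∀ x : ℂ, 0 < r → r + 2 * η ≤ 3 * L → 0 ≤ κ →
      (∀ q, ∫⁻ z in closedBall x r, ENNReal.ofReal (b (z - pos η q)) ≤ ENNReal.ofReal κ) →
      dens ρ (closedBall x r) ≤ ENNReal.ofReal (κ * ∑ q ∈ A with dist (pos η q) x ≤ 3 * L, m q) := by
    intro _ r L κ x hr hL hκ hq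
    rw [hdens _ measurableSet_closedBall, Finset.mul_sum,
      ENNReal.ofReal_sum_of_nonneg fun q _ => mul_nonneg hκ (hm0 q), Finset.sum_filter]
    refine Finset.sum_le_sum fun q _ => ?_
    split_ifs with hd
    · rw [ENNReal.ofReal_mul hκ, mul_comm]
      exact mul_le_mul_left (hq q) _
    · rw [setLIntegral_congr_fun (g := fun _ => 0) measurableSet_closedBall]
      · simp
      · intro z hz
        rw [mem_closedBall] at hz
        have : 2 * η ≤ ‖z - pos η q‖ := by
          rw [← dist_eq_norm]
          push Not at hd
          have := dist_triangle (pos η q) z x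
          rw [dist_comm (pos η q) z] at this
          linarith
        simp [bs _ this]
  refine ⟨ρ, ⟨hρc, hρ0, hsupp, ⟨fun x r hr => ?_, ?_⟩⟩, ?_, fun x hx => ?_⟩
  · have hb1' : ∀ q, ∫⁻ z in closedBall x r, ENNReal.ofReal (b (z - pos η q)) ≤ ENNReal.ofReal 1 := fun q => by
      rw [ENNReal.ofReal_one, ← hb1 q]; exact setLIntegral_le_lintegral _ _
    have hrs : 0 < r ^ s := Real.rpow_pos_of_pos hr s
    rcases lt_or_ge δ0 r with hr1 | hr1
    · refine (measure_mono (subset_univ _)).trans ?_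
      rw [htot]
      refine ENNReal.ofReal_le_ofReal (hm1.trans ?_)
      have h1 : δ0 ^ s ≤ r ^ s := Real.rpow_le_rpow hδ0p.le hr1.le hs.le
      have h2 : 1 ≤ (δ0 ^ s)⁻¹ * r ^ s := by
        rw [← div_eq_inv_mul, le_div_iff₀ (by positivity)]; linarith
      nlinarith
    · suffices h' : dens ρ (closedBall x r) ≤ ENNReal.ofReal (196 * r ^ s) by
        refine h'.trans (ENNReal.ofReal_le_ofReal ?_)
        gcongr
        have : 0 < (δ0 ^ s)⁻¹ := by positivity
        linarith
      rcases lt_or_ge r η with hr2 | hr2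
      · refine (hball 0 r (η * 2 ^ 0) (r ^ 2 / η ^ 2) x hr (by simp; linarith) (by positivity)
          (fun q => bb r hr x _)).trans (ENNReal.ofReal_le_ofReal ?_)
        have h1 := hmj 0 (Nat.zero_le _) x
        calc _ ≤ r ^ 2 / η ^ 2 * (49 * (η * 2 ^ 0) ^ s) := by gcongr
          _ = 49 * (r ^ s * (r ^ (2 - s) / η ^ (2 - s))) := by
            rw [Real.rpow_sub hr, Real.rpow_sub hη]
            have := Real.rpow_pos_of_pos hη s
            simp
            field_simp
          _ ≤ 49 * (r ^ s * 1) := by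
            gcongr
            rw [div_le_one (by positivity)]
            exact Real.rpow_le_rpow hr.le hr2.le (by linarith)
          _ ≤ _ := by linarith
      · obtain ⟨j, hjJ, hj1, hj2⟩ : ∃ j ≤ J, r ≤ η * 2 ^ j ∧ η * 2 ^ j ≤ 2 * r := by
          classical
          have hex : ∃ j : ℕ, r ≤ η * 2 ^ j := ⟨J, by rw [hηJ]; exact hr1⟩
          refine ⟨Nat.find hex, Nat.find_min' hex (by rw [hηJ]; exact hr1), Nat.find_spec hex, ?_⟩
          rcases hf : Nat.find hex with _ | k
          · simp; linarith
          · have := Nat.find_min hex (m := k) (by omega)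
            push Not at this
            rw [pow_succ]; linarith
        have h3 : η ≤ η * 2 ^ j := le_mul_of_one_le_right hη.le (one_le_pow₀ one_le_two)
        refine (hball 0 r (η * 2 ^ j) 1 x hr (by linarith) zero_le_one hb1').trans
          (ENNReal.ofReal_le_ofReal ?_)
        rw [one_mul]
        calc _ ≤ 49 * (η * 2 ^ j) ^ s := hmj j hjJ x
          _ ≤ 49 * (2 * r) ^ s := by gcongr
          _ = 49 * (2 ^ s * r ^ s) := by rw [Real.mul_rpow (by norm_num) hr.le]
          _ ≤ 49 * (4 * r ^ s) := by
            gcongr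
            calc (2:ℝ) ^ s ≤ 2 ^ (2:ℝ) := Real.rpow_le_rpow_of_exponent_le (by norm_num) hs2
              _ = 4 := by norm_num
          _ = _ := by ring
  · have : MeasurableSet {x : ℂ | max 1 (R + 4 * δ0) < ‖x‖} :=
      (isOpen_lt continuous_const continuous_norm).measurableSet
    unfold dens
    rw [withDensity_apply _ this, setLIntegral_congr_fun (g := fun _ => 0) this]
    · simp
    · intro x hx
      simp [hsupp x hx]
  · rw [htot]; exact ENNReal.ofReal_le_ofReal hmc
  · obtain ⟨y, hy, hxy⟩ := hρs x hx
    exact ⟨y, hy, hxy.trans hJ⟩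
end

/-- coordinates -/
def LL : ℂ × ℂ →ₗ[ℝ] (PairIdx 2 → ℝ) where
  toFun w p := if p.1.2 = 1 then w.1.re else if p.1.1 = 0 then w.1.im else w.2.re
  map_add' w w' := by ext p; simp only [Pi.add_apply]; split_ifs <;> simp
  map_smul' c w := by ext p; simp only [Pi.smul_apply]; split_ifs <;> simp

lemma pair_cases (p : PairIdx 2) : p = ⟨(0, 1), by decide⟩ ∨ p = ⟨(0, 2), by decide⟩ ∨ p = ⟨(1, 2), by decide⟩ := by
  revert p; decide

lemma LL_surj : Function.Surjective LL := by
  intro f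
  refine ⟨(⟨f ⟨(0, 1), by decide⟩, f ⟨(0, 2), by decide⟩⟩, ⟨f ⟨(1, 2), by decide⟩, 0⟩), ?_⟩
  ext p
  rcases pair_cases p with rfl | rfl | rfl <;> simp [LL]

lemma TC_sub (E : Set (Pt 2)) : TC (Complex.orthonormalBasisOneI.repr.symm '' E) ⊆ LL ⁻¹' (Tconf 2 2 E) := by
  set e := Complex.orthonormalBasisOneI.repr
  rintro w ⟨_, ⟨x, hx, rfl⟩, _, ⟨y, hy, rfl⟩, _, ⟨z, hz, rfl⟩, hc, h1, h2, h3⟩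
  refine ⟨![x, y, z], ⟨?_, ?_⟩, ?_⟩
  · intro i; fin_cases i <;> simpa
  · unfold Nondeg
    rw [Fintype.linearIndependent_iff]
    intro g hg
    rw [Fin.sum_univ_two] at hg
    have hg' := congrArg e.symm hg
    have e0 : (![x, y, z] : Fin 3 → Pt 2) (Fin.succ 0) = y := rfl
    have e1 : (![x, y, z] : Fin 3 → Pt 2) (Fin.succ 1) = z := rfl
    have e2 : (![x, y, z] : Fin 3 → Pt 2) 0 = x := rfl
    rw [e0, e1, e2, map_add, map_smul, map_smul, map_sub, map_sub, map_zero] at hg'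
    have hr := congrArg Complex.re hg'
    have hi := congrArg Complex.im hg'
    simp only [Complex.add_re, Complex.add_im, Complex.real_smul, Complex.re_ofReal_mul,
      Complex.im_ofReal_mul, Complex.zero_re, Complex.zero_im] at hr hi
    unfold crs at hc
    have k0 : g 0 * ((e.symm y - e.symm x).re * (e.symm z - e.symm x).im -
      (e.symm y - e.symm x).im * (e.symm z - e.symm x).re) = 0 := by
      linear_combination (e.symm z - e.symm x).im * hr - (e.symm z - e.symm x).re * hi
    have k1 : g 1 * ((e.symm y - e.symm x).re * (e.symm z - e.symm x).im -
      (e.symm y - e.symm x).im * (e.symm z - e.symm x).re) = 0 := by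
      linear_combination (e.symm y - e.symm x).re * hi - (e.symm y - e.symm x).im * hr
    intro i
    fin_cases i
    · exact (mul_eq_zero.1 k0).resolve_right hc
    · exact (mul_eq_zero.1 k1).resolve_right hc
  · rw [← map_sub, LinearIsometryEquiv.norm_map] at h1 h2 h3
    ext p
    rcases pair_cases p with rfl | rfl | rfl
    · simp [LL, simplexMap, h1, dist_eq_norm, norm_sub_rev x y]
    · simp [LL, simplexMap, h2, dist_eq_norm, norm_sub_rev x z]
    · simp [LL, simplexMap, h3, dist_eq_norm, norm_sub_rev y z]

theorem stmt3 (E : Set (Pt 2)) (hE : IsCompact E)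
    (hdim : (8 : ℝ≥0∞) / 5 < dimH E) :
    0 < volume (Tconf 2 2 E) := by
  set e := Complex.orthonormalBasisOneI.repr
  set E' := e.symm '' E with hE'
  have hc : IsCompact E' := hE.image e.symm.continuous
  have hd : dimH E' = dimH E := e.symm.isometry.dimH_image E
  obtain ⟨s, hs1, hs2, hsH⟩ : ∃ s : ℝ, 8/5 < s ∧ s ≤ 2 ∧ μH[s] E' ≠ 0 := by
    rw [← hd] at hdim
    obtain ⟨t, ht1, ht2⟩ := ENNReal.lt_iff_exists_nnreal_btwn.1 hdim
    have ht1' : (8 : ℝ) / 5 < t := by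
      have := (ENNReal.toReal_lt_toReal (by finiteness) ENNReal.coe_ne_top).2 ht1
      simpa using this
    refine ⟨((min t 2 : NNReal) : ℝ), ?_, ?_, ?_⟩
    · rw [NNReal.coe_min]
      exact lt_min ht1' (by norm_num)
    · rw [NNReal.coe_min]; exact min_le_right _ _
    · rw [hausdorffMeasure_of_lt_dimH]
      · simp
      · exact lt_of_le_of_lt (by exact_mod_cast min_le_left _ _) ht2
  obtain ⟨D, M, m0, hD, hM, hm0, happ⟩ := frostman hc (by linarith) hs2 hsH
  have hpos := TC_pos (S0_pos hc hm0 hs1 hs2 hD hM happ)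
  rw [pos_iff_ne_zero]
  intro h0
  apply hpos
  refine measure_mono_null (TC_sub E) ?_
  haveI : (volume : Measure (ℂ × ℂ)).IsAddHaarMeasure := by
    rw [Measure.volume_eq_prod]; infer_instance
  obtain ⟨c, -, -, hmap⟩ := LinearMap.exists_map_addHaar_eq_smul_addHaar' LL
    (volume : Measure (ℂ × ℂ)) (volume : Measure (PairIdx 2 → ℝ)) LL_surj
  have hLm : Measurable LL := LL.continuous_of_finiteDimensional.measurable
  refine le_antisymm ((Measure.le_map_apply hLm.aemeasurable _).trans ?_) zero_le
  rw [hmap]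
  simp [h0]
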